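/- Let n be an integer with 7 <= n <= 13 and let q be a prime power such that gcd(q, n) = 1. Then there always exists an element α in F_{q^n}* such that both α and α^{-1} are simultaneously primitive and 1-normal over F_q. -/

import Mathlib

open Polynomial

noncomputable section

/-- The action `h ∘ β = Σ_i a_i β^{q^i}` of a polynomial `h = Σ_i a_i x^i` over `F_q`
on an element `β` of an extension field. -/
def polyAct {Fq F : Type*} [Field Fq] [Field F] [Algebra Fq F]
    (q : ℕ) (h : Fq[X]) (β : F) : F :=
  h.sum fun i a => algebraMap Fq F a * β ^ q ^ i

/-- `h` is the `F_q`-order of `β`: the monic divisor of `x^n - 1` of least degree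
annihilating `β`. -/
def IsFqOrder {Fq F : Type*} [Field Fq] [Field F] [Algebra Fq F]
    (q n : ℕ) (h : Fq[X]) (β : F) : Prop :=
  h.Monic ∧ h ∣ (X ^ n - 1 : Fq[X]) ∧ polyAct q h β = 0 ∧
    ∀ h' : Fq[X], h'.Monic → h' ∣ (X ^ n - 1 : Fq[X]) → polyAct q h' β = 0 →
      h.natDegree ≤ h'.natDegree

/-- `α` is `k`-normal over `F_q`: its `F_q`-order has degree `n - k`. -/
def IsKNormal (Fq : Type*) {F : Type*} [Field Fq] [Field F] [Algebra Fq F]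
    (q n k : ℕ) (α : F) : Prop :=
  ∃ h : Fq[X], IsFqOrder q n h α ∧ h.natDegree = n - k

/-- Polynomials of injective degree are linearly independent: a nontrivial combination is nonzero. -/
theorem sum_C_mul_ne_zero_of_natDegree_injective {k ι : Type*} [Field k] [Fintype ι]
    (P : ι → k[X]) (hP : ∀ i, P i ≠ 0) (hinj : Function.Injective fun i => (P i).natDegree)
    (c : ι → k) (hc : c ≠ 0) : ∑ i, C (c i) * P i ≠ 0 := by
  classical
  obtain ⟨i₀, hi₀⟩ := Function.ne_iff.mp hc
  obtain ⟨i, hi, hmax⟩ := Finset.exists_max_image (Finset.univ.filter fun i => c i ≠ 0)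
    (fun i => (P i).natDegree) ⟨i₀, by simpa using hi₀⟩
  intro h
  have h1 := congrArg (fun f : k[X] => f.coeff (P i).natDegree) h
  simp only [finsetSum_coeff, coeff_C_mul, coeff_zero] at h1
  rw [Finset.sum_eq_single i] at h1
  · have := hP i
    simp at hi h1
    tauto
  · intro j _ hji
    by_cases hcj : c j = 0
    · simp [hcj]
    · have h2 := hmax j (by simpa using hcj)
      have h3 : (P j).natDegree ≠ (P i).natDegree := fun h => hji (hinj h)
      rw [coeff_eq_zero_of_natDegree_lt (by omega), mul_zero]
  · simp

/-- All coefficients of a polynomial over `k[Y]` have degree at most `b`. -/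
def CoeffDegreeLE {k : Type*} [Field k] (b : ℕ) (G : k[X][X]) : Prop :=
  ∀ l, (G.coeff l).natDegree ≤ b

namespace CoeffDegreeLE

variable {k : Type*} [Field k] {a b : ℕ} {G H : k[X][X]}

theorem mono (hG : CoeffDegreeLE a G) (hab : a ≤ b) : CoeffDegreeLE b G :=
  fun l => (hG l).trans hab

theorem add (hG : CoeffDegreeLE b G) (hH : CoeffDegreeLE b H) : CoeffDegreeLE b (G + H) := by
  intro l
  rw [coeff_add]
  exact natDegree_add_le_of_degree_le (hG l) (hH l)

theorem sub (hG : CoeffDegreeLE b G) (hH : CoeffDegreeLE b H) : CoeffDegreeLE b (G - H) := by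
  intro l
  rw [coeff_sub]
  exact (natDegree_sub_le _ _).trans (max_le (hG l) (hH l))

theorem mul (hG : CoeffDegreeLE a G) (hH : CoeffDegreeLE b H) :
    CoeffDegreeLE (a + b) (G * H) := by
  intro l
  rw [coeff_mul]
  refine natDegree_sum_le_of_forall_le _ _ fun x _ => ?_
  exact natDegree_mul_le_of_le (hG _) (hH _)

theorem const (f : k[X]) : CoeffDegreeLE f.natDegree (C f) := by
  intro l
  rw [coeff_C]
  split_ifs <;> simp

theorem scalar (c : k) : CoeffDegreeLE 0 (C (C c)) := by
  simpa using const (C c)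

theorem pow (hG : CoeffDegreeLE b G) (m : ℕ) : CoeffDegreeLE (m * b) (G ^ m) := by
  induction m with
  | zero => simpa using scalar (1 : k)
  | succ m ih =>
    rw [pow_succ, Nat.succ_mul]
    exact ih.mul hG

theorem sum {ι : Type*} (s : Finset ι) {f : ι → k[X][X]} (h : ∀ i ∈ s, CoeffDegreeLE b (f i)) :
    CoeffDegreeLE b (∑ i ∈ s, f i) := by
  intro l
  rw [finsetSum_coeff]
  exact natDegree_sum_le_of_forall_le _ _ fun i hi => h i hi l

theorem C_X_pow (m : ℕ) : CoeffDegreeLE m (C (X ^ m : k[X])) := by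
  simpa using const (X ^ m : k[X])

theorem C_X_add_X_pow (m : ℕ) : CoeffDegreeLE m ((C X + X : k[X][X]) ^ m) := by
  have h : CoeffDegreeLE 1 (C X + X : k[X][X]) := by
    refine add (by simpa using const (X : k[X])) fun l => ?_
    rw [coeff_X]
    split_ifs <;> simp
  simpa using h.pow m

end CoeffDegreeLE

/-- A homogeneous linear system with more unknowns than equations has a nontrivial solution. -/
theorem exists_ne_zero_map_eq_zero {k ι κ : Type*} [Field k] [Fintype ι] [Fintype κ]
    (h : Fintype.card κ < Fintype.card ι) (L : (ι → k) →ₗ[k] (κ → k)) :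
    ∃ c : ι → k, c ≠ 0 ∧ L c = 0 := by
  have h1 : ¬ Function.Injective L := fun hinj => by
    have := LinearMap.finrank_le_finrank_of_injective hinj
    simp at this
    omega
  rw [← LinearMap.ker_eq_bot, Submodule.eq_bot_iff] at h1
  push Not at h1
  obtain ⟨c, hc, hc0⟩ := h1
  exact ⟨c, hc0, hc⟩

/-- Elements of `ι → k[Y][T]` whose coefficients have bounded degree satisfy a nontrivial linear
relation modulo `T ^ M` as soon as `M * D < |ι|`. -/
theorem exists_X_pow_dvd_sum {k ι : Type*} [Field k] [Fintype ι] (M D : ℕ)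
    (G : ι → k[X][X]) (hG : ∀ i l, ((G i).coeff l).natDegree < D)
    (hcard : M * D < Fintype.card ι) :
    ∃ c : ι → k, c ≠ 0 ∧ (X : k[X][X]) ^ M ∣ ∑ i, C (C (c i)) * G i := by
  let L : (ι → k) →ₗ[k] (Fin M × Fin D → k) :=
    { toFun := fun c x => ((∑ i, C (C (c i)) * G i).coeff x.1).coeff x.2
      map_add' := fun c c' => by
        ext x
        simp [add_mul, Finset.sum_add_distrib]
      map_smul' := fun a c => by
        ext x
        simp [mul_assoc, Finset.mul_sum] }
  obtain ⟨c, hc0, hc⟩ := exists_ne_zero_map_eq_zero (by simpa using hcard) L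
  refine ⟨c, hc0, X_pow_dvd_iff.mpr fun l hl => ?_⟩
  ext s
  by_cases hs : s < D
  · simpa [L] using congrFun hc (⟨l, hl⟩, ⟨s, hs⟩)
  · rw [coeff_zero, finsetSum_coeff, finsetSum_coeff]
    refine Finset.sum_eq_zero fun i _ => ?_
    rw [coeff_C_mul, coeff_C_mul, coeff_eq_zero_of_natDegree_lt (by have := hG i l; omega), mul_zero]

/-- A nonzero polynomial vanishing to order `M` on `S` has degree at least `M * |S|`. -/
theorem card_mul_le_natDegree {k : Type*} [Field k] (M : ℕ) (S : Finset k) (F : k[X])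
    (hF : F ≠ 0) (h : ∀ z ∈ S, (X - C z) ^ M ∣ F) : M * S.card ≤ F.natDegree := by
  have h1 : ∏ z ∈ S, (X - C z) ^ M ∣ F := by
    refine Finset.prod_dvd_of_coprime (fun a _ b _ hab => ?_) h
    exact (isCoprime_X_sub_C_of_isUnit_sub (sub_ne_zero.mpr hab).isUnit).pow
  have h2 := natDegree_le_of_dvd h1 hF
  rw [natDegree_prod _ _ fun z _ => pow_ne_zero _ (X_sub_C_ne_zero z)] at h2
  simp only [natDegree_pow, natDegree_X_sub_C, mul_one, Finset.sum_const, smul_eq_mul] at h2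
  rwa [mul_comm]

/-- The polynomial `X ^ (d * J) * Tr (A * X ^ d + B * X ^ (-d))` with `J = p ^ (2 * μ - 1)`, where
`Tr` is the absolute trace polynomial of a field with `p ^ (2 * μ)` elements. -/
def tracePoly {k : Type*} [Field k] (p μ d : ℕ) (A B : k) : k[X] :=
  ∑ i ∈ Finset.range (2 * μ), (C (A ^ p ^ i) * X ^ (d * (p ^ (2 * μ - 1) + p ^ i)) +
    C (B ^ p ^ i) * X ^ (d * (p ^ (2 * μ - 1) - p ^ i)))

/-- The expansion of `tracePoly` around a point `Y` where the trace is `c`, up to a power of `Y`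
and modulo `T ^ (p ^ μ)`. -/
def localTracePoly {k : Type*} [Field k] (p μ d : ℕ) (A B c : k) : k[X][X] :=
  C (C c * X ^ (d * p ^ μ)) + ∑ i ∈ Finset.range μ,
    (C (C (A ^ p ^ i) * X ^ (d * p ^ μ)) * ((C X + X) ^ (d * p ^ i) - C (X ^ (d * p ^ i))) +
      C (C (B ^ p ^ i)) * ((C X + X) ^ (d * (p ^ μ - p ^ i)) - C (X ^ (d * (p ^ μ - p ^ i)))))

section

variable {k : Type*} [Field k] {p μ d : ℕ}

theorem natDegree_tracePoly (hp : p.Prime) (hμ : 0 < μ) (hd : 0 < d) {A : k} (hA : A ≠ 0) (B : k) :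
    (tracePoly p μ d A B).natDegree = 2 * d * p ^ (2 * μ - 1) := by
  have hle : ∀ i ∈ Finset.range (2 * μ), p ^ i ≤ p ^ (2 * μ - 1) := fun i hi =>
    Nat.pow_le_pow_right hp.pos (by rw [Finset.mem_range] at hi; omega)
  have hJ : 0 < p ^ (2 * μ - 1) := pow_pos hp.pos _
  refine natDegree_eq_of_le_of_coeff_ne_zero ?_ ?_
  · refine natDegree_sum_le_of_forall_le _ _ fun i hi => ?_
    have h1 := hle i hi
    refine natDegree_add_le_of_degree_le ((natDegree_C_mul_X_pow_le _ _).trans ?_)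
      ((natDegree_C_mul_X_pow_le _ _).trans ?_)
    · rw [mul_comm 2 d, mul_assoc]
      exact Nat.mul_le_mul_left _ (by omega)
    · rw [mul_comm 2 d, mul_assoc]
      exact Nat.mul_le_mul_left _ (by omega)
  · rw [tracePoly, finsetSum_coeff, Finset.sum_eq_single (2 * μ - 1)]
    · rw [coeff_add, coeff_C_mul_X_pow, coeff_C_mul_X_pow, if_pos (by ring), if_neg]
      · rw [add_zero]
        exact pow_ne_zero _ hA
      · rw [Nat.sub_self, mul_zero]
        have := Nat.mul_pos hd hJ
        rw [mul_assoc]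
        omega
    · intro i hi hne
      have h1 : p ^ i < p ^ (2 * μ - 1) := Nat.pow_lt_pow_right hp.one_lt
        (by rw [Finset.mem_range] at hi; omega)
      rw [coeff_add, coeff_C_mul_X_pow, coeff_C_mul_X_pow, if_neg, if_neg, add_zero]
      · rw [mul_comm 2 d, mul_assoc]
        intro h
        have := Nat.eq_of_mul_eq_mul_left hd h
        omega
      · rw [mul_comm 2 d, mul_assoc]
        intro h
        have := Nat.eq_of_mul_eq_mul_left hd h
        omega
    · intro h
      exact absurd (Finset.mem_range.mpr (by omega)) h

theorem eval_tracePoly [Fact p.Prime] [CharP k p] (A B : k) {z : k} (hz : z ≠ 0) :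
    (tracePoly p μ d A B).eval z = z ^ (d * p ^ (2 * μ - 1)) *
      ∑ i ∈ Finset.range (2 * μ), (A * z ^ d + B * (z ^ d)⁻¹) ^ p ^ i := by
  rw [tracePoly, eval_finsetSum, Finset.mul_sum]
  refine Finset.sum_congr rfl fun i hi => ?_
  have h1 : p ^ i ≤ p ^ (2 * μ - 1) :=
    Nat.pow_le_pow_right (Fact.out : p.Prime).pos (by rw [Finset.mem_range] at hi; omega)
  obtain ⟨r, hr⟩ := Nat.exists_eq_add_of_le h1
  rw [add_pow_char_pow, hr, Nat.add_sub_cancel_left]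
  simp only [eval_add, eval_mul, eval_C, eval_pow, eval_X, mul_pow, mul_add, pow_add]
  have : (z ^ d) ^ p ^ i ≠ 0 := pow_ne_zero _ (pow_ne_zero _ hz)
  rw [inv_pow]
  field_simp
  ring

theorem coeffDegreeLE_localTracePoly (hp : p.Prime) (A B c : k) :
    CoeffDegreeLE (2 * d * p ^ μ) (localTracePoly p μ d A B c) := by
  have hX : ∀ a : k, ∀ m, CoeffDegreeLE m (C (C a * X ^ m : k[X])) := fun a m =>
    (CoeffDegreeLE.const _).mono (natDegree_C_mul_X_pow_le _ _)
  refine CoeffDegreeLE.add ((hX _ _).mono (Nat.mul_le_mul_right _ (by omega))) (CoeffDegreeLE.sum _ fun i hi => ?_)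
  have h1 : p ^ i ≤ p ^ μ := Nat.pow_le_pow_right hp.pos (Finset.mem_range.mp hi).le
  have h2 : ∀ m, CoeffDegreeLE m ((C X + X) ^ m - C (X ^ m) : k[X][X]) := fun m =>
    (CoeffDegreeLE.C_X_add_X_pow m).sub (CoeffDegreeLE.C_X_pow m)
  refine CoeffDegreeLE.add (((hX _ _).mul (h2 _)).mono ?_)
    (((CoeffDegreeLE.scalar _).mul (h2 _)).mono ?_)
  · nlinarith [Nat.mul_le_mul_left d h1]
  · nlinarith [Nat.mul_le_mul_left d (Nat.sub_le (p ^ μ) (p ^ i))]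

/-- Evaluation of `k[Y][T]` at `Y = z`, `T = t`. -/
def evalTwo {R : Type*} [CommRing R] [Algebra k R] (z : k) (t : R) : k[X][X] →+* R :=
  eval₂RingHom ((algebraMap k R).comp (evalRingHom z)) t

theorem aeval_tracePoly_eq {R : Type*} [CommRing R] [Algebra k R] [CharP R p] (hp : p.Prime)
    (hμ : 0 < μ) (A B c z : k) (t : R) (ht : t ^ p ^ μ = 0)
    (hz : (tracePoly p μ d A B).eval z = c * z ^ (d * p ^ (2 * μ - 1))) :
    aeval (algebraMap k R z + t) (tracePoly p μ d A B) =
      algebraMap k R z ^ (d * (p ^ (2 * μ - 1) - p ^ μ)) *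
        evalTwo z t (localTracePoly p μ d A B c) := by
  have := Fact.mk hp
  set y := algebraMap k R z with hy
  set w := y + t with hw
  have hM : ∀ m, p ^ μ ∣ m → w ^ m = y ^ m := by
    rintro _ ⟨m, rfl⟩
    rw [pow_mul, pow_mul, hw, add_pow_char_pow, ht, add_zero]
  have hJ : p ^ μ ∣ p ^ (2 * μ - 1) := pow_dvd_pow _ (by omega)
  have hJle : p ^ μ ≤ p ^ (2 * μ - 1) := Nat.le_of_dvd (pow_pos hp.pos _) hJ
  have hbase : aeval y (tracePoly p μ d A B) = algebraMap k R c * y ^ (d * p ^ (2 * μ - 1)) := by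
    rw [hy, aeval_algebraMap_apply_eq_algebraMap_eval, hz, map_mul, map_pow]
  have key : aeval w (tracePoly p μ d A B) - aeval y (tracePoly p μ d A B) =
      y ^ (d * (p ^ (2 * μ - 1) - p ^ μ)) * ∑ i ∈ Finset.range μ,
        (algebraMap k R (A ^ p ^ i) * y ^ (d * p ^ μ) * (w ^ (d * p ^ i) - y ^ (d * p ^ i)) +
          algebraMap k R (B ^ p ^ i) *
            (w ^ (d * (p ^ μ - p ^ i)) - y ^ (d * (p ^ μ - p ^ i)))) := by
    rw [tracePoly, map_sum, map_sum, ← Finset.sum_sub_distrib, Finset.mul_sum]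
    rw [← Finset.sum_subset (Finset.range_subset_range.mpr (by omega : μ ≤ 2 * μ))]
    · refine Finset.sum_congr rfl fun i hi => ?_
      have h1 : p ^ i ≤ p ^ μ := Nat.pow_le_pow_right hp.pos (Finset.mem_range.mp hi).le
      have e1 : d * (p ^ (2 * μ - 1) + p ^ i) = d * p ^ (2 * μ - 1) + d * p ^ i := by ring
      have e2 : d * (p ^ (2 * μ - 1) - p ^ i) =
          d * (p ^ (2 * μ - 1) - p ^ μ) + d * (p ^ μ - p ^ i) := by
        rw [← mul_add]; congr 1; omega
      have e3 : d * p ^ (2 * μ - 1) = d * (p ^ (2 * μ - 1) - p ^ μ) + d * p ^ μ := by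
        rw [← mul_add]; congr 1; omega
      simp only [map_add, map_mul, map_pow, aeval_C, aeval_X, e1, e2, pow_add]
      rw [hM _ (hJ.mul_left d), hM _ ((Nat.dvd_sub hJ dvd_rfl).mul_left d), e3, pow_add]
      ring
    · intro i hi hi'
      have h1 : p ^ μ ∣ p ^ i := pow_dvd_pow _ (by simpa using hi')
      simp only [map_add, map_mul, map_pow, aeval_C, aeval_X]
      rw [hM _ ((hJ.add h1).mul_left d), hM _ ((Nat.dvd_sub hJ h1).mul_left d), sub_self]
  rw [← sub_add_cancel (aeval w _) (aeval y (tracePoly p μ d A B)), key, hbase, localTracePoly]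
  have e3 : d * p ^ (2 * μ - 1) = d * (p ^ (2 * μ - 1) - p ^ μ) + d * p ^ μ := by
    rw [← mul_add]; congr 1; omega
  simp only [evalTwo, map_add, map_sum, map_mul, map_sub, map_pow, coe_eval₂RingHom, eval₂_C,
    eval₂_X, RingHom.comp_apply, coe_evalRingHom, eval_C, eval_X, ← hy, ← hw]
  rw [e3, pow_add]
  ring

end

section

variable {k : Type*} [Field k]

/-- Vanishing of `F` at a thickened point `z + τ` with `τ ^ M = 0` means vanishing to order `M`. -/
theorem X_sub_C_pow_dvd_of_aeval_eq_zero (M : ℕ) (z : k) (F : k[X])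
    (h : aeval (algebraMap k (AdjoinRoot (X ^ M : k[X])) z + AdjoinRoot.root (X ^ M)) F = 0) :
    (X - C z) ^ M ∣ F := by
  have h1 : aeval (algebraMap k (AdjoinRoot (X ^ M : k[X])) z + AdjoinRoot.root (X ^ M)) F =
      AdjoinRoot.mk (X ^ M) (F.comp (C z + X)) := by
    rw [← AdjoinRoot.aeval_eq, aeval_comp]
    simp
  rw [h1, AdjoinRoot.mk_eq_zero] at h
  have h2 := map_dvd (compRingHom (X - C z)) h
  simpa [comp_assoc] using h2

/-- The exponents occurring in the auxiliary polynomial are pairwise distinct. -/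
theorem stepanov_exponent_injective {p d J I s : ℕ} (hpd : Nat.Coprime d p) :
    Function.Injective fun x : Fin I × Fin p × Fin J =>
      (x.2.2 : ℕ) + J * (x.1 * p + x.2.1 * d) + s := by
  rintro ⟨⟨i, hi⟩, ⟨j, hj⟩, ⟨e, he⟩⟩ ⟨⟨i', hi'⟩, ⟨j', hj'⟩, ⟨e', he'⟩⟩ h
  simp only at h
  have h1 : e + J * (i * p + j * d) = e' + J * (i' * p + j' * d) := by omega
  have h2 : e = e' := by
    have := congrArg (· % J) h1
    simpa [Nat.add_mul_mod_self_left, Nat.mod_eq_of_lt, he, he'] using this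
  subst h2
  have h3 : i * p + j * d = i' * p + j' * d :=
    Nat.eq_of_mul_eq_mul_left (by omega : 0 < J) (by omega)
  have h4 : j = j' := by
    have h5 : j * d ≡ j' * d [MOD p] := by
      have := congrArg (· % p) h3
      simpa [Nat.ModEq, Nat.add_comm (_ * p), Nat.add_mul_mod_self_right] using this
    have := Nat.ModEq.cancel_right_of_coprime hpd.symm h5
    exact Nat.ModEq.eq_of_lt_of_lt this hj hj'
  subst h4
  have h5 : i = i' := Nat.eq_of_mul_eq_mul_right (by omega : 0 < p) (by omega)
  subst h5
  rfl

variable {p μ d : ℕ}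

/-- The local expansion of `X ^ (e + i K + (p - 1 - j) d J) * tracePoly ^ j`. -/
def stepanovLocal (p μ d : ℕ) (A B c : k) (i j e : ℕ) : k[X][X] :=
  (C X + X) ^ e * C (X ^ i) * localTracePoly p μ d A B c ^ j * C (X ^ (d * p ^ μ * (p - 1 - j)))

/-- The global building block of the auxiliary polynomial. -/
def stepanovGlobal (p μ d : ℕ) (A B : k) (i j e : ℕ) : k[X] :=
  X ^ (e + i * p ^ (2 * μ) + (p - 1 - j) * (d * p ^ (2 * μ - 1))) * tracePoly p μ d A B ^ j

theorem coeffDegreeLE_stepanovLocal (hp : p.Prime) (A B c : k) (i j e : ℕ) :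
    CoeffDegreeLE (e + i + j * (2 * d * p ^ μ) + d * p ^ μ * (p - 1 - j))
      (stepanovLocal p μ d A B c i j e) :=
  (((CoeffDegreeLE.C_X_add_X_pow e).mul (CoeffDegreeLE.C_X_pow i)).mul
    ((coeffDegreeLE_localTracePoly hp A B c).pow j)).mul (CoeffDegreeLE.C_X_pow _)

theorem natDegree_stepanovGlobal (hp : p.Prime) (hμ : 0 < μ) (hd : 0 < d) {A : k} (hA : A ≠ 0)
    (B : k) {i j e : ℕ} (hj : j < p) :
    (stepanovGlobal p μ d A B i j e).natDegree =
      e + p ^ (2 * μ - 1) * (i * p + j * d) + (p - 1) * d * p ^ (2 * μ - 1) := by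
  have hJ : 0 < p ^ (2 * μ - 1) := pow_pos hp.pos _
  have hH := natDegree_tracePoly hp hμ hd hA B
  have hH0 : tracePoly p μ d A B ≠ 0 := by
    intro h
    rw [h, natDegree_zero] at hH
    have := Nat.mul_pos (Nat.mul_pos (by omega : 0 < 2) hd) hJ
    omega
  have hK : p ^ (2 * μ) = p ^ (2 * μ - 1) * p := by
    rw [← pow_succ]; congr 1; omega
  rw [stepanovGlobal, natDegree_mul (pow_ne_zero _ X_ne_zero) (pow_ne_zero _ hH0), natDegree_X_pow,
    natDegree_pow, hH, hK]
  obtain ⟨r, hr⟩ : ∃ r, p = j + 1 + r := Nat.exists_eq_add_of_le hj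
  have h1 : p - 1 - j = r := by omega
  have h2 : p - 1 = j + r := by omega
  rw [h1, h2]
  ring

theorem aeval_stepanovGlobal {R : Type*} [CommRing R] [Algebra k R] [CharP R p] (hp : p.Prime)
    (hμ : 0 < μ) (A B c z : k) (t : R) (ht : t ^ p ^ μ = 0) (hzK : z ^ p ^ (2 * μ) = z)
    (hz : (tracePoly p μ d A B).eval z = c * z ^ (d * p ^ (2 * μ - 1))) {i j e : ℕ} (hj : j < p) :
    aeval (algebraMap k R z + t) (stepanovGlobal p μ d A B i j e) =
      algebraMap k R z ^ (d * (p ^ (2 * μ - 1) - p ^ μ) * (p - 1)) *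
        evalTwo z t (stepanovLocal p μ d A B c i j e) := by
  have := Fact.mk hp
  have hM : ∀ m, p ^ μ ∣ m → (algebraMap k R z + t) ^ m = algebraMap k R z ^ m := by
    rintro _ ⟨m, rfl⟩
    rw [pow_mul, pow_mul, add_pow_char_pow, ht, add_zero]
  have hJ : p ^ μ ∣ p ^ (2 * μ - 1) := pow_dvd_pow _ (by omega)
  have hJle : p ^ μ ≤ p ^ (2 * μ - 1) := Nat.le_of_dvd (pow_pos hp.pos _) hJ
  have hK : p ^ μ ∣ p ^ (2 * μ) := pow_dvd_pow _ (by omega)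
  obtain ⟨r, hr⟩ : ∃ r, p = j + 1 + r := Nat.exists_eq_add_of_le hj
  have h1 : p - 1 - j = r := by omega
  have h2 : p - 1 = r + j := by omega
  rw [stepanovGlobal, stepanovLocal, map_mul, map_pow, map_pow, aeval_X, pow_add, pow_add,
    aeval_tracePoly_eq hp hμ A B c z t ht hz, hM _ (hK.mul_left i),
    hM _ ((hJ.mul_left d).mul_left _), h1, h2, mul_comm i, pow_mul _ _ i, ← map_pow, hzK]
  have e3 : r * (d * p ^ (2 * μ - 1)) =
      d * (p ^ (2 * μ - 1) - p ^ μ) * r + d * p ^ μ * r := by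
    rw [← add_mul, ← mul_add, Nat.sub_add_cancel hJle]; ring
  rw [e3, pow_add, mul_add, pow_add, mul_pow, ← pow_mul]
  have ev : evalTwo z t (C X + X) = algebraMap k R z + t := by simp [evalTwo]
  have ev2 : ∀ m, evalTwo z t (C (X ^ m)) = algebraMap k R z ^ m := by
    intro m
    rw [evalTwo, coe_eval₂RingHom, eval₂_C]
    simp
  rw [map_mul, map_mul, map_mul, map_pow (evalTwo z t) (C X + X),
    map_pow (evalTwo z t) (localTracePoly _ _ _ _ _ _), ev, ev2, ev2]
  ring

theorem stepanov_bound [Fintype k] [DecidableEq k] [CharP k p] (hp : p.Prime)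
    (hμ : 0 < μ) (hcard : Fintype.card k = p ^ (2 * μ)) (hd : 0 < d) (hpd : Nat.Coprime d p)
    (hM : 2 * d * p + 2 < p ^ μ) {A : k} (hA : A ≠ 0) (B c : k) :
    (Finset.univ.filter fun z : k => z ≠ 0 ∧
      ∑ i ∈ Finset.range (2 * μ), (A * z ^ d + B * (z ^ d)⁻¹) ^ p ^ i = c).card ≤
        p ^ (2 * μ - 1) + (2 * d * p + 2 * d + 2) * p ^ μ := by
  have := Fact.mk hp
  set S := Finset.univ.filter fun z : k => z ≠ 0 ∧
      ∑ i ∈ Finset.range (2 * μ), (A * z ^ d + B * (z ^ d)⁻¹) ^ p ^ i = c with hS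
  obtain ⟨m, rfl⟩ : ∃ m, μ = m + 1 := ⟨μ - 1, by omega⟩
  set M := p ^ (m + 1) with hMdef
  set J := p ^ (2 * (m + 1) - 1) with hJdef
  set I := p ^ m + (2 * d * p + 2) with hIdef
  have hm : 0 < p ^ m := pow_pos hp.pos _
  have hMm : M = p * p ^ m := by rw [hMdef, pow_succ, mul_comm]
  have hJM : J = p ^ m * M := by
    rw [hJdef, hMdef, ← pow_add]; congr 1; omega
  have hKJ : p ^ (2 * (m + 1)) = p * J := by
    rw [hJdef, ← pow_succ']; congr 1
  have hMpos : 0 < M := pow_pos hp.pos _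
  have hJpos : 0 < J := pow_pos hp.pos _
  have hp2 : 2 ≤ p := hp.two_le
  have hmM : p ^ m ≤ M := by rw [hMm]; nlinarith
  let G : Fin I × Fin p × Fin J → k[X][X] := fun x =>
    stepanovLocal p (m + 1) d A B c x.1 x.2.1 x.2.2
  let P : Fin I × Fin p × Fin J → k[X] := fun x =>
    stepanovGlobal p (m + 1) d A B x.1 x.2.1 x.2.2
  have hPdeg : ∀ x, (P x).natDegree = x.2.2 + J * (x.1 * p + x.2.1 * d) + (p - 1) * d * J :=
    fun x => natDegree_stepanovGlobal hp hμ hd hA B x.2.1.2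
  obtain ⟨γ, hγ0, hγ⟩ := exists_X_pow_dvd_sum M (J + I + 2 * d * M * p) G (by
    intro x l
    refine lt_of_le_of_lt (coeffDegreeLE_stepanovLocal hp A B c _ _ _ l) ?_
    have h1 := x.1.2
    have h2 := x.2.1.2
    have h3 := x.2.2.2
    obtain ⟨r, hr⟩ : ∃ r, p = x.2.1 + 1 + r := Nat.exists_eq_add_of_le h2
    have h4 : p - 1 - x.2.1 = r := by omega
    rw [h4, ← hMdef]
    have h5 : 2 * d * M * p = 2 * (d * M) * x.2.1 + 2 * (d * M) + 2 * (d * M * r) := by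
      conv_lhs => rw [hr]
      ring
    have h6 : (x.2.1 : ℕ) * (2 * d * M) = 2 * (d * M) * x.2.1 := by ring
    rw [h5, h6]
    omega) (by
    simp only [Fintype.card_prod, Fintype.card_fin]
    have h1 : I * (p * J) = M * J + (2 * d * p + 2) * (M * M) := by
      rw [hIdef, hJM]
      nth_rewrite 4 [hMm]
      nth_rewrite 4 [hMm]
      ring_nf
      rw [hMm]; ring
    rw [h1, hIdef]
    nlinarith [mul_pos hMpos hMpos])
  set F : k[X] := ∑ x, C (γ x) * P x with hF
  have hF0 : F ≠ 0 := by
    refine sum_C_mul_ne_zero_of_natDegree_injective P (fun x hx => ?_) ?_ γ hγ0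
    · have h1 := hPdeg x
      rw [hx, natDegree_zero] at h1
      have h2 : 0 < (p - 1) * d * J := Nat.mul_pos (Nat.mul_pos (by omega) hd) hJpos
      omega
    · simp only [hPdeg]
      exact stepanov_exponent_injective hpd
  have hdeg : F.natDegree ≤ (I + 2 * d) * (p * J) := by
    refine natDegree_sum_le_of_forall_le _ _ fun x _ => (natDegree_C_mul_le _ _).trans ?_
    rw [hPdeg]
    have h1 : (x.1 : ℕ) + 1 ≤ I := x.1.2
    have h2 : (x.2.1 : ℕ) + 1 ≤ p := x.2.1.2
    have h3 := x.2.2.2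
    have h4 : J * (x.1 * p + x.2.1 * d) ≤ J * ((I - 1) * p + (p - 1) * d) := by
      gcongr <;> omega
    have h5 : J * ((I - 1) * p + (p - 1) * d) + (p - 1) * d * J + J ≤ (I + 2 * d) * (p * J) := by
      obtain ⟨I', hI'⟩ : ∃ I', I = I' + 1 := ⟨I - 1, by omega⟩
      obtain ⟨p', hp'⟩ : ∃ p', p = p' + 1 := ⟨p - 1, by omega⟩
      rw [hI', show p - 1 = p' by omega, Nat.add_sub_cancel]
      nlinarith [Nat.zero_le (d * J), Nat.zero_le (p' * J)]
    omega
  have hdvd : ∀ z ∈ S, (X - C z) ^ M ∣ F := by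
    intro z hz
    rw [hS, Finset.mem_filter] at hz
    have hev := eval_tracePoly (p := p) (μ := m + 1) (d := d) A B hz.2.1
    rw [hz.2.2, mul_comm] at hev
    refine X_sub_C_pow_dvd_of_aeval_eq_zero M z F ?_
    have hnt : Nontrivial (AdjoinRoot (X ^ M : k[X])) := AdjoinRoot.nontrivial _ (by
      rw [degree_X_pow]; exact_mod_cast hMpos.ne')
    have hch : CharP (AdjoinRoot (X ^ M : k[X])) p :=
      charP_of_injective_algebraMap (algebraMap k _).injective p
    set t : AdjoinRoot (X ^ M : k[X]) := AdjoinRoot.root (X ^ M)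
    have ht : t ^ M = 0 := by
      have := AdjoinRoot.eval₂_root (X ^ M : k[X])
      simpa using this
    have hzK : z ^ p ^ (2 * (m + 1)) = z := by rw [← hcard, FiniteField.pow_card]
    have key : evalTwo z t (∑ x, C (C (γ x)) * G x) = 0 := by
      obtain ⟨W, hW⟩ := hγ
      rw [hW, map_mul, map_pow]
      simp [evalTwo, ht]
    rw [hF, map_sum]
    have : ∀ x, aeval (algebraMap k _ z + t) (C (γ x) * P x) =
        algebraMap k _ z ^ (d * (p ^ (2 * (m + 1) - 1) - p ^ (m + 1)) * (p - 1)) *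
          evalTwo z t (C (C (γ x)) * G x) := by
      intro x
      rw [map_mul, aeval_C, aeval_stepanovGlobal hp hμ A B c z t ht hzK hev x.2.1.2, map_mul]
      simp only [evalTwo, coe_eval₂RingHom, eval₂_C, RingHom.comp_apply, coe_evalRingHom, eval_C, G]
      ring
    simp only [this]
    rw [← Finset.mul_sum, ← map_sum, key, mul_zero]
  have h1 := (card_mul_le_natDegree M S F hF0 hdvd).trans hdeg
  have h2 : (I + 2 * d) * (p * J) = M * (J + (2 * d * p + 2 * d + 2) * M) := by
    rw [hIdef, hJM]
    have : p * (p ^ m * M) = M * M := by rw [hMm]; ring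
    rw [this]; ring
  rw [h2] at h1
  exact Nat.le_of_mul_le_mul_left h1 hMpos

end

/-- A sum of a nontrivial additive character over a function with nearly equidistributed values. -/
theorem norm_sum_addChar_le_of_card_fiber_le {α G : Type*} [AddCommGroup G] [Fintype G]
    [DecidableEq G] (s : Finset α) (f : α → G) (e : AddChar G ℂ) (he : e ≠ 1) (U : ℕ)
    (hU : ∀ c, (s.filter fun z => f z = c).card ≤ U) :
    ‖∑ z ∈ s, e (f z)‖ ≤ (Fintype.card G : ℝ) * U - s.card := by
  have h0 : ∑ c : G, e c = 0 := by
    classical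
    rw [AddChar.sum_eq_ite, if_neg]
    exact he
  have h1 : ∑ z ∈ s, e (f z) = ∑ c : G, ((s.filter fun z => f z = c).card : ℂ) * e c := by
    rw [← Finset.sum_fiberwise_of_maps_to (t := Finset.univ) (g := f) (by simp)]
    refine Finset.sum_congr rfl fun c _ => ?_
    rw [Finset.sum_congr rfl (g := fun _ => e c), Finset.sum_const, nsmul_eq_mul]
    intro z hz
    rw [(Finset.mem_filter.mp hz).2]
  have h2 : ∑ z ∈ s, e (f z) =
      -∑ c : G, ((U : ℂ) - (s.filter fun z => f z = c).card) * e c := by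
    simp only [sub_mul, Finset.sum_sub_distrib, ← Finset.mul_sum, h0, ← h1]
    simp
  have h3 : (s.card : ℝ) = ∑ c : G, ((s.filter fun z => f z = c).card : ℝ) := by
    rw [Finset.card_eq_sum_card_fiberwise (f := f) (t := Finset.univ) (by simp)]
    push_cast
    rfl
  rw [h2, norm_neg, h3]
  refine (norm_sum_le _ _).trans (le_of_eq ?_)
  rw [← nsmul_eq_mul, ← Finset.card_univ, ← Finset.sum_const, ← Finset.sum_sub_distrib]
  refine Finset.sum_congr rfl fun c _ => ?_
  rw [norm_mul, AddChar.norm_apply, mul_one]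
  have h4 : (U : ℂ) - (s.filter fun z => f z = c).card =
      ((U - (s.filter fun z => f z = c).card : ℕ) : ℂ) := by
    rw [Nat.cast_sub (hU c)]
  rw [h4, Complex.norm_natCast, Nat.cast_sub (hU c)]

theorem norm_sum_trace_pow_le {k : Type*} [Field k] [Fintype k] [DecidableEq k] {p μ d : ℕ}
    [Fact p.Prime] [Algebra (ZMod p) k] (hμ : 0 < μ) (hcard : Fintype.card k = p ^ (2 * μ))
    (hd : 0 < d) (hpd : Nat.Coprime d p) (hM : 2 * d * p + 2 < p ^ μ) {A : k} (hA : A ≠ 0) (B : k)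
    (e : AddChar (ZMod p) ℂ) (he : e ≠ 1) :
    ‖∑ z ∈ Finset.univ.filter fun z : k => z ≠ 0,
      e (Algebra.trace (ZMod p) k (A * z ^ d + B * (z ^ d)⁻¹))‖ ≤
        ((2 * d * p + 2 * d + 2) * p + 1 : ℕ) * (p ^ μ : ℕ) := by
  have hp : p.Prime := Fact.out
  have hch : CharP k p := charP_of_injective_algebraMap (algebraMap (ZMod p) k).injective p
  have hfr : Module.finrank (ZMod p) k = 2 * μ := by
    have := Module.card_eq_pow_finrank (K := ZMod p) (V := k)
    rw [hcard, ZMod.card] at this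
    exact (Nat.pow_right_injective hp.two_le this).symm
  refine (norm_sum_addChar_le_of_card_fiber_le _ _ e he
    (p ^ (2 * μ - 1) + (2 * d * p + 2 * d + 2) * p ^ μ) fun c => ?_).trans ?_
  · refine le_trans (le_of_eq ?_) (stepanov_bound hp hμ hcard hd hpd hM hA B (algebraMap _ k c))
    rw [Finset.filter_filter]
    congr 1
    ext z
    simp only [Finset.mem_filter, Finset.mem_univ, true_and]
    rw [← (algebraMap (ZMod p) k).injective.eq_iff, FiniteField.algebraMap_trace_eq_sum_pow, hfr]
    simp
  · have h1 : (Finset.univ.filter fun z : k => z ≠ 0).card + 1 = p ^ (2 * μ) := by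
      rw [Finset.filter_ne' Finset.univ (0 : k), Finset.card_erase_of_mem (Finset.mem_univ _),
        Finset.card_univ, hcard]
      have := pow_pos hp.pos (2 * μ)
      omega
    have h2 : p ^ (2 * μ) = p * p ^ (2 * μ - 1) := by
      rw [← pow_succ']; congr 1; omega
    have h3 : 1 ≤ p ^ μ := pow_pos hp.pos _
    rw [ZMod.card, sub_le_iff_le_add]
    norm_cast
    nlinarith

/-- If the power sums of `u` and `v` are bounded, then `u` lies in the closed unit disc. -/
theorem norm_le_one_of_norm_pow_add_pow_le {u v : ℂ} {c : ℝ} {j₀ : ℕ}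
    (h : ∀ j ≥ j₀, ‖u ^ j + v ^ j‖ ≤ c) : ‖u‖ ≤ 1 := by
  have bdd : ∀ (x : ℝ) (c' : ℝ), (∀ j ≥ j₀, x ^ j ≤ c') → x ≤ 1 := by
    intro x c' hx
    by_contra! hlt
    obtain ⟨j, hj⟩ := pow_unbounded_of_one_lt c' hlt
    have h1 : x ^ j ≤ x ^ (max j j₀) := pow_le_pow_right₀ hlt.le (le_max_left _ _)
    have := hx _ (le_max_right j j₀)
    linarith
  have huv : ‖u * v‖ ≤ 1 := by
    refine bdd _ ((c ^ 2 + c) / 2) fun j hj => ?_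
    have h1 : 2 * (u * v) ^ j = (u ^ j + v ^ j) ^ 2 - (u ^ (2 * j) + v ^ (2 * j)) := by
      rw [mul_pow]; ring
    have h2 : ‖2 * (u * v) ^ j‖ ≤ c ^ 2 + c := by
      rw [h1]
      refine (norm_sub_le _ _).trans (add_le_add ?_ (h _ (by omega)))
      rw [norm_pow]
      exact pow_le_pow_left₀ (norm_nonneg _) (h j hj) 2
    rw [norm_mul, norm_pow, Complex.norm_ofNat] at h2
    linarith
  by_contra! hu
  have hv : ‖v‖ ≤ 1 := by
    rw [norm_mul] at huv
    nlinarith [norm_nonneg v]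
  refine absurd (bdd ‖u‖ (c + 1) fun j hj => ?_) (not_le.mpr hu)
  have h1 : ‖u ^ j‖ ≤ ‖u ^ j + v ^ j‖ + ‖v ^ j‖ := by
    simpa using norm_sub_le (u ^ j + v ^ j) (v ^ j)
  rw [norm_pow, norm_pow] at h1
  have := pow_le_one₀ (norm_nonneg v) hv (n := j)
  linarith [h j hj]

/-- A sequence obeying Newton's identities for a quadratic polynomial whose even terms are
`O(Q ^ (k / 2))` has first term at most `2 √Q`. -/
theorem norm_le_two_mul_sqrt_of_newton {s : ℕ → ℂ} {a₁ a₂ : ℂ} {Q c : ℝ} {j₀ : ℕ} (hQ : 0 < Q)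
    (h1 : a₁ = s 1) (h2 : 2 * a₂ = s 1 * a₁ + s 2)
    (h3 : ∀ k, s (k + 3) = -(a₁ * s (k + 2) + a₂ * s (k + 1)))
    (hb : ∀ j ≥ j₀, ‖s (2 * j)‖ ≤ c * Q ^ j) : ‖s 1‖ ≤ 2 * Real.sqrt Q := by
  obtain ⟨δ, hδ⟩ := IsAlgClosed.exists_pow_nat_eq (a₁ ^ 2 - 4 * a₂) (n := 2) (by norm_num)
  obtain ⟨u, hu⟩ : ∃ u, u = (-a₁ + δ) / 2 := ⟨_, rfl⟩
  obtain ⟨v, hv⟩ : ∃ v, v = (-a₁ - δ) / 2 := ⟨_, rfl⟩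
  have hsum : u + v = -a₁ := by rw [hu, hv]; ring
  have hprod : u * v = a₂ := by rw [hu, hv]; linear_combination (-1 / 4 : ℂ) * hδ
  have hs : ∀ k, s (k + 1) = -(u ^ (k + 1) + v ^ (k + 1)) ∧
      s (k + 2) = -(u ^ (k + 2) + v ^ (k + 2)) := by
    intro k
    induction k with
    | zero =>
      refine ⟨?_, ?_⟩
      · simp only [zero_add, pow_one]
        rw [hsum, ← h1, neg_neg]
      · simp only [zero_add]
        have e : u ^ 2 + v ^ 2 = (u + v) ^ 2 - 2 * (u * v) := by ring
        rw [e, hsum, hprod, h2, h1]; ring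
    | succ k ih =>
      refine ⟨ih.2, ?_⟩
      rw [show k + 1 + 2 = k + 3 by ring, h3, ih.1, ih.2]
      have e : a₁ = -(u + v) := by rw [hsum, neg_neg]
      rw [e, ← hprod]; ring
  have key : ∀ x y : ℂ, (∀ k, s (k + 2) = -(x ^ (k + 2) + y ^ (k + 2))) → ‖x‖ ≤ Real.sqrt Q := by
    intro x y hxy
    have h4 : ‖x ^ 2 / (Q : ℂ)‖ ≤ 1 := by
      refine norm_le_one_of_norm_pow_add_pow_le (v := y ^ 2 / (Q : ℂ)) (c := c) (j₀ := j₀ + 1) ?_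
      intro j hj
      have h5 := hb j (by omega)
      obtain ⟨i, rfl⟩ : ∃ i, j = i + 1 := ⟨j - 1, by omega⟩
      rw [show 2 * (i + 1) = 2 * i + 2 by ring, hxy, norm_neg] at h5
      rw [div_pow, div_pow, ← add_div, norm_div, norm_pow, Complex.norm_real,
        Real.norm_of_nonneg hQ.le, div_le_iff₀ (pow_pos hQ _), ← pow_mul, ← pow_mul]
      exact h5
    rw [norm_div, norm_pow, Complex.norm_real, Real.norm_of_nonneg hQ.le, div_le_one hQ] at h4
    exact Real.le_sqrt_of_sq_le h4
  have hu1 := key u v fun k => (hs k).2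
  have hv1 := key v u fun k => by rw [(hs k).2, add_comm]
  have := (hs 0).1
  simp only [zero_add, pow_one] at this
  rw [this, norm_neg]
  linarith [norm_add_le u v]

section

variable {E : Type*} [Field E] [Fintype E]

open scoped Classical in
/-- The monic polynomials of degree `n` over a finite field. -/
def monics (E : Type*) [Field E] [Fintype E] (n : ℕ) : Finset E[X] :=
  (Finset.univ : Finset (Fin n → E)).image fun c => X ^ n + ∑ i : Fin n, C (c i) * X ^ (i : ℕ)

theorem mem_monics {n : ℕ} {f : E[X]} : f ∈ monics E n ↔ f.Monic ∧ f.natDegree = n := by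
  simp only [monics, Finset.mem_image, Finset.mem_univ, true_and]
  constructor
  · rintro ⟨c, rfl⟩
    have h := degree_sum_fin_lt c
    exact ⟨monic_X_pow_add h, by
      rw [natDegree_eq_of_degree_eq_some]
      rw [degree_add_eq_left_of_degree_lt (by rwa [degree_X_pow]), degree_X_pow]⟩
  · rintro ⟨hf, rfl⟩
    refine ⟨fun i => f.coeff i, ?_⟩
    conv_rhs => rw [hf.as_sum]
    rw [Finset.sum_range]

open scoped Classical in
/-- The monic irreducible polynomials of degree `n` over a finite field. -/
def monicIrreducibles (E : Type*) [Field E] [Fintype E] (n : ℕ) : Finset E[X] :=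
  (monics E n).filter Irreducible

theorem mem_monicIrreducibles {n : ℕ} {f : E[X]} :
    f ∈ monicIrreducibles E n ↔ f.Monic ∧ f.natDegree = n ∧ Irreducible f := by
  simp [monicIrreducibles, mem_monics, and_assoc]

open scoped Classical in
/-- The degree of a monic polynomial counted through prime power divisors. -/
theorem natDegree_eq_sum_pow_dvd {f : E[X]} (hf : f.Monic) :
    f.natDegree = ∑ k ∈ Finset.Icc 1 f.natDegree, ∑ d ∈ k.divisors,
      ∑ P ∈ monicIrreducibles E d, if P ^ (k / d) ∣ f then d else 0 := by
  set S := UniqueFactorizationMonoid.normalizedFactors f with hS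
  have hf0 : f ≠ 0 := hf.ne_zero
  have hprod : S.prod = f := by
    have h1 := UniqueFactorizationMonoid.prod_normalizedFactors_eq hf0
    rw [h1, hf.normalize_eq_self]
  have hmon : ∀ P ∈ S, P.Monic := fun P hP => by
    have h1 := UniqueFactorizationMonoid.normalize_normalized_factor P hP
    rw [← h1]
    exact monic_normalize (UniqueFactorizationMonoid.irreducible_of_normalized_factor P hP).ne_zero
  have hdeg : f.natDegree = ∑ P ∈ S.toFinset, ∑ _e ∈ Finset.Icc 1 (S.count P), P.natDegree := by
    conv_lhs => rw [← hprod]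
    rw [natDegree_multiset_prod_of_monic _ hmon, Finset.sum_multiset_map_count]
    simp
  have hcount : ∀ P, P.Monic → Irreducible P → ∀ e, (P ^ e ∣ f ↔ e ≤ S.count P) := by
    intro P hPm hP e
    rw [UniqueFactorizationMonoid.dvd_iff_normalizedFactors_le_normalizedFactors
      (pow_ne_zero _ hP.ne_zero) hf0, UniqueFactorizationMonoid.normalizedFactors_pow,
      UniqueFactorizationMonoid.normalizedFactors_irreducible hP, hPm.normalize_eq_self,
      Multiset.nsmul_singleton, Multiset.le_count_iff_replicate_le]
  have hrhs : (∑ k ∈ Finset.Icc 1 f.natDegree, ∑ d ∈ k.divisors,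
      ∑ P ∈ monicIrreducibles E d, if P ^ (k / d) ∣ f then d else 0) =
      ∑ k ∈ Finset.Icc 1 f.natDegree, ∑ d ∈ k.divisors,
        ∑ P ∈ (monicIrreducibles E d).filter (fun P => P ^ (k / d) ∣ f), d := by
    simp only [Finset.sum_filter]
  rw [hrhs]
  conv_lhs => rw [hdeg]
  simp only [Finset.sum_sigma']
  refine Finset.sum_bij' (fun x _ => ⟨x.2 * x.1.natDegree, x.1.natDegree, x.1⟩)
    (fun x _ => ⟨x.2.2, x.1 / x.2.1⟩) ?_ ?_ ?_ ?_ ?_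
  · rintro ⟨P, e⟩ h
    simp only [Finset.mem_sigma, Multiset.mem_toFinset, Finset.mem_Icc, Nat.mem_divisors,
      Finset.mem_filter, mem_monicIrreducibles] at h ⊢
    obtain ⟨hP, he1, he2⟩ := h
    have hPi := UniqueFactorizationMonoid.irreducible_of_normalized_factor P hP
    have hPpos : 0 < P.natDegree := hPi.natDegree_pos
    have hdvd := (hcount P (hmon P hP) hPi e).mpr he2
    have hle := natDegree_le_of_dvd hdvd hf0
    rw [natDegree_pow] at hle
    have hpos := Nat.mul_pos he1 hPpos
    rw [Nat.mul_div_cancel _ hPpos]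
    exact ⟨⟨hpos, hle⟩, ⟨Dvd.intro_left _ rfl, hpos.ne'⟩, ⟨hmon P hP, trivial, hPi⟩, hdvd⟩
  · rintro ⟨k, d, P⟩ h
    simp only [Finset.mem_sigma, Multiset.mem_toFinset, Finset.mem_Icc, Nat.mem_divisors,
      Finset.mem_filter, mem_monicIrreducibles] at h ⊢
    obtain ⟨⟨hk1, hk2⟩, ⟨hdk, -⟩, ⟨hPm, hPd, hPi⟩, hdvd⟩ := h
    have h1 := (hcount P hPm hPi _).mp hdvd
    have h2 : 1 ≤ k / d := Nat.div_pos (Nat.le_of_dvd hk1 hdk) (Nat.pos_of_dvd_of_pos hdk hk1)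
    exact ⟨Multiset.count_pos.mp (by omega), h2, h1⟩
  · rintro ⟨P, e⟩ h
    simp only [Finset.mem_sigma, Multiset.mem_toFinset, Finset.mem_Icc] at h
    have hPi := UniqueFactorizationMonoid.irreducible_of_normalized_factor P h.1
    simp [Nat.mul_div_cancel _ hPi.natDegree_pos]
  · rintro ⟨k, d, P⟩ h
    simp only [Finset.mem_sigma, Finset.mem_Icc, Nat.mem_divisors,
      Finset.mem_filter, mem_monicIrreducibles] at h ⊢
    obtain ⟨-, ⟨hdk, -⟩, ⟨-, rfl, -⟩, -⟩ := h
    rw [Nat.div_mul_cancel hdk]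
  · simp

/-- The sum of `lam` over monic polynomials of degree `n`. -/
def monicSum (lam : E[X] → ℂ) (n : ℕ) : ℂ := ∑ f ∈ monics E n, lam f

/-- The von Mangoldt type sum `Σ_{deg P ∣ k} deg P * lam P ^ (k / deg P)`. -/
def mangoldtSum (lam : E[X] → ℂ) (k : ℕ) : ℂ :=
  ∑ d ∈ k.divisors, ∑ P ∈ monicIrreducibles E d, d * lam P ^ (k / d)

/-- Newton's identities for the `L`-function of a completely multiplicative function. -/
theorem mul_monicSum_eq {lam : E[X] → ℂ} (h1 : lam 1 = 1)
    (hmul : ∀ f g, f.Monic → g.Monic → lam (f * g) = lam f * lam g) (n : ℕ) :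
    n * monicSum lam n = ∑ k ∈ Finset.Icc 1 n, mangoldtSum lam k * monicSum lam (n - k) := by
  classical
  have hpow : ∀ P : E[X], P.Monic → ∀ e, lam (P ^ e) = lam P ^ e := by
    intro P hP e
    induction e with
    | zero => simpa using h1
    | succ e ih => rw [pow_succ, hmul _ _ (hP.pow e) hP, ih, pow_succ]
  have key : ∀ k ∈ Finset.Icc 1 n, ∀ d ∈ k.divisors, ∀ P ∈ monicIrreducibles E d,
      ∑ f ∈ monics E n, ((if P ^ (k / d) ∣ f then d else 0 : ℕ) : ℂ) * lam f =
        d * lam P ^ (k / d) * monicSum lam (n - k) := by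
    intro k hk d hd P hP
    rw [mem_monicIrreducibles] at hP
    obtain ⟨hPm, hPd, -⟩ := hP
    have hPe : (P ^ (k / d)).natDegree = k := by
      rw [hPm.natDegree_pow, hPd, Nat.div_mul_cancel (Nat.dvd_of_mem_divisors hd)]
    have hkn := (Finset.mem_Icc.mp hk).2
    simp only [Nat.cast_ite, Nat.cast_zero, ite_mul, zero_mul]
    rw [← Finset.sum_filter, monicSum, Finset.mul_sum]
    symm
    refine Finset.sum_bij (fun g _ => P ^ (k / d) * g) ?_ ?_ ?_ ?_
    · intro g hg
      rw [mem_monics] at hg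
      rw [Finset.mem_filter, mem_monics]
      refine ⟨⟨(hPm.pow _).mul hg.1, ?_⟩, Dvd.intro _ rfl⟩
      rw [(hPm.pow _).natDegree_mul hg.1, hPe, hg.2]
      omega
    · intro g _ g' _ h
      exact mul_left_cancel₀ (hPm.pow _).ne_zero h
    · intro f hf
      rw [Finset.mem_filter, mem_monics] at hf
      obtain ⟨⟨hfm, hfd⟩, g, rfl⟩ := hf
      have hgm : g.Monic := (hPm.pow _).of_mul_monic_left hfm
      refine ⟨g, ?_, rfl⟩
      rw [mem_monics]
      rw [(hPm.pow _).natDegree_mul hgm, hPe] at hfd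
      exact ⟨hgm, by omega⟩
    · intro g hg
      rw [hmul _ _ (hPm.pow _) (mem_monics.mp hg).1, hpow P hPm]
      ring
  calc (n : ℂ) * monicSum lam n
      = ∑ f ∈ monics E n, (∑ k ∈ Finset.Icc 1 n, ∑ d ∈ k.divisors,
          ∑ P ∈ monicIrreducibles E d, ((if P ^ (k / d) ∣ f then d else 0 : ℕ) : ℂ)) * lam f := by
        rw [monicSum, Finset.mul_sum]
        refine Finset.sum_congr rfl fun f hf => ?_
        obtain ⟨hfm, rfl⟩ := mem_monics.mp hf
        congr 1
        exact_mod_cast natDegree_eq_sum_pow_dvd hfm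
    _ = ∑ k ∈ Finset.Icc 1 n, ∑ d ∈ k.divisors, ∑ P ∈ monicIrreducibles E d,
          ∑ f ∈ monics E n, ((if P ^ (k / d) ∣ f then d else 0 : ℕ) : ℂ) * lam f := by
        simp only [Finset.sum_mul]
        rw [Finset.sum_comm]
        refine Finset.sum_congr rfl fun k _ => ?_
        rw [Finset.sum_comm]
        refine Finset.sum_congr rfl fun d _ => ?_
        rw [Finset.sum_comm]
    _ = _ := by
        refine Finset.sum_congr rfl fun k hk => ?_
        rw [mangoldtSum, Finset.sum_mul]
        refine Finset.sum_congr rfl fun d hd => ?_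
        rw [Finset.sum_mul]
        exact Finset.sum_congr rfl fun P hP => key k hk d hd P hP

end

section

variable {E : Type*} [Field E]

/-- The completely multiplicative function on monic polynomials attached to the twisted Kloosterman
sum of `χ(x) ψ(a x + b / x)`. -/
def kloostermanWeight (χ : MulChar E ℂ) (ψ : AddChar E ℂ) (a b : E) (f : E[X]) : ℂ :=
  χ ((-1) ^ f.natDegree * f.coeff 0) * ψ (-(a * f.nextCoeff) - b * (f.coeff 1 / f.coeff 0))

variable (χ : MulChar E ℂ) (ψ : AddChar E ℂ) (a b : E)

theorem kloostermanWeight_one : kloostermanWeight χ ψ a b 1 = 1 := by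
  simp [kloostermanWeight, nextCoeff, coeff_one]

theorem kloostermanWeight_mul {f g : E[X]} (hf : f.Monic) (hg : g.Monic) :
    kloostermanWeight χ ψ a b (f * g) =
      kloostermanWeight χ ψ a b f * kloostermanWeight χ ψ a b g := by
  simp only [kloostermanWeight]
  rw [hf.natDegree_mul hg, hf.nextCoeff_mul hg, mul_coeff_zero, mul_coeff_one]
  by_cases hf0 : f.coeff 0 = 0
  · simp [hf0, MulChar.map_zero]
  by_cases hg0 : g.coeff 0 = 0
  · simp [hg0, MulChar.map_zero]
  have e1 : (-1) ^ (f.natDegree + g.natDegree) * (f.coeff 0 * g.coeff 0) =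
      ((-1) ^ f.natDegree * f.coeff 0) * ((-1) ^ g.natDegree * g.coeff 0) := by ring
  have e2 : -(a * (f.nextCoeff + g.nextCoeff)) -
      b * ((f.coeff 0 * g.coeff 1 + f.coeff 1 * g.coeff 0) / (f.coeff 0 * g.coeff 0)) =
      (-(a * f.nextCoeff) - b * (f.coeff 1 / f.coeff 0)) +
        (-(a * g.nextCoeff) - b * (g.coeff 1 / g.coeff 0)) := by
    field_simp
    ring
  rw [e1, e2, map_mul, AddChar.map_add_eq_mul]
  ring

theorem monicSum_kloostermanWeight_eq_zero [Fintype E] (hψ : ψ ≠ 1) (ha : a ≠ 0) {n : ℕ}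
    (hn : 3 ≤ n) : monicSum (kloostermanWeight χ ψ a b) n = 0 := by
  obtain ⟨s, hs⟩ : ∃ s, ψ s ≠ 1 := by
    by_contra! h
    exact hψ (by ext x; simp [h])
  obtain ⟨t, ht⟩ : ∃ t, s = -(a * t) := ⟨-s / a, by field_simp⟩
  have hmem : ∀ (u : E), ∀ f ∈ monics E n, f + C u * X ^ (n - 1) ∈ monics E n ∧
      (f + C u * X ^ (n - 1)).nextCoeff = f.nextCoeff + u := by
    intro u f hf
    rw [mem_monics] at hf ⊢
    have hlt : (C u * X ^ (n - 1)).degree < f.degree := by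
      rw [degree_eq_natDegree hf.1.ne_zero, hf.2]
      refine (degree_C_mul_X_pow_le _ _).trans_lt ?_
      exact_mod_cast (by omega : n - 1 < n)
    have hnd : (f + C u * X ^ (n - 1)).natDegree = n := by
      rw [natDegree_eq_of_degree_eq (degree_add_eq_left_of_degree_lt hlt), hf.2]
    refine ⟨⟨hf.1.add_of_left hlt, hnd⟩, ?_⟩
    rw [nextCoeff_of_natDegree_pos (by omega), nextCoeff_of_natDegree_pos (by omega), hnd, hf.2,
      coeff_add, coeff_C_mul_X_pow, if_pos rfl]
  have hshift : ψ s * monicSum (kloostermanWeight χ ψ a b) n =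
      monicSum (kloostermanWeight χ ψ a b) n := by
    rw [monicSum, Finset.mul_sum]
    refine Finset.sum_bij' (fun f _ => f + C t * X ^ (n - 1)) (fun f _ => f + C (-t) * X ^ (n - 1))
      (fun f hf => (hmem t f hf).1) (fun f hf => (hmem (-t) f hf).1) ?_ ?_ ?_
    · intro f _
      simp
    · intro f _
      simp
    · intro f hf
      obtain ⟨h1, h2⟩ := hmem t f hf
      rw [mem_monics] at h1 hf
      simp only [kloostermanWeight]
      rw [h1.2, hf.2, h2, coeff_add, coeff_add, coeff_C_mul_X_pow, coeff_C_mul_X_pow,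
        if_neg (by omega), if_neg (by omega), add_zero, add_zero, ht]
      have e : -(a * (f.nextCoeff + t)) - b * (f.coeff 1 / f.coeff 0) =
          -(a * t) + (-(a * f.nextCoeff) - b * (f.coeff 1 / f.coeff 0)) := by ring
      rw [e, AddChar.map_add_eq_mul]
      ring
  have h0 : (ψ s - 1) * monicSum (kloostermanWeight χ ψ a b) n = 0 := by
    rw [sub_mul, hshift, one_mul, sub_self]
  exact (mul_eq_zero.mp h0).resolve_left (sub_ne_zero.mpr hs)

theorem adjoin_simple_inv {L : Type*} [Field L] [Algebra E L] (x : L) :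
    IntermediateField.adjoin E {x⁻¹} = IntermediateField.adjoin E {x} := by
  refine le_antisymm ?_ ?_
  · rw [IntermediateField.adjoin_simple_le_iff]
    exact inv_mem (IntermediateField.mem_adjoin_simple_self E x)
  · rw [IntermediateField.adjoin_simple_le_iff]
    have := inv_mem (IntermediateField.mem_adjoin_simple_self E x⁻¹)
    rwa [inv_inv] at this

theorem nextCoeff_minpoly_inv {L : Type*} [Field L] [Algebra E L] [FiniteDimensional E L] {x : L}
    (hx : x ≠ 0) :
    (minpoly E x⁻¹).nextCoeff = (minpoly E x).coeff 1 / (minpoly E x).coeff 0 := by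
  set f := minpoly E x with hf
  have hint : IsIntegral E x := IsIntegral.of_finite E x
  have hint' : IsIntegral E x⁻¹ := IsIntegral.of_finite E _
  have h0 : f.coeff 0 ≠ 0 := minpoly.coeff_zero_ne_zero hint hx
  have hfm : f.Monic := minpoly.monic hint
  have hpos : 0 < f.natDegree := minpoly.natDegree_pos hint
  have hrev : f.reverse.natDegree = f.natDegree := by
    rw [reverse_natDegree, natTrailingDegree_eq_zero.mpr (Or.inr h0), Nat.sub_zero]
  have hlead : f.reverse.leadingCoeff = f.coeff 0 := by
    rw [reverse_leadingCoeff, trailingCoeff, natTrailingDegree_eq_zero.mpr (Or.inr h0)]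
  have hroot : aeval x⁻¹ f.reverse = 0 := by
    let _ : Invertible x := invertibleOfNonzero hx
    have := (eval₂_reverse_eq_zero_iff (algebraMap E L) x f).mpr (minpoly.aeval E x)
    rwa [invOf_eq_inv] at this
  have hdeg : (minpoly E x⁻¹).natDegree = f.natDegree := by
    rw [← IntermediateField.adjoin.finrank hint', hf, ← IntermediateField.adjoin.finrank hint]
    rw [adjoin_simple_inv]
  have heq : minpoly E x⁻¹ = C (f.coeff 0)⁻¹ * f.reverse := by
    refine (eq_of_monic_of_dvd_of_natDegree_le (p := minpoly E x⁻¹) (minpoly.monic hint') ?_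
      (minpoly.dvd E _ ?_) ?_).symm
    · rw [Monic, leadingCoeff_mul, leadingCoeff_C, hlead, inv_mul_cancel₀ h0]
    · rw [map_mul, hroot, mul_zero]
    · rw [natDegree_C_mul (inv_ne_zero h0), hrev, hdeg]
  rw [nextCoeff_of_natDegree_pos (by omega), hdeg, heq, coeff_C_mul, coeff_reverse,
    revAt_le (by omega), show f.natDegree - (f.natDegree - 1) = 1 by omega]
  field_simp

theorem kloostermanWeight_minpoly_pow {L : Type*} [Field L] [Algebra E L] [FiniteDimensional E L]
    (x : L) :
    kloostermanWeight χ ψ a b (minpoly E x) ^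
        (Module.finrank E L / (minpoly E x).natDegree) =
      χ (Algebra.norm E x) *
        ψ (Algebra.trace E L (algebraMap E L a * x + algebraMap E L b * x⁻¹)) := by
  have hint : IsIntegral E x := IsIntegral.of_finite E x
  have hdeg := IntermediateField.adjoin.finrank hint
  have hmul := Module.finrank_mul_finrank E (IntermediateField.adjoin E {x}) L
  set m := Module.finrank (IntermediateField.adjoin E {x}) L with hm
  have hpos : 0 < (minpoly E x).natDegree := minpoly.natDegree_pos hint
  have hquot : Module.finrank E L / (minpoly E x).natDegree = m := by
    rw [← hmul, hdeg, Nat.mul_div_cancel_left _ hpos]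
  have hmpos : 0 < m := Module.finrank_pos
  rw [hquot]
  by_cases hx : x = 0
  · subst hx
    have h1 : Algebra.norm E (0 : L) = 0 := Algebra.norm_zero
    rw [h1, kloostermanWeight, minpoly.zero]
    simp [MulChar.map_zero, hmpos.ne']
  have hnorm : Algebra.norm E x =
      ((-1) ^ (minpoly E x).natDegree * (minpoly E x).coeff 0) ^ m := by
    rw [Algebra.norm_eq_norm_adjoin E x]
    congr 1
    have := Algebra.PowerBasis.norm_gen_eq_coeff_zero_minpoly
      (IntermediateField.adjoin.powerBasis hint)
    rw [IntermediateField.adjoin.powerBasis_gen hint, IntermediateField.minpoly_gen,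
      IntermediateField.adjoin.powerBasis_dim] at this
    exact this
  have htr : Algebra.trace E L x = m * -(minpoly E x).nextCoeff :=
    trace_eq_finrank_mul_minpoly_nextCoeff E x
  have htr' : Algebra.trace E L x⁻¹ =
      m * -((minpoly E x).coeff 1 / (minpoly E x).coeff 0) := by
    rw [trace_eq_finrank_mul_minpoly_nextCoeff E x⁻¹, nextCoeff_minpoly_inv hx, hm, adjoin_simple_inv]
  rw [kloostermanWeight, mul_pow, ← map_pow, ← hnorm, ← AddChar.map_nsmul_eq_pow]
  congr 2
  rw [map_add, ← Algebra.smul_def, ← Algebra.smul_def, map_smul, map_smul, htr, htr']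
  simp only [smul_eq_mul, nsmul_eq_mul]
  ring

/-- The Mangoldt sum of the weight is the twisted Kloosterman sum over the extension of degree
`k`. -/
theorem mangoldtSum_kloostermanWeight [Fintype E] {L : Type*} [Field L] [Fintype L] [Algebra E L] :
    mangoldtSum (kloostermanWeight χ ψ a b) (Module.finrank E L) =
      ∑ x : L, χ (Algebra.norm E x) *
        ψ (Algebra.trace E L (algebraMap E L a * x + algebraMap E L b * x⁻¹)) := by
  classical
  set k := Module.finrank E L with hk
  have hkpos : 0 < k := Module.finrank_pos
  have hcard : Nat.card L = Nat.card E ^ k := Module.natCard_eq_pow_finrank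
  have hsum : ∀ x : L, χ (Algebra.norm E x) *
      ψ (Algebra.trace E L (algebraMap E L a * x + algebraMap E L b * x⁻¹)) =
      ∑ d ∈ k.divisors, ∑ P ∈ monicIrreducibles E d,
        if minpoly E x = P then kloostermanWeight χ ψ a b P ^ (k / d) else 0 := by
    intro x
    have hint : IsIntegral E x := IsIntegral.of_finite E x
    rw [Finset.sum_eq_single (minpoly E x).natDegree]
    · rw [Finset.sum_ite_eq, if_pos, kloostermanWeight_minpoly_pow]
      exact mem_monicIrreducibles.mpr ⟨minpoly.monic hint, rfl, minpoly.irreducible hint⟩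
    · intro d _ hd
      refine Finset.sum_eq_zero fun P hP => if_neg fun h => hd ?_
      rw [h, (mem_monicIrreducibles.mp hP).2.1]
    · intro h
      refine absurd (Nat.mem_divisors.mpr ⟨?_, hkpos.ne'⟩) h
      exact minpoly.degree_dvd hint
  simp only [hsum]
  rw [mangoldtSum, Finset.sum_comm]
  refine Finset.sum_congr rfl fun d hd => ?_
  rw [Finset.sum_comm]
  refine Finset.sum_congr rfl fun P hP => ?_
  rw [← Finset.sum_filter, Finset.sum_const, nsmul_eq_mul]
  congr 2
  obtain ⟨hPm, hPd, hPi⟩ := mem_monicIrreducibles.mp hP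
  have hsplit : (P.map (algebraMap E L)).Splits := by
    have h1 : P ∣ X ^ Nat.card E ^ k - X :=
      (hPi.natDegree_dvd_iff_dvd_X_pow_card_pow_sub_X).mp (hPd ▸ Nat.dvd_of_mem_divisors hd)
    refine Splits.of_dvd ?_ ?_ (map_dvd (mapRingHom (algebraMap E L)) h1)
    · simp only [coe_mapRingHom, Polynomial.map_sub, Polynomial.map_pow, map_X]
      rw [← hcard, Nat.card_eq_fintype_card]
      rw [splits_iff_card_roots, FiniteField.roots_X_pow_card_sub_X,
        FiniteField.X_pow_card_sub_X_natDegree_eq L Fintype.one_lt_card]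
      simp
    · simp only [coe_mapRingHom, Polynomial.map_sub, Polynomial.map_pow, map_X]
      rw [← hcard]
      exact FiniteField.X_pow_card_sub_X_ne_zero L Finite.one_lt_card
  have hroots : (P.rootSet L).toFinset = Finset.univ.filter fun x : L => minpoly E x = P := by
    ext x
    simp only [Set.mem_toFinset, Finset.mem_filter, Finset.mem_univ, true_and,
      mem_rootSet_of_ne hPi.ne_zero]
    constructor
    · intro h
      exact (minpoly.eq_of_irreducible_of_monic hPi h hPm).symm
    · rintro rfl
      exact minpoly.aeval E x
  rw [← hroots, Set.toFinset_card, card_rootSet_eq_natDegree (PerfectField.separable_of_irreducible hPi) hsplit, hPd]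

end

theorem MulChar.norm_apply_le_one {E : Type*} [Field E] [Fintype E] (χ : MulChar E ℂ) (x : E) :
    ‖χ x‖ ≤ 1 := by
  by_cases hx : x = 0
  · simp [hx]
  · refine le_of_eq (Complex.norm_eq_one_of_pow_eq_one (n := Fintype.card E - 1) ?_ ?_)
    · rw [← map_pow, FiniteField.pow_card_sub_one_eq_one x hx, map_one]
    · have := Fintype.one_lt_card (α := E)
      omega

/-- Twisted Kloosterman sums over large even degree extensions are `O(√|L|)`. -/
theorem norm_sum_extension_le {E L : Type*} [Field E] [Fintype E] [Field L] [Fintype L]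
    [Algebra E L] {p r j : ℕ} [Fact p.Prime] [Algebra (ZMod p) E] [Algebra (ZMod p) L]
    [IsScalarTower (ZMod p) E L] (hr : 0 < r) (hj : 0 < j) (hE : Fintype.card E = p ^ r)
    (hL : Fintype.card L = p ^ (2 * (r * j)))
    (hM : 2 * (p ^ r - 1) * p + 2 < p ^ (r * j)) (χ : MulChar E ℂ)
    (e : AddChar (ZMod p) ℂ) (he : e ≠ 1) {a : E} (ha : a ≠ 0) (b : E) :
    ‖∑ x : L, χ (Algebra.norm E x) * e (Algebra.trace (ZMod p) E
      (Algebra.trace E L (algebraMap E L a * x + algebraMap E L b * x⁻¹)))‖ ≤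
      ((2 * (p ^ r - 1) * p + 2 * (p ^ r - 1) + 2) * p + 1 : ℕ) * (p ^ (r * j) : ℕ) := by
  classical
  have hp : p.Prime := Fact.out
  set d := p ^ r - 1 with hd
  have hp1 : 1 < p ^ r := Nat.one_lt_pow hr.ne' hp.one_lt
  have hdpos : 0 < d := by omega
  have hcop : Nat.Coprime d p := by
    rw [Nat.coprime_comm, hp.coprime_iff_not_dvd]
    intro h
    have h1 : p ∣ p ^ r := dvd_pow_self p hr.ne'
    have h2 : p ∣ 1 := by
      have := (Nat.dvd_sub h1 h)
      rwa [hd, Nat.sub_sub_self hp1.le] at this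
    exact hp.one_lt.ne' (Nat.dvd_one.mp h2)
  set A := algebraMap E L a with hA
  set B := algebraMap E L b with hB
  have hA0 : A ≠ 0 := by simpa [hA] using ha
  set bound : ℝ := ((2 * d * p + 2 * d + 2) * p + 1 : ℕ) * (p ^ (r * j) : ℕ) with hbound
  simp only [Algebra.trace_trace]
  set g : L → ℂ := fun x => χ (Algebra.norm E x) * e (Algebra.trace (ZMod p) L (A * x + B * x⁻¹))
    with hg
  set Z := Finset.univ.filter fun z : L => z ≠ 0 with hZ
  have hZcard : 0 < Z.card := Finset.card_pos.mpr ⟨1, by simp [hZ]⟩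
  have hnorm : ∀ z ∈ Z, Algebra.norm E (z ^ d) = 1 := by
    intro z hz
    have hz0 : Algebra.norm E z ≠ 0 := Algebra.norm_ne_zero_iff.mpr (by simpa [hZ] using hz)
    rw [map_pow, hd, ← hE, FiniteField.pow_card_sub_one_eq_one _ hz0]
  have hshift : ∀ z ∈ Z, ∑ x, g (x * z ^ d) = ∑ x, g x := by
    intro z hz
    have hz0 : z ^ d ≠ 0 := pow_ne_zero _ (by simpa [hZ] using hz)
    exact Fintype.sum_equiv (Equiv.mulRight₀ _ hz0) _ _ fun x => rfl
  have hinner : ∀ x, ‖∑ z ∈ Z, g (x * z ^ d)‖ ≤ if x = 0 then 0 else bound := by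
    intro x
    split_ifs with hx
    · simp [hg, hx, Algebra.norm_zero, MulChar.map_zero]
    · have h1 : ∑ z ∈ Z, g (x * z ^ d) = χ (Algebra.norm E x) * ∑ z ∈ Z,
          e (Algebra.trace (ZMod p) L (A * x * z ^ d + B * x⁻¹ * (z ^ d)⁻¹)) := by
        rw [Finset.mul_sum]
        refine Finset.sum_congr rfl fun z hz => ?_
        rw [hg]
        simp only
        rw [map_mul (Algebra.norm E), hnorm z hz, mul_one, mul_inv]
        congr 3
        ring
      rw [h1, norm_mul]
      have h2 := norm_sum_trace_pow_le (Nat.mul_pos hr hj) hL hdpos hcop hM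
        (mul_ne_zero hA0 hx) (B * x⁻¹) e he
      exact (mul_le_of_le_one_left (norm_nonneg _) (χ.norm_apply_le_one _)).trans h2
  have htotal : (Z.card : ℂ) * ∑ x, g x = ∑ x, ∑ z ∈ Z, g (x * z ^ d) := by
    rw [Finset.sum_comm, Finset.sum_congr rfl hshift, Finset.sum_const, nsmul_eq_mul]
  have hle : (Z.card : ℝ) * ‖∑ x, g x‖ ≤ Z.card * bound := by
    have h1 : ‖(Z.card : ℂ) * ∑ x, g x‖ ≤ Z.card * bound := by
      rw [htotal]
      refine (norm_sum_le _ _).trans ((Finset.sum_le_sum fun x _ => hinner x).trans (le_of_eq ?_))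
      have : ∀ x : L, (if x = 0 then 0 else bound) = if x ≠ 0 then bound else 0 := by
        intro x; by_cases hx : x = 0 <;> simp [hx]
      simp only [this]
      rw [← Finset.sum_filter, Finset.sum_const, nsmul_eq_mul]
    rwa [norm_mul, Complex.norm_natCast] at h1
  exact le_of_mul_le_mul_left hle (by exact_mod_cast hZcard)

/-- The Weil bound for twisted Kloosterman sums. -/
theorem norm_kloosterman_le {E : Type*} [Field E] [Fintype E] {p : ℕ} [Fact p.Prime]
    [Algebra (ZMod p) E] (χ : MulChar E ℂ) (e : AddChar (ZMod p) ℂ) (he : e ≠ 1) {a : E}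
    (ha : a ≠ 0) (b : E) :
    ‖∑ x : E, χ x * e (Algebra.trace (ZMod p) E (a * x + b * x⁻¹))‖ ≤
      2 * Real.sqrt (Fintype.card E) := by
  have hp : p.Prime := Fact.out
  have hch : CharP E p := charP_of_injective_algebraMap (algebraMap (ZMod p) E).injective p
  set r := Module.finrank (ZMod p) E with hr
  have hrpos : 0 < r := Module.finrank_pos
  have hE : Fintype.card E = p ^ r := by
    rw [Module.card_eq_pow_finrank (K := ZMod p), ZMod.card]
  let ψ : AddChar E ℂ := e.compAddMonoidHom (Algebra.trace (ZMod p) E).toAddMonoidHom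
  have hψapp : ∀ x, ψ x = e (Algebra.trace (ZMod p) E x) := fun x => rfl
  have hψ : ψ ≠ 1 := by
    intro h
    refine he ?_
    ext c
    obtain ⟨x, rfl⟩ := Algebra.trace_surjective (ZMod p) E c
    rw [← hψapp, h]
    simp
  set lam := kloostermanWeight χ ψ a b with hlam
  have hnewton := mul_monicSum_eq (lam := lam) (kloostermanWeight_one χ ψ a b)
    (fun f g hf hg => kloostermanWeight_mul χ ψ a b hf hg)
  have hzero : ∀ n, 3 ≤ n → monicSum lam n = 0 := fun n hn =>
    monicSum_kloostermanWeight_eq_zero χ ψ a b hψ ha hn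
  have hA0 : monicSum lam 0 = 1 := by
    have : monics E 0 = {1} := by
      ext f
      rw [mem_monics, Finset.mem_singleton]
      exact ⟨fun h => h.1.natDegree_eq_zero.mp h.2, fun h => by simp [h]⟩
    rw [monicSum, this, Finset.sum_singleton, hlam, kloostermanWeight_one]
  have hs1 : mangoldtSum lam 1 = ∑ x : E, χ x * e (Algebra.trace (ZMod p) E (a * x + b * x⁻¹)) := by
    have := mangoldtSum_kloostermanWeight χ ψ a b (L := E)
    rw [Module.finrank_self] at this
    rw [hlam, this]
    refine Finset.sum_congr rfl fun x _ => ?_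
    rw [Algebra.norm_self, hψapp, Algebra.trace_self_apply]
    rfl
  rw [← hs1]
  refine norm_le_two_mul_sqrt_of_newton (s := mangoldtSum lam) (a₁ := monicSum lam 1)
    (a₂ := monicSum lam 2) (c := ((2 * (p ^ r - 1) * p + 2 * (p ^ r - 1) + 2) * p + 1 : ℕ))
    (j₀ := 2 * (p ^ r - 1) * p + 3) ?_ ?_ ?_ ?_ ?_
  · exact_mod_cast Fintype.card_pos
  · have := hnewton 1
    simpa [hA0] using this
  · have := hnewton 2
    rw [show Finset.Icc 1 2 = {1, 2} from rfl, Finset.sum_pair (by norm_num)] at this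
    simpa [hA0] using this
  · intro k
    have := hnewton (k + 3)
    rw [hzero (k + 3) (by omega), mul_zero] at this
    have h1 : ∑ i ∈ Finset.Icc 1 (k + 3), mangoldtSum lam i * monicSum lam (k + 3 - i) =
        ∑ i ∈ {k + 1, k + 2, k + 3}, mangoldtSum lam i * monicSum lam (k + 3 - i) := by
      symm
      refine Finset.sum_subset ?_ ?_
      · intro i hi
        simp only [Finset.mem_insert, Finset.mem_singleton] at hi
        rw [Finset.mem_Icc]
        omega
      · intro i hi hi'
        simp only [Finset.mem_insert, Finset.mem_singleton] at hi'
        rw [Finset.mem_Icc] at hi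
        rw [hzero _ (by omega), mul_zero]
    rw [h1, Finset.sum_insert (by simp), Finset.sum_pair (by simp),
      show k + 3 - (k + 1) = 2 by omega, show k + 3 - (k + 2) = 1 by omega, Nat.sub_self, hA0]
      at this
    linear_combination -this
  · intro j hj
    have : NeZero (2 * j) := ⟨by omega⟩
    let _ : Fintype (FiniteField.Extension E p (2 * j)) := Fintype.ofFinite _
    have hfin := FiniteField.finrank_extension E p (2 * j)
    have hcard : Fintype.card (FiniteField.Extension E p (2 * j)) = p ^ (2 * (r * j)) := by
      rw [← Nat.card_eq_fintype_card, FiniteField.natCard_extension, Nat.card_eq_fintype_card, hE,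
        ← pow_mul]
      congr 1
      ring
    have hM : 2 * (p ^ r - 1) * p + 2 < p ^ (r * j) := by
      have h1 : j < 2 ^ j := Nat.lt_two_pow_self
      have h2 : 2 ^ j ≤ p ^ j := Nat.pow_le_pow_left hp.two_le j
      have h3 : p ^ j ≤ p ^ (r * j) := Nat.pow_le_pow_right hp.pos (Nat.le_mul_of_pos_left j hrpos)
      omega
    have hsum := mangoldtSum_kloostermanWeight χ ψ a b (L := FiniteField.Extension E p (2 * j))
    rw [hfin] at hsum
    rw [hlam, hsum]
    have hb := norm_sum_extension_le hrpos (by omega : 0 < j) hE hcard hM χ e he ha b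
    refine hb.trans (le_of_eq ?_)
    rw [hE]
    push_cast
    rw [pow_mul]

section

variable {E : Type*} [Field E] [Fintype E]

/-- The additive character `x ↦ e (Tr x)` of a finite field. -/
def traceAddChar {p : ℕ} [Fact p.Prime] [Algebra (ZMod p) E] (e : AddChar (ZMod p) ℂ) :
    AddChar E ℂ :=
  e.compAddMonoidHom (Algebra.trace (ZMod p) E).toAddMonoidHom

/-- `ψ` satisfies the Weil bound for all twisted Kloosterman sums. -/
def WeilBound (ψ : AddChar E ℂ) : Prop :=
  ψ.IsPrimitive ∧ ∀ (χ : MulChar E ℂ) (a b : E), (a ≠ 0 ∨ b ≠ 0) →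
    ‖∑ x : E, χ x * ψ (a * x + b * x⁻¹)‖ ≤ 2 * Real.sqrt (Fintype.card E)

theorem exists_weilBound (E : Type*) [Field E] [Fintype E] : ∃ ψ : AddChar E ℂ, WeilBound ψ := by
  obtain ⟨p, hp⟩ := CharP.exists E
  have hpp : Fact p.Prime := ⟨CharP.char_is_prime E p⟩
  let _ : Algebra (ZMod p) E := ZMod.algebra E p
  let e : AddChar (ZMod p) ℂ := ZMod.stdAddChar
  have he : e ≠ 1 := by
    have h := ZMod.isPrimitive_stdAddChar p (one_ne_zero : (1 : ZMod p) ≠ 0)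
    rwa [AddChar.mulShift_one] at h
  have happ : ∀ x : E, traceAddChar e x = e (Algebra.trace (ZMod p) E x) := fun x => rfl
  refine ⟨traceAddChar e, ?_, ?_⟩
  · refine AddChar.IsPrimitive.of_ne_one fun h => he ?_
    ext c
    obtain ⟨x, rfl⟩ := Algebra.trace_surjective (ZMod p) E c
    rw [← happ, h]
    simp
  · intro χ a b hab
    simp only [happ]
    by_cases ha : a = 0
    · have hb : b ≠ 0 := hab.resolve_left (not_not.mpr ha)
      have h1 : ∑ x : E, χ x * e (Algebra.trace (ZMod p) E (a * x + b * x⁻¹)) =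
          ∑ x : E, χ⁻¹ x * e (Algebra.trace (ZMod p) E (b * x + a * x⁻¹)) := by
        refine Fintype.sum_equiv (Equiv.inv E) _ _ fun x => ?_
        simp only [Equiv.inv_apply, inv_inv, MulChar.inv_apply']
        rw [add_comm]
      rw [h1]
      exact norm_kloosterman_le _ e he hb a
    · exact norm_kloosterman_le χ e he ha b

open scoped Classical in
/-- The Fourier coefficients of the indicator function of an additive subgroup. -/
def subgroupCoeff (ψ : AddChar E ℂ) (A : AddSubgroup E) (b : E) : ℝ :=
  if ∀ a ∈ A, ψ (b * a) = 1 then (Nat.card A : ℝ) / Fintype.card E else 0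

theorem subgroupCoeff_nonneg (ψ : AddChar E ℂ) (A : AddSubgroup E) (b : E) :
    0 ≤ subgroupCoeff ψ A b := by
  rw [subgroupCoeff]
  split_ifs <;> positivity

theorem subgroupCoeff_zero (ψ : AddChar E ℂ) (A : AddSubgroup E) :
    subgroupCoeff ψ A 0 = (Nat.card A : ℝ) / Fintype.card E := by
  rw [subgroupCoeff, if_pos]
  simp

open scoped Classical in
theorem sum_subgroupCoeff {ψ : AddChar E ℂ} (hψ : ψ.IsPrimitive) (A : AddSubgroup E) (x : E) :
    ∑ b, (subgroupCoeff ψ A b : ℂ) * ψ (b * x) = if x ∈ A then 1 else 0 := by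
  have hQ : (Fintype.card E : ℂ) ≠ 0 := by exact_mod_cast Fintype.card_ne_zero
  have h1 : ∀ b, (subgroupCoeff ψ A b : ℂ) = (∑ a : A, ψ (b * -a)) / Fintype.card E := by
    intro b
    let φ : AddChar A ℂ :=
      (ψ.mulShift (-b)).compAddMonoidHom A.subtype
    have hφ : ∀ a : A, φ a = ψ (b * -a) := fun a => by
      rw [AddChar.compAddMonoidHom_apply, AddChar.mulShift_apply]
      congr 1
      simp
    have h2 : (∑ a : A, ψ (b * -a)) = ∑ a : A, φ a := by simp only [hφ]
    have hiff : φ = 0 ↔ ∀ a ∈ A, ψ (b * a) = 1 := by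
      constructor
      · intro h a ha
        have := hφ ⟨-a, neg_mem ha⟩
        rw [h] at this
        simpa using this.symm
      · intro h
        ext a
        rw [hφ, h _ (neg_mem a.2)]
        rfl
    rw [h2, AddChar.sum_eq_ite, subgroupCoeff]
    by_cases h : φ = 0
    · rw [if_pos h, if_pos (hiff.mp h), Nat.card_eq_fintype_card]
      push_cast
      rfl
    · rw [if_neg h, if_neg (fun h' => h (hiff.mpr h'))]
      simp
  simp only [h1, div_mul_eq_mul_div, Finset.sum_mul, ← AddChar.map_add_eq_mul, ← mul_add]
  rw [← Finset.sum_div, Finset.sum_comm]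
  simp only [AddChar.sum_mulShift _ hψ]
  split_ifs with hx
  · rw [Finset.sum_eq_single ⟨x, hx⟩]
    · simp [hQ]
    · intro a _ ha
      have : -(a : E) + x ≠ 0 := fun h => ha (Subtype.ext (neg_add_eq_zero.mp h))
      simp [this]
    · simp
  · rw [Finset.sum_eq_zero, zero_div]
    intro a _
    have : -(a : E) + x ≠ 0 := fun h => hx (neg_add_eq_zero.mp h ▸ a.2)
    simp [this]

theorem sum_subgroupCoeff_eq_one {ψ : AddChar E ℂ} (hψ : ψ.IsPrimitive) (A : AddSubgroup E) :
    ∑ b, subgroupCoeff ψ A b = 1 := by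
  have := sum_subgroupCoeff hψ A 0
  simp only [mul_zero, AddChar.map_zero_eq_one, mul_one, zero_mem, if_true] at this
  exact_mod_cast this

open scoped Classical in
/-- Elements `x ≠ 0` with `x ∈ A` and `x⁻¹ ∈ B`. -/
def invPairs (A B : AddSubgroup E) : Finset E :=
  Finset.univ.filter fun x => x ≠ 0 ∧ x ∈ A ∧ x⁻¹ ∈ B

open scoped Classical in
theorem norm_sum_invPairs_sub_le {ψ : AddChar E ℂ} (hψ : WeilBound ψ) (A B : AddSubgroup E)
    (χ : MulChar E ℂ) :
    ‖∑ x ∈ invPairs A B, χ x - if χ = 1 then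
      (((Fintype.card E - 1) * ((Nat.card A : ℝ) / Fintype.card E) *
        ((Nat.card B : ℝ) / Fintype.card E) : ℝ) : ℂ) else 0‖ ≤
        2 * Real.sqrt (Fintype.card E) := by
  set u := subgroupCoeff ψ A with hu
  set v := subgroupCoeff ψ B with hv
  have hexp : ∑ x ∈ invPairs A B, χ x =
      ∑ y : E × E, ((u y.1 * v y.2 : ℝ) : ℂ) * ∑ x : E, χ x * ψ (y.1 * x + y.2 * x⁻¹) := by
    have h1 : ∑ x ∈ invPairs A B, χ x = ∑ x : E, χ x * ((∑ a, (u a : ℂ) * ψ (a * x)) *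
        ∑ b, (v b : ℂ) * ψ (b * x⁻¹)) := by
      rw [invPairs, Finset.sum_filter]
      refine Finset.sum_congr rfl fun x _ => ?_
      rw [sum_subgroupCoeff hψ.1, sum_subgroupCoeff hψ.1]
      by_cases hx : x = 0
      · simp [hx, MulChar.map_zero]
      · by_cases h1 : x ∈ A <;> by_cases h2 : x⁻¹ ∈ B <;> simp [hx, h1, h2]
    rw [h1]
    simp only [Fintype.sum_mul_sum]
    simp only [Finset.mul_sum, Fintype.sum_prod_type]
    rw [Finset.sum_comm]
    refine Finset.sum_congr rfl fun a _ => ?_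
    rw [Finset.sum_comm]
    refine Finset.sum_congr rfl fun b _ => Finset.sum_congr rfl fun x _ => ?_
    rw [AddChar.map_add_eq_mul]
    push_cast
    ring
  have hzero : (if χ = 1 then
      (((Fintype.card E - 1) * ((Nat.card A : ℝ) / Fintype.card E) *
        ((Nat.card B : ℝ) / Fintype.card E) : ℝ) : ℂ) else 0) =
      ((u 0 * v 0 : ℝ) : ℂ) * ∑ x : E, χ x * ψ (0 * x + 0 * x⁻¹) := by
    simp only [zero_mul, add_zero, AddChar.map_zero_eq_one, mul_one]
    split_ifs with h
    · rw [h, MulChar.sum_one_eq_card_units, hu, hv, subgroupCoeff_zero, subgroupCoeff_zero,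
        Fintype.card_units, Nat.cast_sub Fintype.card_pos]
      push_cast
      ring
    · rw [MulChar.sum_eq_zero_of_ne_one h, mul_zero]
  have huv : ∑ y : E × E, u y.1 * v y.2 = 1 := by
    rw [Fintype.sum_prod_type, ← Fintype.sum_mul_sum, sum_subgroupCoeff_eq_one hψ.1,
      sum_subgroupCoeff_eq_one hψ.1, one_mul]
  rw [hexp, hzero, ← Finset.add_sum_erase _ _ (Finset.mem_univ ((0 : E), (0 : E)))]
  simp only [add_sub_cancel_left]
  refine (norm_sum_le _ _).trans ?_
  have hnn : ∀ y : E × E, 0 ≤ u y.1 * v y.2 := fun y =>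
    mul_nonneg (subgroupCoeff_nonneg _ _ _) (subgroupCoeff_nonneg _ _ _)
  calc _ ≤ ∑ y ∈ Finset.univ.erase ((0 : E), (0 : E)),
        u y.1 * v y.2 * (2 * Real.sqrt (Fintype.card E)) := by
        refine Finset.sum_le_sum fun y hy => ?_
        rw [norm_mul, Complex.norm_real, Real.norm_of_nonneg (hnn y)]
        refine mul_le_mul_of_nonneg_left (hψ.2 χ _ _ ?_) (hnn y)
        have hy0 := Finset.ne_of_mem_erase hy
        by_contra! h
        exact hy0 (Prod.ext h.1 h.2)
    _ ≤ ∑ y : E × E, u y.1 * v y.2 * (2 * Real.sqrt (Fintype.card E)) :=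
        Finset.sum_le_sum_of_subset_of_nonneg (Finset.erase_subset _ _) fun y _ _ =>
          mul_nonneg (hnn y) (by positivity)
    _ = _ := by rw [← Finset.sum_mul, huv, one_mul]

end

section

variable {E : Type*} [Field E] [Fintype E]

open scoped Classical in
/-- The indicator function of `χ = 1`. -/
def charInd (χ : MulChar E ℂ) (x : E) : ℝ := if χ x = 1 then 1 else 0

omit [Fintype E] in
theorem charInd_eq {χ : MulChar E ℂ} {l : ℕ} (hl : 0 < l) (hχ : orderOf χ = l) {x : E}
    (hx : x ≠ 0) : (charInd χ x : ℂ) = (l : ℂ)⁻¹ * ∑ i ∈ Finset.range l, (χ ^ i) x := by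
  have hl0 : (l : ℂ) ≠ 0 := by exact_mod_cast hl.ne'
  have hpow : ∀ i, (χ ^ i) x = χ x ^ i := fun i => MulChar.pow_apply_coe χ i (Units.mk0 x hx)
  have h1 : χ x ^ l = 1 := by
    rw [← hpow, ← hχ, pow_orderOf_eq_one]
    exact MulChar.one_apply_coe (Units.mk0 x hx)
  simp only [hpow, charInd]
  split_ifs with h
  · simp [h, hl0]
  · have h2 := mul_neg_geom_sum (χ x) l
    rw [h1, sub_self] at h2
    rw [(mul_eq_zero.mp h2).resolve_left (sub_ne_zero.mpr (Ne.symm h))]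
    simp

theorem coprime_orderOf_pow_mul {G : Type*} [CommGroup G] {a b : G} {k : ℕ}
    (ha : (orderOf a).Coprime k) (hb : (orderOf b).Coprime k) (i : ℕ) :
    (orderOf (a ^ i * b)).Coprime k := by
  refine Nat.Coprime.coprime_dvd_left (Commute.orderOf_mul_dvd_mul_orderOf (Commute.all _ _)) ?_
  exact Nat.Coprime.mul_left (ha.coprime_dvd_left (orderOf_pow_dvd i)) hb

theorem pow_mul_ne_one {G : Type*} [CommGroup G] {a b : G} {l i : ℕ}
    (ha : orderOf a = l) (hb : (orderOf b).Coprime l) (hi : 0 < i) (hil : i < l) :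
    a ^ i * b ≠ 1 := by
  intro h
  have h1 : a ^ i = b⁻¹ := eq_inv_of_mul_eq_one_left h
  have h2 : orderOf (a ^ i) ∣ l := ha ▸ orderOf_pow_dvd i
  have h3 : (orderOf (a ^ i)).Coprime l := by rw [h1, orderOf_inv]; exact hb
  have h4 : a ^ i = 1 := orderOf_eq_one_iff.mp (Nat.Coprime.eq_one_of_dvd h3 h2)
  have h5 := orderOf_dvd_of_pow_eq_one h4
  rw [ha] at h5
  exact absurd (Nat.le_of_dvd hi h5) (by omega)

open scoped Classical in
/-- The character sums over `S` weighted by `w` are within `R` of those of a constant function of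
total mass `M`, for characters of order coprime to the elements of `C`. -/
def CharSumsClose (S : Finset E) (C : Finset ℕ) (w : E → ℝ) (M R : ℝ) : Prop :=
  ∀ ψ : MulChar E ℂ, (∀ l ∈ C, (orderOf ψ).Coprime l) →
    ‖∑ x ∈ S, (w x : ℂ) * ψ x - (if ψ = 1 then (M : ℂ) else 0)‖ ≤ R

open scoped Classical in
theorem CharSumsClose.mul_charInd {S : Finset E} {C : Finset ℕ} {w : E → ℝ} {M R : ℝ}
    (h : CharSumsClose S C w M R) (hS : (0 : E) ∉ S) {l : ℕ} (hl : l.Prime) (hlC : ∀ k ∈ C,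
    l.Coprime k) {χ : MulChar E ℂ} (hχ : orderOf χ = l) {ψ : MulChar E ℂ}
    (hψ : ∀ k ∈ insert l C, (orderOf ψ).Coprime k) :
    ‖∑ x ∈ S, ((w x * charInd χ x : ℝ) : ℂ) * ψ x - (l : ℂ)⁻¹ * ∑ x ∈ S, (w x : ℂ) * ψ x‖ ≤
      (1 - (l : ℝ)⁻¹) * R := by
  have hl0 : (l : ℂ) ≠ 0 := by exact_mod_cast hl.ne_zero
  have hlr : (0 : ℝ) < l := by exact_mod_cast hl.pos
  have h1 : ∑ x ∈ S, ((w x * charInd χ x : ℝ) : ℂ) * ψ x =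
      (l : ℂ)⁻¹ * ∑ i ∈ Finset.range l, ∑ x ∈ S, (w x : ℂ) * (χ ^ i * ψ) x := by
    rw [Finset.sum_comm, Finset.mul_sum]
    refine Finset.sum_congr rfl fun x hx => ?_
    have hx0 : x ≠ 0 := fun h0 => hS (h0 ▸ hx)
    push_cast
    rw [charInd_eq hl.pos hχ hx0]
    simp only [MulChar.mul_apply, ← Finset.mul_sum, ← Finset.sum_mul]
    ring
  obtain ⟨m, rfl⟩ : ∃ m, l = m + 1 := ⟨l - 1, by have := hl.pos; omega⟩
  rw [h1, Finset.sum_range_succ', pow_zero, one_mul, mul_add, add_sub_cancel_right, norm_mul,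
    norm_inv, Complex.norm_natCast]
  have h2 : ∀ i ∈ Finset.range m, ‖∑ x ∈ S, (w x : ℂ) * (χ ^ (i + 1) * ψ) x‖ ≤ R := by
    intro i hi
    have h3 := h (χ ^ (i + 1) * ψ) (fun k hk => coprime_orderOf_pow_mul (hχ ▸ hlC k hk)
      (hψ k (Finset.mem_insert_of_mem hk)) _)
    rwa [if_neg (pow_mul_ne_one hχ (hψ _ (Finset.mem_insert_self _ _)) (Nat.succ_pos i)
      (by simpa using hi)), sub_zero] at h3
  have h4 := norm_sum_le_of_le _ h2
  rw [Finset.sum_const, Finset.card_range, nsmul_eq_mul] at h4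
  calc _ ≤ ((m + 1 : ℕ) : ℝ)⁻¹ * (m * R) := by gcongr
    _ = _ := by push_cast; field_simp; ring

theorem CharSumsClose.insert {S : Finset E} {C : Finset ℕ} {w : E → ℝ} {M R : ℝ}
    (h : CharSumsClose S C w M R) (hS : (0 : E) ∉ S) {l : ℕ} (hl : l.Prime) (hlC : ∀ k ∈ C,
    l.Coprime k) {χ : MulChar E ℂ} (hχ : orderOf χ = l) :
    CharSumsClose S (insert l C) (fun x => w x * (1 - charInd χ x)) ((1 - (l : ℝ)⁻¹) * M)
      ((1 - (l : ℝ)⁻¹) * (2 * R)) := by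
  intro ψ hψ
  have h1 := h.mul_charInd hS hl hlC hχ hψ
  have h2 := h ψ fun k hk => hψ k (Finset.mem_insert_of_mem hk)
  have hlr : (1 : ℝ) ≤ l := by exact_mod_cast hl.pos
  have hinv : 0 ≤ 1 - (l : ℝ)⁻¹ := sub_nonneg.mpr (inv_le_one_of_one_le₀ hlr)
  set T := ∑ x ∈ S, (w x : ℂ) * ψ x with hT
  set U := ∑ x ∈ S, ((w x * charInd χ x : ℝ) : ℂ) * ψ x with hU
  have h3 : ∑ x ∈ S, ((w x * (1 - charInd χ x) : ℝ) : ℂ) * ψ x = T - U := by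
    rw [hT, hU, ← Finset.sum_sub_distrib]
    refine Finset.sum_congr rfl fun x _ => ?_
    push_cast
    ring
  have h4 : T - U - (if ψ = 1 then ((((1 - (l : ℝ)⁻¹) * M : ℝ)) : ℂ) else 0) =
      ((1 - (l : ℝ)⁻¹ : ℝ) : ℂ) * (T - (if ψ = 1 then (M : ℂ) else 0)) - (U - (l : ℂ)⁻¹ * T) := by
    split_ifs <;> push_cast <;> ring
  rw [h3, h4]
  refine (norm_sub_le _ _).trans ?_
  rw [norm_mul, Complex.norm_real, Real.norm_of_nonneg hinv]
  calc _ ≤ (1 - (l : ℝ)⁻¹) * R + (1 - (l : ℝ)⁻¹) * R := by gcongr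
    _ = _ := by ring

theorem charSumsClose_prod {S : Finset E} (hS : (0 : E) ∉ S) {M R : ℝ}
    (h : CharSumsClose S ∅ (fun _ => 1) M R) {χ : ℕ → MulChar E ℂ} (C : Finset ℕ)
    (hC : ∀ l ∈ C, l.Prime ∧ orderOf (χ l) = l) :
    CharSumsClose S C (fun x => ∏ l ∈ C, (1 - charInd (χ l) x))
      ((∏ l ∈ C, (1 - (l : ℝ)⁻¹)) * M) ((∏ l ∈ C, (1 - (l : ℝ)⁻¹)) * (2 ^ C.card * R)) := by
  induction C using Finset.induction_on with
  | empty => simpa using h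
  | insert l C hlC ih =>
    have ih' := ih fun k hk => hC k (Finset.mem_insert_of_mem hk)
    obtain ⟨hl, hχ⟩ := hC l (Finset.mem_insert_self _ _)
    have h1 := ih'.insert hS hl (fun k hk => (Nat.coprime_primes hl
      (hC k (Finset.mem_insert_of_mem hk)).1).mpr (by rintro rfl; exact hlC hk)) hχ
    simp only [Finset.prod_insert hlC, Finset.card_insert_of_notMem hlC]
    convert h1 using 1
    · ext x
      ring
    · ring
    · ring

theorem charSumsClose_invPairs {φ : AddChar E ℂ} (hφ : WeilBound φ) (A B : AddSubgroup E) :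
    CharSumsClose (invPairs A B) ∅ (fun _ => 1) ((Fintype.card E - 1) *
      ((Nat.card A : ℝ) / Fintype.card E) * ((Nat.card B : ℝ) / Fintype.card E))
      (2 * Real.sqrt (Fintype.card E)) := by
  intro ψ _
  simpa using norm_sum_invPairs_sub_le hφ A B ψ

theorem zero_notMem_invPairs (A B : AddSubgroup E) : (0 : E) ∉ invPairs A B := by
  simp [invPairs]

omit [Fintype E] in
theorem sum_eq_complex_sum {S : Finset E} (hS : (0 : E) ∉ S) (w : E → ℝ) :
    ((∑ x ∈ S, w x : ℝ) : ℂ) = ∑ x ∈ S, (w x : ℂ) * (1 : MulChar E ℂ) x := by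
  push_cast
  refine Finset.sum_congr rfl fun x hx => ?_
  have hx0 : x ≠ 0 := fun h0 => hS (h0 ▸ hx)
  rw [show (1 : MulChar E ℂ) x = 1 from MulChar.one_apply_coe (Units.mk0 x hx0), mul_one]

theorem CharSumsClose.abs_sum_sub_le {S : Finset E} {C : Finset ℕ} {w : E → ℝ} {M R : ℝ}
    (h : CharSumsClose S C w M R) (hS : (0 : E) ∉ S) : |∑ x ∈ S, w x - M| ≤ R := by
  have h1 := h 1 (by simp)
  rw [if_pos rfl, ← sum_eq_complex_sum hS, ← Complex.ofReal_sub, Complex.norm_real] at h1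
  exact h1

theorem CharSumsClose.sum_charInd_le {S : Finset E} {C : Finset ℕ} {w : E → ℝ} {M R : ℝ}
    (h : CharSumsClose S C w M R) (hS : (0 : E) ∉ S) {l : ℕ} (hl : l.Prime) (hlC : ∀ k ∈ C,
    l.Coprime k) {χ : MulChar E ℂ} (hχ : orderOf χ = l) :
    ∑ x ∈ S, w x * charInd χ x ≤ (l : ℝ)⁻¹ * M + R := by
  have h1 := h.mul_charInd hS hl hlC hχ (ψ := 1) (by simp)
  rw [← sum_eq_complex_sum hS, ← sum_eq_complex_sum hS, show (l : ℂ)⁻¹ = (((l : ℝ)⁻¹ : ℝ) : ℂ) by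
    push_cast; rfl, ← Complex.ofReal_mul, ← Complex.ofReal_sub, Complex.norm_real] at h1
  have h2 := (abs_le.mp h1).2
  have h3 := (abs_le.mp (h.abs_sum_sub_le hS)).2
  have hlr : (0 : ℝ) ≤ (l : ℝ)⁻¹ := by positivity
  nlinarith [mul_le_mul_of_nonneg_left h3 hlr]

open scoped Classical in
/-- The sieve: `x` and `x⁻¹` lie in `A` but avoid the subgroups `B f`, while the characters `χ l`
of prime order `l` are nontrivial at `x`. -/
theorem exists_of_sieve (A : AddSubgroup E) {ι : Type*} (T : Finset ι)
    (B : ι → AddSubgroup E) (hB : ∀ f ∈ T, B f ≤ A) (C R : Finset ℕ) (hCR : Disjoint C R)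
    (χ : ℕ → MulChar E ℂ) (hχ : ∀ l ∈ C ∪ R, l.Prime ∧ orderOf (χ l) = l)
    (hmain : 2 ^ C.card * (2 * Real.sqrt (Fintype.card E)) * (1 + R.card + 2 * T.card) <
      (Fintype.card E - 1) * ((Nat.card A : ℝ) / Fintype.card E) *
        ((Nat.card A : ℝ) / Fintype.card E * (1 - ∑ l ∈ R, (l : ℝ)⁻¹) -
          2 * ∑ f ∈ T, (Nat.card (B f) : ℝ) / Fintype.card E)) :
    ∃ x : E, x ≠ 0 ∧ x ∈ A ∧ x⁻¹ ∈ A ∧ (∀ l ∈ C ∪ R, χ l x ≠ 1) ∧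
      ∀ f ∈ T, x ∉ B f ∧ x⁻¹ ∉ B f := by
  obtain ⟨φ, hφ⟩ := exists_weilBound E
  set K : ℝ := Fintype.card E - 1 with hK
  set α : ℝ := (Nat.card A : ℝ) / Fintype.card E with hα
  set β : ι → ℝ := fun f => (Nat.card (B f) : ℝ) / Fintype.card E with hβ
  set e : ℝ := 2 * Real.sqrt (Fintype.card E) with he
  set w : E → ℝ := fun x => ∏ l ∈ C, (1 - charInd (χ l) x) with hw
  set θ : ℝ := ∏ l ∈ C, (1 - (l : ℝ)⁻¹) with hθ
  have hχC : ∀ l ∈ C, l.Prime ∧ orderOf (χ l) = l := fun l hl =>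
    hχ l (Finset.mem_union_left _ hl)
  have hχR : ∀ l ∈ R, l.Prime ∧ orderOf (χ l) = l := fun l hl =>
    hχ l (Finset.mem_union_right _ hl)
  have hθpos : 0 < θ := Finset.prod_pos fun l hl => by
    have : (1 : ℝ) < l := by exact_mod_cast (hχC l hl).1.one_lt
    exact sub_pos.mpr (inv_lt_one_of_one_lt₀ this)
  have hclose := fun A' B' => charSumsClose_prod (zero_notMem_invPairs A' B')
    (charSumsClose_invPairs hφ A' B') C hχC
  have hwnn : ∀ x, 0 ≤ w x := fun x => Finset.prod_nonneg fun l _ => by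
    rw [charInd]
    split_ifs <;> norm_num
  by_contra! hcon
  have hpt : ∀ x ∈ invPairs A A, w x ≤ ∑ l ∈ R, w x * charInd (χ l) x +
      (∑ f ∈ T, if x ∈ B f then w x else 0) + ∑ f ∈ T, if x⁻¹ ∈ B f then w x else 0 := by
    intro x hx
    obtain ⟨hx0, hxA, hxA'⟩ : x ≠ 0 ∧ x ∈ A ∧ x⁻¹ ∈ A := by simpa [invPairs] using hx
    have n1 : 0 ≤ ∑ l ∈ R, w x * charInd (χ l) x := Finset.sum_nonneg fun l _ =>
      mul_nonneg (hwnn x) (by rw [charInd]; split_ifs <;> norm_num)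
    have n2 : 0 ≤ ∑ f ∈ T, if x ∈ B f then w x else 0 := Finset.sum_nonneg fun f _ => by
      split_ifs <;> simp [hwnn x]
    have n3 : 0 ≤ ∑ f ∈ T, if x⁻¹ ∈ B f then w x else 0 := Finset.sum_nonneg fun f _ => by
      split_ifs <;> simp [hwnn x]
    by_cases hl : ∀ l ∈ C ∪ R, χ l x ≠ 1
    · obtain ⟨f, hf, hfx⟩ := hcon x hx0 hxA hxA' hl
      by_cases hxf : x ∈ B f
      · have := Finset.single_le_sum (f := fun f => if x ∈ B f then w x else 0)
          (fun f _ => by split_ifs <;> simp [hwnn x]) hf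
        simp only [if_pos hxf] at this
        linarith
      · have := Finset.single_le_sum (f := fun f => if x⁻¹ ∈ B f then w x else 0)
          (fun f _ => by split_ifs <;> simp [hwnn x]) hf
        simp only [if_pos (hfx hxf)] at this
        linarith
    · push Not at hl
      obtain ⟨l, hl, hlx⟩ := hl
      rcases Finset.mem_union.mp hl with hlC | hlR
      · have : w x = 0 := Finset.prod_eq_zero hlC (by simp [charInd, hlx])
        linarith
      · have := Finset.single_le_sum (f := fun l => w x * charInd (χ l) x)
          (fun l _ => mul_nonneg (hwnn x) (by rw [charInd]; split_ifs <;> norm_num)) hlR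
        simp only [charInd, hlx, if_true, mul_one] at this n1 ⊢
        linarith
  have hsum := Finset.sum_le_sum hpt
  rw [Finset.sum_add_distrib, Finset.sum_add_distrib, Finset.sum_comm, Finset.sum_comm (t := T),
    Finset.sum_comm (t := T)] at hsum
  have b0 := (abs_le.mp ((hclose A A).abs_sum_sub_le (zero_notMem_invPairs _ _))).1
  have b1 : ∑ l ∈ R, ∑ x ∈ invPairs A A, w x * charInd (χ l) x ≤
      ∑ l ∈ R, ((l : ℝ)⁻¹ * (θ * (K * α * α)) + θ * (2 ^ C.card * e)) :=
    Finset.sum_le_sum fun l hl => (hclose A A).sum_charInd_le (zero_notMem_invPairs _ _)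
      (hχR l hl).1 (fun k hk => (Nat.coprime_primes (hχR l hl).1 (hχC k hk).1).mpr
        fun h => Finset.disjoint_left.mp hCR hk (h ▸ hl)) (hχR l hl).2
  have b2 : (∑ f ∈ T, ∑ x ∈ invPairs A A, if x ∈ B f then w x else 0) ≤
      ∑ f ∈ T, (θ * (K * β f * α) + θ * (2 ^ C.card * e)) := by
    refine Finset.sum_le_sum fun f hf => ?_
    have h1 : (∑ x ∈ invPairs A A, if x ∈ B f then w x else 0) = ∑ x ∈ invPairs (B f) A, w x := by
      rw [← Finset.sum_filter]
      congr 1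
      ext x
      simp only [invPairs, Finset.mem_filter, Finset.mem_univ, true_and]
      exact ⟨fun h => ⟨h.1.1, h.2, h.1.2.2⟩, fun h => ⟨⟨h.1, hB f hf h.2.1, h.2.2⟩, h.2.1⟩⟩
    rw [h1]
    linarith [(abs_le.mp ((hclose (B f) A).abs_sum_sub_le (zero_notMem_invPairs _ _))).2]
  have b3 : (∑ f ∈ T, ∑ x ∈ invPairs A A, if x⁻¹ ∈ B f then w x else 0) ≤
      ∑ f ∈ T, (θ * (K * α * β f) + θ * (2 ^ C.card * e)) := by
    refine Finset.sum_le_sum fun f hf => ?_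
    have h1 : (∑ x ∈ invPairs A A, if x⁻¹ ∈ B f then w x else 0) =
        ∑ x ∈ invPairs A (B f), w x := by
      rw [← Finset.sum_filter]
      congr 1
      ext x
      simp only [invPairs, Finset.mem_filter, Finset.mem_univ, true_and]
      exact ⟨fun h => ⟨h.1.1, h.1.2.1, h.2⟩, fun h => ⟨⟨h.1, h.2.1, hB f hf h.2.2⟩, h.2.2⟩⟩
    rw [h1]
    linarith [(abs_le.mp ((hclose A (B f)).abs_sum_sub_le (zero_notMem_invPairs _ _))).2]
  rw [Finset.sum_add_distrib, Finset.sum_const, nsmul_eq_mul, ← Finset.sum_mul] at b1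
  rw [Finset.sum_add_distrib, Finset.sum_const, nsmul_eq_mul, ← Finset.mul_sum,
    ← Finset.sum_mul, ← Finset.mul_sum] at b2
  rw [Finset.sum_add_distrib, Finset.sum_const, nsmul_eq_mul, ← Finset.mul_sum,
    ← Finset.mul_sum] at b3
  have hfin := mul_lt_mul_of_pos_left hmain hθpos
  have key : θ * (K * α * (α * (1 - ∑ l ∈ R, (l : ℝ)⁻¹) - 2 * ∑ f ∈ T, β f)) ≤
      θ * (2 ^ C.card * e * (1 + R.card + 2 * T.card)) := by
    linear_combination hsum + b0 + b1 + b2 + b3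
  exact absurd hfin (not_lt.mpr key)

end

section

variable {Fq F : Type*} [Field Fq] [Field F] [Fintype Fq] [Algebra Fq F]

variable (Fq F) in
/-- The `q`-th power map as an `F_q`-linear endomorphism. -/
def frobLin : Module.End Fq F := (FiniteField.frobeniusAlgHom Fq F).toLinearMap

theorem frobLin_pow_apply (i : ℕ) (x : F) :
    (frobLin Fq F ^ i) x = x ^ Fintype.card Fq ^ i := by
  induction i with
  | zero => simp
  | succ i ih =>
    rw [pow_succ', Module.End.mul_apply, ih, pow_succ, pow_mul]
    rfl

theorem polyAct_eq_aeval (h : Fq[X]) (x : F) :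
    polyAct (Fintype.card Fq) h x = aeval (frobLin Fq F) h x := by
  rw [polyAct, aeval_eq_sum_range, Polynomial.sum_over_range _ (by simp), LinearMap.sum_apply]
  refine Finset.sum_congr rfl fun i _ => ?_
  rw [LinearMap.smul_apply, frobLin_pow_apply, Algebra.smul_def]

variable [Fintype F]

theorem aeval_frobLin_X_pow_sub_one :
    aeval (frobLin Fq F) (X ^ Module.finrank Fq F - 1 : Fq[X]) = 0 := by
  rw [← FiniteField.minpoly_frobeniusAlgHom Fq F]
  exact minpoly.aeval _ _

/-- The kernel of the action of `h` has at most `q ^ deg h` elements. -/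
theorem card_ker_aeval_frobLin_le {h : Fq[X]} (hh : h ≠ 0) :
    Nat.card (LinearMap.ker (aeval (frobLin Fq F) h)) ≤ Fintype.card Fq ^ h.natDegree := by
  classical
  set q := Fintype.card Fq with hq
  have hq1 : 1 < q := Fintype.one_lt_card
  set P : F[X] := ∑ i ∈ Finset.range (h.natDegree + 1),
    C (algebraMap Fq F (h.coeff i)) * X ^ q ^ i with hP
  have hev : ∀ x, P.eval x = aeval (frobLin Fq F) h x := fun x => by
    rw [hP, eval_finsetSum, aeval_eq_sum_range, LinearMap.sum_apply]
    refine Finset.sum_congr rfl fun i _ => ?_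
    rw [LinearMap.smul_apply, frobLin_pow_apply, Algebra.smul_def]
    simp [hq]
  have hcoeff : P.coeff (q ^ h.natDegree) = algebraMap Fq F h.leadingCoeff := by
    rw [hP, finsetSum_coeff, Finset.sum_eq_single h.natDegree]
    · simp
    · intro i _ hi
      rw [coeff_C_mul, coeff_X_pow, if_neg, mul_zero]
      exact fun h' => hi (Nat.pow_right_injective hq1 h').symm
    · simp
  have hP0 : P ≠ 0 := fun h0 => by
    rw [h0, coeff_zero] at hcoeff
    exact hh (leadingCoeff_eq_zero.mp ((map_eq_zero _).mp hcoeff.symm))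
  have hdeg : P.natDegree ≤ q ^ h.natDegree := by
    refine natDegree_sum_le_of_forall_le _ _ fun i hi => ?_
    refine (natDegree_C_mul_X_pow_le _ _).trans (Nat.pow_le_pow_right hq1.le ?_)
    simpa [Nat.lt_succ_iff] using hi
  have hsub : (LinearMap.ker (aeval (frobLin Fq F) h) : Set F) ⊆ (P.roots.toFinset : Set F) := by
    intro x hx
    simp only [SetLike.mem_coe, LinearMap.mem_ker] at hx
    simp [hP0, hev, hx]
  calc Nat.card (LinearMap.ker (aeval (frobLin Fq F) h))
      = (LinearMap.ker (aeval (frobLin Fq F) h) : Set F).ncard := rfl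
    _ ≤ (P.roots.toFinset : Set F).ncard := Set.ncard_le_ncard hsub
    _ ≤ Multiset.card P.roots := by
        rw [Set.ncard_coe_finset]
        exact Multiset.toFinset_card_le _
    _ ≤ _ := (card_roots' P).trans hdeg

theorem card_ker_aeval_frobLin {h k : Fq[X]} (hhk : h * k = X ^ Module.finrank Fq F - 1) :
    Nat.card (LinearMap.ker (aeval (frobLin Fq F) h)) = Fintype.card Fq ^ h.natDegree := by
  set q := Fintype.card Fq with hq
  have hn : 0 < Module.finrank Fq F := Module.finrank_pos
  have h0 : h * k ≠ 0 := by
    rw [hhk]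
    exact X_pow_sub_C_ne_zero hn 1
  have hh : h ≠ 0 := left_ne_zero_of_mul h0
  have hk : k ≠ 0 := right_ne_zero_of_mul h0
  have hdeg : h.natDegree + k.natDegree = Module.finrank Fq F := by
    rw [← natDegree_mul hh hk, hhk]
    exact natDegree_X_pow_sub_C
  refine le_antisymm (card_ker_aeval_frobLin_le hh) ?_
  have hcard : Nat.card F = q ^ Module.finrank Fq F := by
    rw [Module.natCard_eq_pow_finrank (K := Fq), Nat.card_eq_fintype_card]
  have h1 : Nat.card F = Nat.card (LinearMap.ker (aeval (frobLin Fq F) k)) *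
      Nat.card (LinearMap.range (aeval (frobLin Fq F) k)) := by
    rw [Submodule.card_eq_card_quotient_mul_card (LinearMap.ker (aeval (frobLin Fq F) k)),
      Nat.card_congr (aeval (frobLin Fq F) k).quotKerEquivRange.toEquiv]
  have h2 : LinearMap.range (aeval (frobLin Fq F) k) ≤ LinearMap.ker (aeval (frobLin Fq F) h) := by
    rintro _ ⟨x, rfl⟩
    rw [LinearMap.mem_ker, ← Module.End.mul_apply, ← map_mul, hhk, aeval_frobLin_X_pow_sub_one]
    rfl
  have h3 := Nat.card_le_card_of_injective _ (Submodule.inclusion_injective h2)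
  have h4 := card_ker_aeval_frobLin_le (F := F) hk
  rw [hcard, ← hdeg, pow_add] at h1
  have hqk : 0 < q ^ k.natDegree := pow_pos Fintype.card_pos _
  refine le_trans ?_ h3
  refine Nat.le_of_mul_le_mul_right ?_ hqk
  rw [h1, mul_comm]
  exact Nat.mul_le_mul_left _ h4

variable (Fq) in
/-- The polynomial `1 + X + ⋯ + X ^ (n - 1)`. -/
def cofactorPoly (n : ℕ) : Fq[X] := ∑ i ∈ Finset.range n, X ^ i

omit [Fintype Fq] in
theorem cofactorPoly_mul (n : ℕ) : cofactorPoly Fq n * (X - 1) = X ^ n - 1 := geom_sum_mul X n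

omit [Fintype Fq] in
theorem cofactorPoly_monic {n : ℕ} (hn : n ≠ 0) : (cofactorPoly Fq n).Monic :=
  monic_geom_sum_X hn

omit [Fintype Fq] in
theorem natDegree_cofactorPoly {n : ℕ} (hn : 0 < n) : (cofactorPoly Fq n).natDegree = n - 1 := by
  have h1 := congrArg natDegree (cofactorPoly_mul (Fq := Fq) n)
  have hX : (X - 1 : Fq[X]).Monic := monic_X_sub_C 1
  rw [(cofactorPoly_monic hn.ne').natDegree_mul hX, show (X ^ n - 1 : Fq[X]).natDegree = n from
    natDegree_X_pow_sub_C, show (X - 1 : Fq[X]).natDegree = 1 from natDegree_X_sub_C 1] at h1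
  omega

open UniqueFactorizationMonoid in
/-- If `g = (X ^ n - 1) / (X - 1)` kills `α` but no `g / f` does, for `f` an irreducible factor of
`g`, then `α` is `1`-normal. -/
theorem isKNormal_of_forall_factor [DecidableEq Fq] {n : ℕ} (hn : 0 < n) {α : F}
    (h0 : aeval (frobLin Fq F) (cofactorPoly Fq n) α = 0)
    (h1 : ∀ f ∈ normalizedFactors (cofactorPoly Fq n),
      aeval (frobLin Fq F) (cofactorPoly Fq n / f) α ≠ 0) :
    IsKNormal Fq (Fintype.card Fq) n 1 α := by
  set g := cofactorPoly Fq n with hg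
  have hgm : g.Monic := cofactorPoly_monic hn.ne'
  refine ⟨g, ⟨hgm, ⟨X - 1, (cofactorPoly_mul n).symm⟩, by rw [polyAct_eq_aeval, h0], ?_⟩,
    natDegree_cofactorPoly hn⟩
  intro h' hm' _ hk'
  rw [polyAct_eq_aeval] at hk'
  by_contra! hlt
  set d := EuclideanDomain.gcd g h' with hd
  have hdk : aeval (frobLin Fq F) d α = 0 := by
    rw [hd, EuclideanDomain.gcd_eq_gcd_ab, mul_comm g, mul_comm h', map_add, map_mul, map_mul,
      LinearMap.add_apply, Module.End.mul_apply, Module.End.mul_apply, h0, hk', map_zero, map_zero,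
      add_zero]
  obtain ⟨e, he⟩ : d ∣ g := EuclideanDomain.gcd_dvd_left g h'
  have hg0 : g ≠ 0 := hgm.ne_zero
  have hd0 : d ≠ 0 := fun h => hg0 (by rw [he, h, zero_mul])
  have he0 : e ≠ 0 := fun h => hg0 (by rw [he, h, mul_zero])
  have hdd : d.natDegree < g.natDegree :=
    (natDegree_le_of_dvd (EuclideanDomain.gcd_dvd_right g h') hm'.ne_zero).trans_lt hlt
  have heu : ¬ IsUnit e := fun hu => by
    have := natDegree_eq_zero_of_isUnit hu
    rw [he, natDegree_mul hd0 he0, this] at hdd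
    omega
  obtain ⟨f, hf⟩ := exists_mem_normalizedFactors he0 heu
  have hfg : f ∈ normalizedFactors g := by
    rw [he, normalizedFactors_mul hd0 he0]
    exact Multiset.mem_add.mpr (Or.inr hf)
  obtain ⟨e', he'⟩ := dvd_of_mem_normalizedFactors hf
  have hf0 : f ≠ 0 := (irreducible_of_normalized_factor f hf).ne_zero
  refine h1 f hfg ?_
  have : g / f = e' * d := by
    rw [he, he', show d * (f * e') = f * (e' * d) by ring, mul_div_cancel_left₀ _ hf0]
  rw [this, map_mul, Module.End.mul_apply, hdk, map_zero]

end

section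

theorem two_mul_card_le_and_sum_inv_pow_le {ι : Type*} (T : Finset ι) (d : ι → ℕ) {m s q : ℕ}
    (hq : 0 < q) (hd : ∀ f ∈ T, 1 ≤ d f) (hsum : ∑ f ∈ T, d f ≤ m)
    (hone : (T.filter fun f => d f = 1).card ≤ s) :
    2 * T.card ≤ m + s ∧
      ∑ f ∈ T, ((q : ℝ) ^ d f)⁻¹ ≤ s / q + ((m : ℝ) - s) / (2 * q ^ 2) := by
  have hq1 : (1 : ℝ) ≤ q := by exact_mod_cast hq
  constructor
  · calc 2 * T.card = ∑ f ∈ T, 2 := by simp [mul_comm]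
      _ ≤ ∑ f ∈ T, (d f + if d f = 1 then 1 else 0) := Finset.sum_le_sum fun f hf => by
          have := hd f hf
          split_ifs <;> omega
      _ ≤ m + s := by
          rw [Finset.sum_add_distrib, ← Finset.sum_filter, Finset.sum_const, smul_eq_mul, mul_one]
          exact add_le_add hsum hone
  · have hc : (0 : ℝ) ≤ 1 / q - 1 / (2 * q ^ 2) := by
      rw [sub_nonneg]
      exact one_div_le_one_div_of_le (by positivity) (by nlinarith)
    calc ∑ f ∈ T, ((q : ℝ) ^ d f)⁻¹
        ≤ ∑ f ∈ T, ((d f : ℝ) * (1 / (2 * q ^ 2)) +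
          if d f = 1 then (1 / (q : ℝ) - 1 / (2 * q ^ 2)) else 0) :=
          Finset.sum_le_sum fun f hf => by
            have h1 := hd f hf
            split_ifs with h
            · rw [h]
              apply le_of_eq
              field_simp
              ring
            · have h2 : (2 : ℝ) ≤ d f := by exact_mod_cast (by omega : 2 ≤ d f)
              rw [add_zero]
              calc ((q : ℝ) ^ d f)⁻¹ ≤ ((q : ℝ) ^ 2)⁻¹ := by
                    gcongr
                    omega
                _ = 2 * (1 / (2 * (q : ℝ) ^ 2)) := by field_simp
                _ ≤ _ := by gcongr
      _ = ((∑ f ∈ T, d f : ℕ) : ℝ) * (1 / (2 * q ^ 2)) +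
          ((T.filter fun f => d f = 1).card : ℝ) * (1 / (q : ℝ) - 1 / (2 * q ^ 2)) := by
          rw [Finset.sum_add_distrib, ← Finset.sum_filter, Finset.sum_const, nsmul_eq_mul,
            ← Finset.sum_mul]
          push_cast
          rfl
      _ ≤ m * (1 / (2 * q ^ 2)) + s * (1 / (q : ℝ) - 1 / (2 * q ^ 2)) := by
          gcongr
      _ = _ := by
          field_simp
          ring

variable {Fq F : Type*} [Field Fq] [Fintype Fq] [DecidableEq Fq]

open UniqueFactorizationMonoid

omit [Fintype Fq] in
theorem sum_natDegree_factors_le {g : Fq[X]} (hg : g ≠ 0) :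
    ∑ f ∈ (normalizedFactors g).toFinset, f.natDegree ≤ g.natDegree := by
  have h1 : ((normalizedFactors g).map natDegree).sum = g.natDegree := by
    rw [← natDegree_multiset_prod _ (zero_notMem_normalizedFactors g)]
    exact natDegree_eq_of_degree_eq (degree_eq_degree_of_associated (prod_normalizedFactors hg))
  rw [← h1, Finset.sum, Multiset.toFinset_val]
  obtain ⟨t, ht⟩ := Multiset.le_iff_exists_add.mp
    (Multiset.map_le_map (f := natDegree) (Multiset.dedup_le (normalizedFactors g)))
  rw [ht, Multiset.sum_add]
  exact Nat.le_add_right _ _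

theorem card_linear_factors_le {n : ℕ} (hn : 0 < n) (hn0 : (n : Fq) ≠ 0) :
    ((normalizedFactors (cofactorPoly Fq n)).toFinset.filter fun f => f.natDegree = 1).card ≤
      n.gcd (Fintype.card Fq - 1) - 1 := by
  set g := cofactorPoly Fq n with hg
  set m := n.gcd (Fintype.card Fq - 1) with hm
  have hg0 : g ≠ 0 := (cofactorPoly_monic hn.ne').ne_zero
  have hm0 : 0 < m := Nat.gcd_pos_of_pos_left _ hn
  set S : Finset Fq := (nthRoots m (1 : Fq)).toFinset.erase 1 with hS
  have hScard : S.card ≤ m - 1 := by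
    rw [hS, Finset.card_erase_of_mem (by simp [mem_nthRoots hm0])]
    exact Nat.sub_le_sub_right ((Multiset.toFinset_card_le _).trans (card_nthRoots m 1)) 1
  have hlin : ∀ f ∈ (normalizedFactors g).toFinset.filter fun f => f.natDegree = 1,
      f ∣ g ∧ f = X - C (-f.coeff 0) := by
    intro f hf
    rw [Finset.mem_filter, Multiset.mem_toFinset, Polynomial.mem_normalizedFactors_iff hg0] at hf
    obtain ⟨⟨_, hfm, hfg⟩, hf1⟩ := hf
    refine ⟨hfg, ?_⟩
    conv_lhs => rw [hfm.eq_X_add_C hf1]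
    simp
  refine le_trans (Finset.card_le_card_of_injOn (fun f => -f.coeff 0) ?_ ?_) hScard
  · intro f hf
    obtain ⟨hfg, hfX⟩ := hlin f hf
    set r := -f.coeff 0 with hr
    rw [hfX, dvd_iff_isRoot, IsRoot.def] at hfg
    have hrn : r ^ n = 1 := by
      have := congrArg (eval r) (cofactorPoly_mul (Fq := Fq) n)
      rw [eval_mul, ← hg, hfg, zero_mul] at this
      simpa [sub_eq_zero] using this.symm
    have hr0 : r ≠ 0 := by
      rintro h
      rw [h, zero_pow hn.ne'] at hrn
      exact zero_ne_one hrn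
    have hr1 : r ≠ 1 := by
      intro h
      rw [h, hg, cofactorPoly, eval_geom_sum] at hfg
      simp [hn0] at hfg
    have hrm : r ^ m = 1 := pow_gcd_eq_one.mpr ⟨hrn, FiniteField.pow_card_sub_one_eq_one r hr0⟩
    simp only [hS, Finset.coe_erase, Set.mem_sdiff, Finset.mem_coe, Multiset.mem_toFinset,
      mem_nthRoots hm0, Set.mem_singleton_iff]
    exact ⟨hrm, hr1⟩
  · intro f hf f' hf' h
    rw [(hlin f hf).2, (hlin f' hf').2]
    simp only at h
    rw [h]

variable [Field F] [Fintype F] [Algebra Fq F]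

omit [DecidableEq Fq] [Fintype F] in
theorem exists_algebraMap_eq_of_pow_card_eq {w : F} (hw : w ^ Fintype.card Fq = w) :
    ∃ c : Fq, algebraMap Fq F c = w := by
  classical
  set q := Fintype.card Fq with hq
  have hq1 : 1 < q := Fintype.one_lt_card
  have h0 : (X ^ q - X : F[X]) ≠ 0 := FiniteField.X_pow_card_sub_X_ne_zero F hq1
  have hmem : ∀ z : F, z ∈ (X ^ q - X : F[X]).roots.toFinset ↔ z ^ q = z := fun z => by
    rw [Multiset.mem_toFinset, mem_roots h0, IsRoot.def, eval_sub, eval_pow, eval_X, sub_eq_zero]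
  have hsub : Finset.univ.image (algebraMap Fq F) ⊆ (X ^ q - X : F[X]).roots.toFinset := by
    intro z hz
    obtain ⟨c, _, rfl⟩ := Finset.mem_image.mp hz
    rw [hmem, ← map_pow, hq, FiniteField.pow_card]
  have hcard : (X ^ q - X : F[X]).roots.toFinset.card ≤
      (Finset.univ.image (algebraMap Fq F)).card := by
    rw [Finset.card_image_of_injective _ (algebraMap Fq F).injective, Finset.card_univ]
    refine (Multiset.toFinset_card_le _).trans ((card_roots' _).trans ?_)
    rw [FiniteField.X_pow_card_sub_X_natDegree_eq F hq1]
  have := (hmem w).mpr hw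
  rw [← Finset.eq_of_subset_of_card_le hsub hcard] at this
  obtain ⟨c, _, hc⟩ := Finset.mem_image.mp this
  exact ⟨c, hc⟩

omit [DecidableEq Fq] in
/-- If `x` is not an `l`-th power for any prime `l` dividing `(q ^ n - 1) / (q - 1)`, some scalar
multiple of `x` is primitive. -/
theorem exists_smul_primitive {x : F} (hx : x ≠ 0) {N : ℕ}
    (hN : N * (Fintype.card Fq - 1) = Fintype.card F - 1)
    (h : ∀ l, l.Prime → l ∣ N → ∀ y : F, x ≠ y ^ l) :
    ∃ c : Fq, c ≠ 0 ∧ orderOf (c • x) = Fintype.card F - 1 := by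
  classical
  set q := Fintype.card Fq with hq
  set M := Fintype.card F - 1 with hM
  have hMc : Fintype.card Fˣ = M := Fintype.card_units F
  have hM0 : 0 < M := hMc ▸ Fintype.card_pos
  have hMne : NeZero M := ⟨hM0.ne'⟩
  obtain ⟨ζ, hζ⟩ := IsCyclic.exists_generator (α := Fˣ)
  have hζM : orderOf ζ = M := by
    rw [orderOf_eq_card_of_forall_mem_zpowers hζ, Nat.card_eq_fintype_card, hMc]
  obtain ⟨a, ha⟩ : ∃ a : ℕ, ζ ^ a = Units.mk0 x hx := by
    have := hζ (Units.mk0 x hx)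
    rw [← mem_powers_iff_mem_zpowers] at this
    exact this
  have hxa : x = (ζ : F) ^ a := by
    rw [← Units.val_pow_eq_pow_val, ha]
    rfl
  have hcop : a.Coprime N := by
    refine Nat.coprime_of_dvd fun l hl hla hlN => ?_
    obtain ⟨k, rfl⟩ := hla
    exact h l hl hlN ((ζ : F) ^ k) (by rw [hxa, ← pow_mul, mul_comm])
  have hNM : N ∣ M := Dvd.intro _ hN
  obtain ⟨u, hu⟩ := ZMod.unitsMap_surjective hNM (ZMod.unitOfCoprime a hcop)
  set b := (u : ZMod M).val with hb
  have hbM : b.Coprime M := ZMod.val_coe_unit_coprime u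
  have hba : b ≡ a [MOD N] := by
    rw [← ZMod.natCast_eq_natCast_iff]
    have := congrArg (fun v : (ZMod N)ˣ => (v : ZMod N)) hu
    simp only [ZMod.unitsMap_def, Units.coe_map, ZMod.coe_unitOfCoprime, MonoidHom.coe_coe] at this
    rw [← this, hb, ZMod.castHom_apply]
    exact ZMod.natCast_val _
  set w : F := (ζ : F) ^ b / (ζ : F) ^ a with hw
  have hw0 : w ≠ 0 := div_ne_zero (pow_ne_zero _ ζ.ne_zero) (pow_ne_zero _ ζ.ne_zero)
  have hw1 : w ^ (q - 1) = 1 := by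
    rw [hw, div_pow, div_eq_one_iff_eq (pow_ne_zero _ (pow_ne_zero _ ζ.ne_zero)), ← pow_mul,
      ← pow_mul, ← Units.val_pow_eq_pow_val, ← Units.val_pow_eq_pow_val]
    congr 1
    rw [pow_eq_pow_iff_modEq, hζM, ← hN]
    exact Nat.ModEq.mul_right' _ hba
  have hwq : w ^ q = w := by
    have hq1 : q = q - 1 + 1 := (Nat.succ_pred_eq_of_pos Fintype.card_pos).symm
    rw [hq1, pow_succ, hw1, one_mul]
  obtain ⟨c, hc⟩ : ∃ c : Fq, algebraMap Fq F c = w :=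
    exists_algebraMap_eq_of_pow_card_eq hwq
  refine ⟨c, ?_, ?_⟩
  · rintro rfl
    exact hw0 (by rw [← hc, map_zero])
  · rw [Algebra.smul_def, hc, hw, hxa, div_mul_cancel₀ _ (pow_ne_zero _ ζ.ne_zero),
      ← Units.val_pow_eq_pow_val, orderOf_units, Nat.Coprime.orderOf_pow, hζM]
    rw [hζM]
    exact hbM.symm

/-- The inequality needed by the sieve, with core primes `C` and remaining primes `R`. -/
def SieveInequality (q n : ℕ) (C R : Finset ℕ) : Prop :=
  2 ^ C.card * (2 * Real.sqrt ((q : ℝ) ^ n)) * (1 + R.card + (n + n.gcd (q - 1) - 2)) <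
    ((q : ℝ) ^ n - 1) / q ^ 2 * (1 - ∑ l ∈ R, (l : ℝ)⁻¹ -
      2 * ((n.gcd (q - 1) - 1) / q + (n - n.gcd (q - 1)) / (2 * q ^ 2)))

theorem exists_primitive_one_normal_pair_of_sieve {q n : ℕ} (hn : 0 < n) (hgcd : Nat.gcd q n = 1)
    (Fq F : Type*) [Field Fq] [Field F] [Fintype Fq] [Fintype F] [Algebra Fq F]
    (hcard : Fintype.card Fq = q) (hdim : Module.finrank Fq F = n) {C : Finset ℕ}
    (hC : C ⊆ (∑ i ∈ Finset.range n, q ^ i).primeFactors)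
    (hineq : SieveInequality q n C ((∑ i ∈ Finset.range n, q ^ i).primeFactors \ C)) :
    ∃ α : F, α ≠ 0 ∧ orderOf α = q ^ n - 1 ∧ orderOf α⁻¹ = q ^ n - 1 ∧
      IsKNormal Fq q n 1 α ∧ IsKNormal Fq q n 1 α⁻¹ := by
  classical
  set N := ∑ i ∈ Finset.range n, q ^ i with hN
  set R := N.primeFactors \ C with hR
  set g := cofactorPoly Fq n with hg
  set d := n.gcd (q - 1) with hd
  have hg0 : g ≠ 0 := (cofactorPoly_monic hn.ne').ne_zero
  have hgdeg : g.natDegree = n - 1 := natDegree_cofactorPoly hn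
  have hd0 : 0 < d := Nat.gcd_pos_of_pos_left _ hn
  have hdn : d ≤ n := Nat.gcd_le_left _ hn
  have hq1 : 1 < q := hcard ▸ Fintype.one_lt_card
  have hqr : (0 : ℝ) < q := by exact_mod_cast hq1.le
  have hQ : Fintype.card F = q ^ n := by
    rw [← hcard, ← hdim]
    exact Module.card_eq_pow_finrank
  have hNq : N * (q - 1) = q ^ n - 1 := by
    rw [hN, Nat.geomSum_eq hq1, Nat.div_mul_cancel (Nat.sub_one_dvd_pow_sub_one q n)]
  have hn0 : (n : Fq) ≠ 0 := by
    obtain ⟨p, hp⟩ := CharP.exists Fq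
    intro h
    have h1 : p ∣ n := (CharP.cast_eq_zero_iff Fq p n).mp h
    have h2 : p ∣ q := (CharP.cast_eq_zero_iff Fq p q).mp (hcard ▸ FiniteField.cast_card_eq_zero Fq)
    exact CharP.char_ne_one Fq p (Nat.dvd_one.mp (hgcd ▸ Nat.dvd_gcd h2 h1))
  set K : Fq[X] → Submodule Fq F := fun h => LinearMap.ker (aeval (frobLin Fq F) h) with hK
  set T := (normalizedFactors g).toFinset with hT
  have hfT : ∀ f ∈ T, Irreducible f ∧ f ∣ g := fun f hf => by
    rw [hT, Multiset.mem_toFinset, Polynomial.mem_normalizedFactors_iff hg0] at hf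
    exact ⟨hf.1, hf.2.2⟩
  have hdiv : ∀ f ∈ T, f * (g / f) = g := fun f hf =>
    EuclideanDomain.mul_div_cancel' (hfT f hf).1.ne_zero (hfT f hf).2
  have hdeg : ∀ f ∈ T, f.natDegree + (g / f).natDegree = n - 1 := fun f hf => by
    have h0 : f * (g / f) ≠ 0 := by rw [hdiv f hf]; exact hg0
    rw [← natDegree_mul (left_ne_zero_of_mul h0) (right_ne_zero_of_mul h0), hdiv f hf, hgdeg]
  have hKle : ∀ f ∈ T, (K (g / f)).toAddSubgroup ≤ (K g).toAddSubgroup := by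
    intro f hf x hx
    change aeval (frobLin Fq F) (g / f) x = 0 at hx
    change aeval (frobLin Fq F) g x = 0
    rw [← hdiv f hf, map_mul, Module.End.mul_apply, hx, map_zero]
  have hKg : (Nat.card (K g).toAddSubgroup : ℝ) / Fintype.card F = 1 / q := by
    have h1 : Nat.card (K g).toAddSubgroup = q ^ (n - 1) := by
      rw [← hcard, ← hgdeg]
      exact card_ker_aeval_frobLin (k := X - 1) (by rw [hg, cofactorPoly_mul, hdim])
    rw [h1, hQ]
    push_cast
    rw [div_eq_div_iff (by positivity) hqr.ne', one_mul, ← pow_succ, Nat.sub_add_cancel hn]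
  have hKf : ∀ f ∈ T, (Nat.card (K (g / f)).toAddSubgroup : ℝ) / Fintype.card F ≤
      1 / q * ((q : ℝ) ^ f.natDegree)⁻¹ := by
    intro f hf
    have h0 : g / f ≠ 0 := right_ne_zero_of_mul (hdiv f hf ▸ hg0)
    have h1 : Nat.card (K (g / f)).toAddSubgroup ≤ q ^ (g / f).natDegree := by
      rw [← hcard]
      exact card_ker_aeval_frobLin_le h0
    have h2 : (q : ℝ) ^ n = q ^ (g / f).natDegree * (q * q ^ f.natDegree) := by
      rw [← pow_succ', ← pow_add]
      congr 1
      have := hdeg f hf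
      omega
    rw [hQ]
    push_cast
    rw [h2, div_le_iff₀ (by positivity)]
    calc (Nat.card (K (g / f)).toAddSubgroup : ℝ) ≤ q ^ (g / f).natDegree := by exact_mod_cast h1
      _ = _ := by field_simp
  obtain ⟨hT2, hTsum⟩ := two_mul_card_le_and_sum_inv_pow_le T natDegree (by omega : 0 < q)
    (fun f hf => (hfT f hf).1.natDegree_pos) (hgdeg ▸ sum_natDegree_factors_le hg0)
    (hcard ▸ card_linear_factors_le hn hn0)
  rw [← hd] at hT2 hTsum
  have hT2' : 2 * (T.card : ℝ) ≤ n + d - 2 := by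
    have h1 : 2 * T.card + 2 ≤ n + d := by omega
    have h2 : 2 * (T.card : ℝ) + 2 ≤ n + d := by exact_mod_cast h1
    linarith
  rw [Nat.cast_sub hn, Nat.cast_sub hd0] at hTsum
  push_cast at hTsum
  have hprime : ∀ l ∈ N.primeFactors, l.Prime ∧ l ∣ Fintype.card F - 1 := fun l hl =>
    ⟨Nat.prime_of_mem_primeFactors hl, hQ ▸ hNq ▸ (Nat.dvd_of_mem_primeFactors hl).mul_right _⟩
  have hexχ : ∀ l, ∃ χ : MulChar F ℂ, l ∈ N.primeFactors → orderOf χ = l := by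
    intro l
    by_cases hl : l ∈ N.primeFactors
    · obtain ⟨χ, hχ⟩ := MulChar.exists_mulChar_orderOf F (hprime l hl).2
        (Complex.isPrimitiveRoot_exp l (hprime l hl).1.ne_zero)
      exact ⟨χ, fun _ => hχ⟩
    · exact ⟨1, fun h => absurd h hl⟩
  choose χ hχ using hexχ
  have hCR : C ∪ R = N.primeFactors := Finset.union_sdiff_of_subset hC
  obtain ⟨x, hx0, hxA, hxA', hxχ, hxT⟩ := exists_of_sieve (K g).toAddSubgroup T
    (fun f => (K (g / f)).toAddSubgroup) hKle C R Finset.disjoint_sdiff χ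
    (fun l hl => ⟨(hprime l (hCR ▸ hl)).1, hχ l (hCR ▸ hl)⟩) (by
      rw [hKg]
      have hsum : ∑ f ∈ T, (Nat.card (K (g / f)).toAddSubgroup : ℝ) / Fintype.card F ≤
          1 / q * (((d : ℝ) - 1) / q + (n - d) / (2 * q ^ 2)) := by
        refine (Finset.sum_le_sum hKf).trans ?_
        rw [← Finset.mul_sum]
        refine mul_le_mul_of_nonneg_left (hTsum.trans (le_of_eq ?_)) (by positivity)
        ring
      have hQ1 : (0 : ℝ) ≤ (q : ℝ) ^ n - 1 := sub_nonneg.mpr (one_le_pow₀ (by exact_mod_cast hq1.le))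
      rw [hQ]
      push_cast
      calc _ ≤ 2 ^ C.card * (2 * Real.sqrt ((q : ℝ) ^ n)) * (1 + R.card + (n + d - 2)) := by
            gcongr
        _ < _ := hineq
        _ = ((q : ℝ) ^ n - 1) * (1 / q) * (1 / q * (1 - ∑ l ∈ R, (l : ℝ)⁻¹) -
            2 * (1 / q * (((d : ℝ) - 1) / q + (n - d) / (2 * q ^ 2)))) := by
            rw [← hd]
            field_simp
        _ ≤ _ := by
            have : (0 : ℝ) ≤ ((q : ℝ) ^ n - 1) * (1 / q) := by positivity
            rw [hQ] at hsum
            push_cast at hsum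
            gcongr)
  rw [hCR] at hxχ
  obtain ⟨c, hc0, hc⟩ := exists_smul_primitive (Fq := Fq) hx0 (N := N) (by rw [hcard, hNq, hQ])
    (by
      intro l hl hlN y hy
      have hN0 : N ≠ 0 := by
        rintro h
        have := hNq
        rw [h, zero_mul] at this
        have := Nat.one_lt_pow hn.ne' hq1
        omega
      have hlm := Nat.mem_primeFactors.mpr ⟨hl, hlN, hN0⟩
      refine hxχ l hlm ?_
      have hy0 : y ≠ 0 := by
        rintro rfl
        exact hx0 (by rw [hy, zero_pow hl.ne_zero])
      rw [hy, map_pow, ← MulChar.pow_apply' _ hl.ne_zero]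
      nth_rewrite 2 [← hχ l hlm]
      rw [pow_orderOf_eq_one]
      exact MulChar.one_apply_coe (Units.mk0 y hy0))
  have hnormal : ∀ (c : Fq) (x : F), c ≠ 0 → x ∈ (K g).toAddSubgroup →
      (∀ f ∈ T, x ∉ (K (g / f)).toAddSubgroup) → IsKNormal Fq q n 1 (c • x) := by
    intro c x hc hx hxf
    rw [← hcard]
    refine isKNormal_of_forall_factor hn ((K g).smul_mem c hx) fun f hf h => ?_
    rw [map_smul, smul_eq_zero_iff_right hc] at h
    exact hxf f (Multiset.mem_toFinset.mpr hf) h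
  refine ⟨c • x, smul_ne_zero hc0 hx0, hQ ▸ hc, ?_, hnormal c x hc0 hxA fun f hf => (hxT f hf).1, ?_⟩
  · rw [← hQ, ← hc]
    exact orderOf_eq_orderOf_iff.mpr fun k => by rw [inv_pow, inv_eq_one]
  · rw [smul_inv₀]
    exact hnormal c⁻¹ x⁻¹ (inv_ne_zero hc0) hxA' fun f hf => (hxT f hf).2

end

theorem Nat.pow_card_le_of_forall_prime_dvd {M b : ℕ} (hM : M ≠ 0) {L : Finset ℕ}
    (hL : ∀ p ∈ L, p.Prime ∧ b ≤ p ∧ p ∣ M) : b ^ L.card ≤ M :=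
  calc b ^ L.card ≤ ∏ p ∈ L, p := Finset.pow_card_le_prod _ _ _ fun p hp => (hL p hp).2.1
    _ ≤ M := Nat.le_of_dvd (Nat.pos_of_ne_zero hM) <|
      Finset.prod_primes_dvd M (fun p hp => (hL p hp).1.prime) fun p hp => (hL p hp).2.2

theorem sieveInequality_of_le {q n : ℕ} (hn : 0 < n) (hq : 1 < q) {C R : Finset ℕ} {k m : ℕ} {s : ℝ}
    (hC : C.card ≤ k) (hR : R.card ≤ m) (hs0 : 0 < s)
    (hs : s ≤ 1 - ∑ l ∈ R, (l : ℝ)⁻¹ -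
      2 * ((n.gcd (q - 1) - 1) / q + (n - n.gcd (q - 1)) / (2 * q ^ 2)))
    (hlt : (2 ^ (k + 1) * (m + n + n.gcd (q - 1) - 1 : ℝ) * q ^ 2) ^ 2 * q ^ n <
      (((q : ℝ) ^ n - 1) * s) ^ 2) : SieveInequality q n C R := by
  unfold SieveInequality
  have hq0 : (0 : ℝ) < q := by positivity
  have hQ1 : (1 : ℝ) < (q : ℝ) ^ n := one_lt_pow₀ (by exact_mod_cast hq) hn.ne'
  have hg : (1 : ℝ) ≤ n.gcd (q - 1) := by
    exact_mod_cast Nat.gcd_pos_of_pos_left _ hn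
  have hn1 : (1 : ℝ) ≤ n := by exact_mod_cast hn
  set g := (n.gcd (q - 1) : ℝ)
  have hsq := Real.sq_sqrt (by positivity : (0 : ℝ) ≤ (q : ℝ) ^ n)
  have hlt' : 2 ^ (k + 1) * (m + n + g - 1) * (q : ℝ) ^ 2 * Real.sqrt ((q : ℝ) ^ n) <
      ((q : ℝ) ^ n - 1) * s := by
    refine lt_of_pow_lt_pow_left₀ 2 (mul_nonneg (by linarith) hs0.le) ?_
    rwa [mul_pow, hsq]
  have hC2 : (2 : ℝ) ^ C.card ≤ 2 ^ k := pow_le_pow_right₀ (by norm_num) hC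
  have hR' : (R.card : ℝ) ≤ m := by exact_mod_cast hR
  have hR0 : (0 : ℝ) ≤ R.card := by positivity
  calc _ ≤ 2 ^ k * (2 * Real.sqrt ((q : ℝ) ^ n)) * (1 + m + (n + g - 2)) :=
        mul_le_mul (by gcongr) (by linarith) (by linarith) (by positivity)
    _ < ((q : ℝ) ^ n - 1) / q ^ 2 * s := by
        rw [div_mul_eq_mul_div, lt_div_iff₀ (by positivity)]
        refine lt_of_eq_of_lt ?_ hlt'
        ring
    _ ≤ _ := by
        refine mul_le_mul_of_nonneg_left hs (div_nonneg (by linarith) (by positivity))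

theorem Finset.sum_toFinset_le_sum_map {d : List ℕ} {f : ℕ → ℝ} (hf : ∀ p, 0 ≤ f p) :
    ∑ p ∈ d.toFinset, f p ≤ (d.map f).sum := by
  induction d with
  | nil => simp
  | cons a d ih =>
    rw [List.toFinset_cons, List.map_cons, List.sum_cons]
    by_cases ha : a ∈ d.toFinset
    · rw [Finset.insert_eq_of_mem ha]
      linarith [hf a]
    · rw [Finset.sum_insert ha]
      linarith

/-- The primes of `c` form the core of the sieve, those of `d` are sieved out individually, and the
remaining ones, all at least `b`, divide `M` and are only counted. -/
theorem exists_sieveInequality_of_lists {q n b M r : ℕ} {c d : List ℕ} {s : ℝ} (hn : 0 < n)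
    (hq : 1 < q) (hb : 0 < b)
    (hcov : ∀ p, p.Prime → p ∣ ∑ i ∈ Finset.range n, q ^ i →
      p ∈ c ∨ p ∈ d ∨ (b ≤ p ∧ p ∣ M))
    (hM0 : M ≠ 0) (hM : M < b ^ (r + 1)) (hs0 : 0 < s)
    (hs : s ≤ 1 - r / b - (d.map fun p : ℕ => (p : ℝ)⁻¹).sum -
      2 * ((n.gcd (q - 1) - 1) / q + (n - n.gcd (q - 1)) / (2 * q ^ 2)))
    (hlt : (2 ^ (c.length + 1) * ((d.length + r : ℕ) + n + n.gcd (q - 1) - 1 : ℝ) * q ^ 2) ^ 2 *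
      q ^ n < (((q : ℝ) ^ n - 1) * s) ^ 2) :
    ∃ C ⊆ (∑ i ∈ Finset.range n, q ^ i).primeFactors,
      SieveInequality q n C ((∑ i ∈ Finset.range n, q ^ i).primeFactors \ C) := by
  classical
  set N := ∑ i ∈ Finset.range n, q ^ i
  set L := N.primeFactors.filter fun p => b ≤ p ∧ p ∣ M
  have hLc : L.card ≤ r := by
    have h := Nat.pow_card_le_of_forall_prime_dvd (b := b) hM0 (L := L) fun p hp => by
      obtain ⟨hpN, hp⟩ := Finset.mem_filter.mp hp
      exact ⟨Nat.prime_of_mem_primeFactors hpN, hp⟩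
    have h2 := Nat.pow_lt_pow_iff_right (a := b) (n := L.card) (m := r + 1) (by
      by_contra hb1
      obtain rfl : b = 1 := by omega
      simp only [one_pow] at hM
      omega)
    exact Nat.lt_succ_iff.mp (h2.mp (h.trans_lt hM))
  have hRsub : N.primeFactors \ N.primeFactors.filter (· ∈ c) ⊆ d.toFinset ∪ L := by
    intro p hp
    simp only [Finset.mem_sdiff, Finset.mem_filter, not_and] at hp
    rw [Finset.mem_union, List.mem_toFinset, Finset.mem_filter]
    rcases hcov p (Nat.prime_of_mem_primeFactors hp.1) (Nat.dvd_of_mem_primeFactors hp.1) with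
      h | h | h
    · exact absurd h (hp.2 hp.1)
    · exact Or.inl h
    · exact Or.inr ⟨hp.1, h⟩
  refine ⟨N.primeFactors.filter (· ∈ c), Finset.filter_subset _ _,
    sieveInequality_of_le hn hq (k := c.length) (m := d.length + r) (s := s) ?_ ?_ hs0
      (hs.trans ?_) hlt⟩
  · refine (Finset.card_le_card (t := c.toFinset) fun p hp => ?_).trans (List.toFinset_card_le c)
    exact List.mem_toFinset.mpr (Finset.mem_filter.mp hp).2
  · exact (Finset.card_le_card hRsub).trans <| (Finset.card_union_le _ _).trans <|
      add_le_add (List.toFinset_card_le d) hLc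
  · have hb0 : (0 : ℝ) < b := by exact_mod_cast hb
    have h1 : ∑ l ∈ L, (l : ℝ)⁻¹ ≤ r / b :=
      calc _ ≤ ∑ l ∈ L, (b : ℝ)⁻¹ := Finset.sum_le_sum fun p hp => by
            have : (b : ℝ) ≤ p := by exact_mod_cast (Finset.mem_filter.mp hp).2.1
            gcongr
        _ = L.card / b := by rw [Finset.sum_const, nsmul_eq_mul, div_eq_mul_inv]
        _ ≤ r / b := by gcongr
    have hf : ∀ p : ℕ, 0 ≤ (p : ℝ)⁻¹ := fun p => by positivity
    have h2 := Finset.sum_toFinset_le_sum_map (d := d) hf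
    have h3 := Finset.sum_le_sum_of_subset_of_nonneg hRsub fun p _ _ => hf p
    have h4 : ∑ p ∈ d.toFinset ∪ L, (p : ℝ)⁻¹ ≤
        ∑ p ∈ d.toFinset, (p : ℝ)⁻¹ + ∑ p ∈ L, (p : ℝ)⁻¹ := by
      rw [← Finset.sum_union_inter]
      exact le_add_of_nonneg_right (Finset.sum_nonneg fun p _ => hf p)
    linarith

theorem sum_pow_lt_two_mul {q n : ℕ} (hq : 2 ≤ q) (hn : 0 < n) :
    ∑ i ∈ Finset.range n, q ^ i < 2 * q ^ (n - 1) := by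
  obtain ⟨m, rfl⟩ : ∃ m, n = m + 1 := ⟨n - 1, by omega⟩
  rw [Finset.sum_range_succ, Nat.add_sub_cancel]
  have := Nat.geomSum_lt (s := Finset.range m) hq (n := m) fun k hk => Finset.mem_range.mp hk
  omega

theorem sum_pow_ne_zero (q : ℕ) {n : ℕ} (hn : 0 < n) : ∑ i ∈ Finset.range n, q ^ i ≠ 0 := by
  obtain ⟨m, rfl⟩ : ∃ m, n = m + 1 := ⟨n - 1, by omega⟩
  rw [Finset.sum_range_succ']
  simp

theorem gcd_loss_le {q n : ℕ} (hn : 0 < n) (hq : 1 < q) :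
    2 * (((n.gcd (q - 1) : ℝ) - 1) / q + (n - n.gcd (q - 1)) / (2 * q ^ 2)) ≤
      2 * (n - 1) / q := by
  have hg : (n.gcd (q - 1) : ℝ) ≤ n := by exact_mod_cast Nat.gcd_le_left _ hn
  have hq1 : (1 : ℝ) < q := by exact_mod_cast hq
  have : ((n : ℝ) - n.gcd (q - 1)) / (2 * q ^ 2) ≤ (n - n.gcd (q - 1)) / q := by
    apply div_le_div_of_nonneg_left <;> nlinarith
  calc _ ≤ 2 * (((n.gcd (q - 1) : ℝ) - 1) / q + (n - n.gcd (q - 1)) / q) := by gcongr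
    _ = _ := by ring

theorem mainTerm_bound {q n : ℕ} {A ρ : ℝ} (hn : 4 ≤ n) (hQ : 100 ≤ (q : ℝ) ^ n) (hρ : 0 < ρ)
    (h : A ^ 2 < (99 / 100 * ρ) ^ 2 * q ^ (n - 4)) :
    (A * q ^ 2) ^ 2 * q ^ n < (((q : ℝ) ^ n - 1) * ρ) ^ 2 := by
  have hq0 : (0 : ℝ) < q := by
    rcases Nat.eq_zero_or_pos q with rfl | h
    · simp [show n ≠ 0 by omega] at hQ
      norm_num at hQ
    · exact_mod_cast h
  calc (A * (q : ℝ) ^ 2) ^ 2 * q ^ n = A ^ 2 * (q ^ 4 * q ^ n) := by ring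
    _ < (99 / 100 * ρ) ^ 2 * q ^ (n - 4) * (q ^ 4 * q ^ n) := by gcongr
    _ = (99 / 100 * (q : ℝ) ^ n * ρ) ^ 2 := by
        have : (q : ℝ) ^ n = q ^ (n - 4) * q ^ 4 := by rw [← pow_add]; congr 1; omega
        rw [this]; ring
    _ ≤ _ := by gcongr; linarith

theorem exists_sieveInequality_of_mem_Ico {q n b q₀ q₁ r : ℕ} {c : List ℕ} (hn : 7 ≤ n) (hq₀ : 38 ≤ q₀)
    (hq : q₀ ≤ q) (hq' : q < q₁) (hb : 0 < b) (hc : ∀ p < b, p.Prime → p ∈ c)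
    (hr : 2 * q₁ ^ (n - 1) ≤ b ^ (r + 1))
    (hs : (0 : ℝ) < 1 - r / b - 2 * (n - 1) / q₀)
    (hlt : ((2 : ℝ) ^ (c.length + 1) * (r + 2 * n - 1)) ^ 2 <
      (99 / 100 * (1 - r / b - 2 * (n - 1) / q₀)) ^ 2 * q₀ ^ (n - 4)) :
    ∃ C ⊆ (∑ i ∈ Finset.range n, q ^ i).primeFactors,
      SieveInequality q n C ((∑ i ∈ Finset.range n, q ^ i).primeFactors \ C) := by
  have hqq : (q₀ : ℝ) ≤ q := by exact_mod_cast hq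
  have h38 : (38 : ℝ) ≤ q₀ := by exact_mod_cast hq₀
  have hn' : (7 : ℝ) ≤ n := by exact_mod_cast hn
  have hdiv : 2 * ((n : ℝ) - 1) / q ≤ 2 * (n - 1) / q₀ := by
    apply div_le_div_of_nonneg_left <;> linarith
  refine exists_sieveInequality_of_lists (c := c) (d := []) (b := b) (r := r)
    (M := ∑ i ∈ Finset.range n, q ^ i) (s := 1 - r / b - 2 * (n - 1) / q₀) (by omega) (by omega) hb
    ?_ (sum_pow_ne_zero _ (by omega)) ?_ hs ?_ ?_
  · intro p hp hpN
    rcases lt_or_ge p b with h | h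
    · exact Or.inl (hc p h hp)
    · exact Or.inr (Or.inr ⟨h, hpN⟩)
  · refine (sum_pow_lt_two_mul (by omega) (by omega)).trans_le (le_trans ?_ hr)
    gcongr
  · have := gcd_loss_le (q := q) (n := n) (by omega) (by omega)
    simp only [List.map_nil, List.sum_nil]
    linarith
  · refine mainTerm_bound (by omega) ?_ hs ?_
    · calc (100 : ℝ) ≤ 38 ^ 2 := by norm_num
        _ ≤ q ^ 2 := by gcongr; linarith
        _ ≤ q ^ n := pow_le_pow_right₀ (by linarith) (by omega)
    · have hg : (n.gcd (q - 1) : ℝ) ≤ n := by exact_mod_cast Nat.gcd_le_left _ (by omega)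
      have hg0 : (0 : ℝ) ≤ n.gcd (q - 1) := by positivity
      have hr0 : (0 : ℝ) ≤ r := by positivity
      simp only [List.length_nil, zero_add]
      calc _ ≤ ((2 : ℝ) ^ (c.length + 1) * (r + 2 * n - 1)) ^ 2 := by
            have h0 : (0 : ℝ) ≤ r + n + n.gcd (q - 1) - 1 := by linarith
            have h1 : (r + n + n.gcd (q - 1) - 1 : ℝ) ≤ r + 2 * n - 1 := by linarith
            gcongr
        _ < _ := hlt
        _ ≤ _ := by gcongr

theorem pow_card_primeFactors_le {N : ℕ} (hN : N ≠ 0) :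
    (64 : ℝ) ^ N.primeFactors.card ≤ 2800000000 * N := by
  set T := (Finset.range 64).filter Nat.Prime
  set S := N.primeFactors.filter (· < 64)
  have hST : S ⊆ T := fun p hp => by
    obtain ⟨h1, h2⟩ := Finset.mem_filter.mp hp
    exact Finset.mem_filter.mpr ⟨Finset.mem_range.mpr h2, Nat.prime_of_mem_primeFactors h1⟩
  have hT1 : ∀ p ∈ T, (1 : ℝ) ≤ 64 / p := fun p hp => by
    obtain ⟨h1, h2⟩ := Finset.mem_filter.mp hp
    have h3 : (p : ℝ) ≤ 64 := by exact_mod_cast (Finset.mem_range.mp h1).le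
    have h4 : (0 : ℝ) < p := by exact_mod_cast h2.pos
    rwa [le_div_iff₀ h4, one_mul]
  have hS : ∏ p ∈ S, (64 / p : ℝ) ≤ 2800000000 := by
    calc ∏ p ∈ S, (64 / p : ℝ) ≤ (∏ p ∈ T \ S, (64 / p : ℝ)) * ∏ p ∈ S, (64 / p : ℝ) := by
          refine le_mul_of_one_le_left (Finset.prod_nonneg fun p _ => by positivity) ?_
          have := Finset.prod_le_prod (s := T \ S) (f := fun _ : ℕ => (1 : ℝ))
            (g := fun p : ℕ => (64 / p : ℝ)) (fun _ _ => zero_le_one)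
            fun p hp => hT1 p (Finset.mem_sdiff.mp hp).1
          rwa [Finset.prod_const_one] at this
      _ = ∏ p ∈ T, (64 / p : ℝ) := Finset.prod_sdiff hST
      _ ≤ 2800000000 := by
          have : T = {2, 3, 5, 7, 11, 13, 17, 19, 23, 29, 31, 37, 41, 43, 47, 53, 59, 61} := by
            decide +kernel
          rw [this]
          norm_num
  have hprod : (∏ p ∈ N.primeFactors, (p : ℝ)) ≤ N := by
    rw [← Nat.cast_prod]
    exact_mod_cast Nat.le_of_dvd (Nat.pos_of_ne_zero hN) (Nat.prod_primeFactors_dvd N)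
  have hpos : ∀ p ∈ N.primeFactors, (0 : ℝ) < p := fun p hp => by
    exact_mod_cast (Nat.prime_of_mem_primeFactors hp).pos
  calc (64 : ℝ) ^ N.primeFactors.card = ∏ p ∈ N.primeFactors, (64 / p : ℝ) * p := by
        rw [Finset.prod_congr rfl fun p hp => div_mul_cancel₀ 64 (hpos p hp).ne',
          Finset.prod_const]
    _ = (∏ p ∈ N.primeFactors, (64 / p : ℝ)) * ∏ p ∈ N.primeFactors, (p : ℝ) :=
        Finset.prod_mul_distrib
    _ ≤ (∏ p ∈ S, (64 / p : ℝ)) * N := by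
        refine mul_le_mul ?_ hprod (Finset.prod_nonneg fun p _ => by positivity)
          (Finset.prod_nonneg fun p _ => by positivity)
        · rw [← Finset.prod_filter_mul_prod_filter_not N.primeFactors (· < 64)]
          refine mul_le_of_le_one_right (Finset.prod_nonneg fun p _ => by positivity) ?_
          refine Finset.prod_le_one (fun p _ => by positivity) fun p hp => ?_
          obtain ⟨h1, h2⟩ := Finset.mem_filter.mp hp
          rw [div_le_one (hpos p h1)]
          exact_mod_cast not_lt.mp h2
    _ ≤ _ := by gcongr

theorem exists_sieveInequality_of_large {q n : ℕ} (hn : 7 ≤ n) (hn' : n ≤ 13) (hq : 2 ^ 21 ≤ q) :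
    ∃ C ⊆ (∑ i ∈ Finset.range n, q ^ i).primeFactors,
      SieveInequality q n C ((∑ i ∈ Finset.range n, q ^ i).primeFactors \ C) := by
  set N := ∑ i ∈ Finset.range n, q ^ i with hN
  have hN0 : N ≠ 0 := sum_pow_ne_zero q (by omega)
  have hqR : (2 : ℝ) ^ 21 ≤ q := by exact_mod_cast hq
  have hq0 : (0 : ℝ) < q := lt_of_lt_of_le (by norm_num) hqR
  have hnR : (n : ℝ) ≤ 13 := by exact_mod_cast hn'
  have hnR' : (7 : ℝ) ≤ n := by exact_mod_cast hn
  refine ⟨N.primeFactors, subset_rfl, ?_⟩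
  refine sieveInequality_of_le (s := 99 / 100) (k := N.primeFactors.card) (m := 0) (by omega)
    (by omega) le_rfl (by simp) (by norm_num) ?_ ?_
  · have h := gcd_loss_le (q := q) (n := n) (by omega) (by omega)
    have : 2 * ((n : ℝ) - 1) / q ≤ 1 / 100 := by
      rw [div_le_iff₀ hq0]
      linarith
    rw [Finset.sdiff_self, Finset.sum_empty]
    linarith
  · refine mainTerm_bound (by omega) ?_ (by norm_num) ?_
    · calc (100 : ℝ) ≤ (2 ^ 21) ^ 1 := by norm_num
        _ ≤ q ^ 1 := by gcongr
        _ ≤ q ^ n := pow_le_pow_right₀ (by linarith) (by omega)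
    · have hg : (n.gcd (q - 1) : ℝ) ≤ n := by exact_mod_cast Nat.gcd_le_left _ (by omega)
      have hg0 : (0 : ℝ) ≤ n.gcd (q - 1) := by positivity
      set w := N.primeFactors.card
      have hNq : (N : ℝ) ≤ 2 * q ^ (n - 1) := by
        exact_mod_cast (sum_pow_lt_two_mul (by omega) (by omega)).le
      have hw : (64 : ℝ) ^ w ≤ 5600000000 * q ^ (n - 1) :=
        (pow_card_primeFactors_le hN0).trans (by linarith)
      have hA : (2 : ℝ) ^ (w + 1) * (((0 : ℕ) : ℝ) + n + n.gcd (q - 1) - 1) ≤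
          2 ^ w * (4 * n - 2) := by
        rw [pow_succ, mul_assoc, Nat.cast_zero]
        gcongr
        linarith
      have hA0 : 0 ≤ (2 : ℝ) ^ (w + 1) * (((0 : ℕ) : ℝ) + n + n.gcd (q - 1) - 1) :=
        mul_nonneg (by positivity) (by push_cast; linarith)
      refine lt_of_le_of_lt (pow_le_pow_left₀ hA0 hA 2) ?_
      refine lt_of_pow_lt_pow_left₀ 3 (by positivity) ?_
      calc (((2 : ℝ) ^ w * (4 * n - 2)) ^ 2) ^ 3 = (64 : ℝ) ^ w * (4 * n - 2) ^ 6 := by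
            rw [show (64 : ℝ) = 2 ^ 6 by norm_num, ← pow_mul 2 6 w, mul_comm 6 w, pow_mul]
            ring
        _ ≤ 5600000000 * (q : ℝ) ^ (n - 1) * (4 * n - 2) ^ 6 := by
            have : (0 : ℝ) ≤ (4 * n - 2) ^ 6 := pow_nonneg (by linarith) 6
            gcongr
        _ = 5600000000 * (4 * n - 2) ^ 6 * (q : ℝ) ^ (n - 1) := by ring
        _ < (1 / 2 * ((2 : ℝ) ^ 21) ^ (2 * n - 11)) * (q : ℝ) ^ (n - 1) := by
            have : (5600000000 * (4 * n - 2) ^ 6 : ℝ) < 1 / 2 * ((2 : ℝ) ^ 21) ^ (2 * n - 11) := by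
              clear * - hn hn'
              interval_cases n <;> norm_num
            gcongr
        _ ≤ (1 / 2 * (q : ℝ) ^ (2 * n - 11)) * (q : ℝ) ^ (n - 1) := by gcongr
        _ ≤ _ := by
            rw [mul_assoc, ← pow_add, mul_pow, ← pow_mul (q : ℝ),
              show 2 * n - 11 + (n - 1) = (n - 4) * 3 by omega]
            gcongr
            norm_num

/-- Remove from `N` the prime `p`, at most `f` times. -/
def stripPrime (p : ℕ) : ℕ → ℕ → ℕ
  | 0, N => N
  | f + 1, N => if N % p = 0 then stripPrime p f (N / p) else N

theorem dvd_stripPrime {l p : ℕ} (hl : l.Prime) (hp : p.Prime) (hlp : l ≠ p) (f : ℕ) :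
    ∀ {N : ℕ}, l ∣ N → l ∣ stripPrime p f N := by
  induction f with
  | zero => exact fun h => h
  | succ f ih =>
    intro N h
    rw [stripPrime]
    split_ifs with hN
    · refine ih ?_
      obtain ⟨m, rfl⟩ := Nat.dvd_of_mod_eq_zero hN
      rw [Nat.mul_div_cancel_left _ hp.pos]
      exact (hl.dvd_mul.mp h).resolve_left fun h => hlp ((Nat.prime_dvd_prime_iff_eq hl hp).mp h)
    · exact h

theorem stripPrime_ne_zero {p : ℕ} (f : ℕ) : ∀ {N : ℕ}, N ≠ 0 → stripPrime p f N ≠ 0 := by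
  induction f with
  | zero => exact fun h => h
  | succ f ih =>
    intro N h
    rw [stripPrime]
    split_ifs with hN
    · exact ih fun h0 => h (by
        rw [← Nat.div_mul_cancel (Nat.dvd_of_mod_eq_zero hN), h0, zero_mul])
    · exact h

def smallPrimes : List ℕ :=
  [2, 3, 5, 7, 11, 13, 17, 19, 23, 29, 31, 37, 41, 43, 47, 53, 59, 61, 67, 71, 73, 79, 83, 89, 97]

def stripPrimes (ps : List ℕ) (N : ℕ) : ℕ :=
  ps.foldr (fun p M => stripPrime p 64 M) N

theorem dvd_stripPrimes {l N : ℕ} (hl : l.Prime) {ps : List ℕ} (hps : ∀ p ∈ ps, p.Prime)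
    (hlps : l ∉ ps) (h : l ∣ N) : l ∣ stripPrimes ps N := by
  induction ps with
  | nil => exact h
  | cons p ps ih =>
    rw [List.mem_cons, not_or] at hlps
    exact dvd_stripPrime hl (hps p List.mem_cons_self) hlps.1 64
      (ih (fun p hp => hps p (List.mem_cons_of_mem _ hp)) hlps.2)

theorem stripPrimes_ne_zero {N : ℕ} {ps : List ℕ} (h : N ≠ 0) : stripPrimes ps N ≠ 0 := by
  induction ps with
  | nil => exact h
  | cons p ps ih => exact stripPrime_ne_zero 64 ih

/-- The numerator and denominator of the sum of the inverses of a list of naturals. -/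
def invSum : List ℕ → ℕ × ℕ
  | [] => (0, 1)
  | p :: ps => ((invSum ps).1 * p + (invSum ps).2, (invSum ps).2 * p)

theorem invSum_snd_pos {d : List ℕ} (hd : ∀ p ∈ d, 0 < p) : 0 < (invSum d).2 := by
  induction d with
  | nil => exact Nat.one_pos
  | cons p d ih =>
    exact Nat.mul_pos (ih fun p hp => hd p (List.mem_cons_of_mem _ hp)) (hd p List.mem_cons_self)

theorem invSum_eq {d : List ℕ} (hd : ∀ p ∈ d, 0 < p) :
    (d.map fun p : ℕ => (p : ℝ)⁻¹).sum = (invSum d).1 / (invSum d).2 := by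
  induction d with
  | nil => simp [invSum]
  | cons p d ih =>
    have hd' : ∀ p ∈ d, 0 < p := fun p hp => hd p (List.mem_cons_of_mem _ hp)
    have h1 : ((invSum d).2 : ℝ) ≠ 0 := by exact_mod_cast (invSum_snd_pos hd').ne'
    have h2 : (p : ℝ) ≠ 0 := by exact_mod_cast (hd p List.mem_cons_self).ne'
    rw [List.map_cons, List.sum_cons, ih hd', invSum]
    push_cast
    field_simp
    ring

/-- The sieve inequality with denominators cleared: the core has `k` primes, the primes of `d` are
sieved, and `r` bounds the number of the remaining ones. -/
def sieveNumeric (q n g r k m S D : ℕ) : Bool :=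
  let P := 101 * D * q ^ 2
  let T := r * D * q ^ 2 + 101 * S * q ^ 2 + 101 * D * (2 * (g - 1) * q + (n - g))
  decide (T < P) &&
    decide ((2 ^ (k + 1) * (m + r + n + g - 1) * q ^ 2 * P) ^ 2 * q ^ n <
      ((q ^ n - 1) * (P - T)) ^ 2)

def sieveCheck (q n : ℕ) : Bool :=
  let N := (q ^ n - 1) / (q - 1)
  let ps := smallPrimes.filter fun p => N % p = 0
  (List.range 12).any fun r => decide (stripPrimes ps N < 101 ^ (r + 1)) &&
    (List.range 9).any fun k =>
      sieveNumeric q n (n.gcd (q - 1)) r (ps.take k).length (ps.drop k).length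
        (invSum (ps.drop k)).1 (invSum (ps.drop k)).2

theorem mem_smallPrimes_of_prime {p : ℕ} (hp : p.Prime) (h : p < 101) : p ∈ smallPrimes := by
  have : ∀ p < 101, p.Prime → p ∈ smallPrimes := by decide +kernel
  exact this p h hp

theorem prime_of_mem_smallPrimes {p : ℕ} (hp : p ∈ smallPrimes) : p.Prime := by
  have : ∀ p ∈ smallPrimes, p.Prime := by decide +kernel
  exact this p hp

theorem exists_sieveInequality_of_sieveCheck {q n : ℕ} (hn : 0 < n) (hq : 1 < q)
    (h : sieveCheck q n = true) :
    ∃ C ⊆ (∑ i ∈ Finset.range n, q ^ i).primeFactors,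
      SieveInequality q n C ((∑ i ∈ Finset.range n, q ^ i).primeFactors \ C) := by
  simp only [sieveCheck, List.any_eq_true, Bool.and_eq_true, decide_eq_true_eq, sieveNumeric] at h
  rw [← Nat.geomSum_eq hq] at h
  obtain ⟨r, -, hr, k, -, hT, hlt⟩ := h
  have hN0 := sum_pow_ne_zero q hn
  set N := ∑ i ∈ Finset.range n, q ^ i
  set ps := smallPrimes.filter fun p => N % p = 0
  have hps : ∀ p ∈ ps, p.Prime := fun p hp => prime_of_mem_smallPrimes (List.mem_filter.mp hp).1
  have hd : ∀ p ∈ ps.drop k, 0 < p := fun p hp => (hps p (List.mem_of_mem_drop hp)).pos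
  have hD0 := invSum_snd_pos hd
  have hsum := invSum_eq hd
  set S := (invSum (ps.drop k)).1
  set D := (invSum (ps.drop k)).2
  have hg1 : 1 ≤ n.gcd (q - 1) := Nat.gcd_pos_of_pos_left _ hn
  have hgn : n.gcd (q - 1) ≤ n := Nat.gcd_le_left _ hn
  have hQ1 : 1 ≤ q ^ n := Nat.one_le_pow _ _ (by omega)
  set g := n.gcd (q - 1)
  set P := 101 * D * q ^ 2
  set T := r * D * q ^ 2 + 101 * S * q ^ 2 + 101 * D * (2 * (g - 1) * q + (n - g))
  have hq0 : (0 : ℝ) < q := by positivity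
  have hD : (0 : ℝ) < D := by exact_mod_cast hD0
  have hP : (P : ℝ) = 101 * D * q ^ 2 := by push_cast [P]; ring
  have hP0 : (0 : ℝ) < P := by rw [hP]; positivity
  have hTc : (T : ℝ) = r * D * q ^ 2 + 101 * S * q ^ 2 +
      101 * D * (2 * (g - 1) * q + (n - g)) := by
    simp only [T]
    push_cast [hg1, hgn]
    ring
  have hTP : (T : ℝ) < P := by exact_mod_cast hT
  refine exists_sieveInequality_of_lists (c := ps.take k) (d := ps.drop k) (b := 101)
    (M := stripPrimes ps N) (r := r) (s := (P - T) / P) hn hq (by norm_num) ?_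
    (stripPrimes_ne_zero hN0) hr (div_pos (by linarith) hP0) ?_ ?_
  · intro p hp hpN
    by_cases hpp : p ∈ ps
    · rw [← List.take_append_drop k ps, List.mem_append] at hpp
      tauto
    · refine Or.inr (Or.inr ⟨?_, dvd_stripPrimes hp hps hpp hpN⟩)
      by_contra hlt
      exact hpp (List.mem_filter.mpr ⟨mem_smallPrimes_of_prime hp (by omega),
        by simpa using Nat.mod_eq_zero_of_dvd hpN⟩)
  · rw [hsum, hP, hTc]
    refine le_of_eq ?_
    field_simp
    push_cast
    ring
  · have hlt' : ((2 ^ ((ps.take k).length + 1) * (((ps.drop k).length + r : ℕ) + n + g - 1) *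
        q ^ 2 * P) ^ 2 * q ^ n : ℝ) < (((q : ℝ) ^ n - 1) * (P - T)) ^ 2 := by
      have := (Nat.cast_lt (α := ℝ)).mpr hlt
      have h1 : 1 ≤ (ps.drop k).length + r + n + g := by omega
      push_cast [hT.le, hQ1, h1] at this
      push_cast
      exact this
    rw [mul_div_assoc', div_pow, lt_div_iff₀ (by positivity)]
    refine lt_of_eq_of_lt ?_ hlt'
    ring

set_option maxRecDepth 10000 in
theorem sieveCheck_seven : ∀ q < 778, 1 < q → Nat.gcd q 7 = 1 →
    q ∈ [2, 3, 4, 5, 6, 8, 15, 22] ∨ sieveCheck q 7 = true := by decide +kernel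

set_option maxRecDepth 10000 in
theorem sieveCheck_eight : ∀ q < 136, 1 < q → Nat.gcd q 8 = 1 →
    q ∈ [3, 5, 7, 9, 13, 17] ∨ sieveCheck q 8 = true := by decide +kernel

set_option maxRecDepth 10000 in
theorem sieveCheck_nine : ∀ q < 97, 1 < q → Nat.gcd q 9 = 1 →
    q ∈ [2, 4, 7, 10] ∨ sieveCheck q 9 = true := by decide +kernel

set_option maxRecDepth 10000 in
theorem sieveCheck_ten : ∀ q < 56, 1 < q → Nat.gcd q 10 = 1 →
    q ∈ [3, 11] ∨ sieveCheck q 10 = true := by decide +kernel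

set_option maxRecDepth 10000 in
theorem sieveCheck_eleven : ∀ q < 45, 1 < q → Nat.gcd q 11 = 1 →
    q ∈ [2, 3, 12] ∨ sieveCheck q 11 = true := by decide +kernel

set_option maxRecDepth 10000 in
theorem sieveCheck_twelve : ∀ q < 40, 1 < q → Nat.gcd q 12 = 1 →
    q ∈ [5, 7, 13] ∨ sieveCheck q 12 = true := by decide +kernel

set_option maxRecDepth 10000 in
theorem sieveCheck_thirteen : ∀ q < 38, 1 < q → Nat.gcd q 13 = 1 →
    q ∈ [2, 3, 14] ∨ sieveCheck q 13 = true := by decide +kernel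

theorem exists_sieveInequality_of_mem_Ico' {q n : ℕ} (b q₀ q₁ r k : ℕ) (hn : 7 ≤ n)
    (hq₀ : 38 ≤ q₀) (hq : q₀ ≤ q) (hq' : q < q₁) (hb : 0 < b)
    (hk : ((List.range b).filter fun p => p.Prime).length = k)
    (hr : 2 * q₁ ^ (n - 1) ≤ b ^ (r + 1)) (hs : (0 : ℝ) < 1 - r / b - 2 * (n - 1) / q₀)
    (hlt : ((2 : ℝ) ^ (k + 1) * (r + 2 * n - 1)) ^ 2 <
      (99 / 100 * (1 - r / b - 2 * (n - 1) / q₀)) ^ 2 * q₀ ^ (n - 4)) :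
    ∃ C ⊆ (∑ i ∈ Finset.range n, q ^ i).primeFactors,
      SieveInequality q n C ((∑ i ∈ Finset.range n, q ^ i).primeFactors \ C) :=
  exists_sieveInequality_of_mem_Ico (c := (List.range b).filter fun p => p.Prime) hn hq₀ hq hq' hb
    (fun p hp hpp => List.mem_filter.mpr ⟨List.mem_range.mpr hp, by simpa using hpp⟩) hr hs
    (by rwa [hk])

/-- The pairs `(q, n)` that the sieve does not settle. -/
def exceptionalPairs : List (ℕ × ℕ) :=
  [(2, 7), (3, 7), (4, 7), (5, 7), (8, 7),
    (3, 8), (5, 8), (7, 8), (9, 8), (13, 8), (17, 8),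
    (2, 9), (4, 9), (7, 9),
    (3, 10), (11, 10),
    (2, 11), (3, 11),
    (5, 12), (7, 12), (13, 12),
    (2, 13), (3, 13)]

theorem exists_sieveInequality {q n : ℕ} (hn : 7 ≤ n) (hn' : n ≤ 13) (hq : IsPrimePow q)
    (hgcd : Nat.gcd q n = 1) (hexc : (q, n) ∉ exceptionalPairs) :
    ∃ C ⊆ (∑ i ∈ Finset.range n, q ^ i).primeFactors,
      SieveInequality q n C ((∑ i ∈ Finset.range n, q ^ i).primeFactors \ C) := by
  rcases le_or_gt (2 ^ 21) q with hlarge | hlt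
  · exact exists_sieveInequality_of_large hn hn' hlarge
  have hq1 := hq.one_lt
  have hcheck : ∀ {t : ℕ} {l : List ℕ},
      (∀ q < t, 1 < q → Nat.gcd q n = 1 → q ∈ l ∨ sieveCheck q n = true) →
      (∀ q ∈ l, IsPrimePow q → (q, n) ∈ exceptionalPairs) → q < t →
      ∃ C ⊆ (∑ i ∈ Finset.range n, q ^ i).primeFactors,
        SieveInequality q n C ((∑ i ∈ Finset.range n, q ^ i).primeFactors \ C) :=
    fun hall hl hqt => exists_sieveInequality_of_sieveCheck (by omega) hq1 <|
      (hall q hqt hq1 hgcd).resolve_left fun h => hexc (hl q h hq)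
  have hmid : ∀ b q₀ q₁ r k : ℕ, 38 ≤ q₀ → 0 < b →
      ((List.range b).filter fun p => p.Prime).length = k →
      2 * q₁ ^ (n - 1) ≤ b ^ (r + 1) → (0 : ℝ) < 1 - r / b - 2 * (n - 1) / q₀ →
      ((2 : ℝ) ^ (k + 1) * (r + 2 * n - 1)) ^ 2 <
        (99 / 100 * (1 - r / b - 2 * (n - 1) / q₀)) ^ 2 * q₀ ^ (n - 4) →
      q₀ ≤ q → q < q₁ →
      ∃ C ⊆ (∑ i ∈ Finset.range n, q ^ i).primeFactors,
        SieveInequality q n C ((∑ i ∈ Finset.range n, q ^ i).primeFactors \ C) :=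
    fun b q₀ q₁ r k h38 hb hk hr hs hlt hq hq' =>
      exists_sieveInequality_of_mem_Ico' b q₀ q₁ r k hn h38 hq hq' hb hk hr hs hlt
  clear hq hgcd hexc
  interval_cases n
  · rcases le_or_gt 5416 q with h | hlt
    · exact hmid 29 5416 (2 ^ 21) 26 9 (by norm_num) (by norm_num) (by decide +kernel)
        (by norm_num) (by norm_num) (by norm_num) h hlt
    rcases le_or_gt 1371 q with h | hlt
    · exact hmid 23 1371 5416 16 8 (by norm_num) (by norm_num) (by decide +kernel)
        (by norm_num) (by norm_num) (by norm_num) h hlt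
    rcases le_or_gt 921 q with h | hlt
    · exact hmid 19 921 1371 14 7 (by norm_num) (by norm_num) (by decide +kernel)
        (by norm_num) (by norm_num) (by norm_num) h hlt
    rcases le_or_gt 778 q with h | hlt
    · exact hmid 17 778 921 14 6 (by norm_num) (by norm_num) (by decide +kernel)
        (by norm_num) (by norm_num) (by norm_num) h hlt
    exact hcheck sieveCheck_seven (by decide +kernel) hlt
  · rcases le_or_gt 885 q with h | hlt
    · exact hmid 37 885 (2 ^ 21) 28 11 (by norm_num) (by norm_num) (by decide +kernel)
        (by norm_num) (by norm_num) (by norm_num) h hlt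
    rcases le_or_gt 233 q with h | hlt
    · exact hmid 23 233 885 15 8 (by norm_num) (by norm_num) (by decide +kernel)
        (by norm_num) (by norm_num) (by norm_num) h hlt
    rcases le_or_gt 158 q with h | hlt
    · exact hmid 17 158 233 13 6 (by norm_num) (by norm_num) (by decide +kernel)
        (by norm_num) (by norm_num) (by norm_num) h hlt
    rcases le_or_gt 136 q with h | hlt
    · exact hmid 17 136 158 12 6 (by norm_num) (by norm_num) (by decide +kernel)
        (by norm_num) (by norm_num) (by norm_num) h hlt
    exact hcheck sieveCheck_eight (by decide +kernel) hlt
  · rcases le_or_gt 334 q with h | hlt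
    · exact hmid 41 334 (2 ^ 21) 31 12 (by norm_num) (by norm_num) (by decide +kernel)
        (by norm_num) (by norm_num) (by norm_num) h hlt
    rcases le_or_gt 97 q with h | hlt
    · exact hmid 23 97 334 15 8 (by norm_num) (by norm_num) (by decide +kernel)
        (by norm_num) (by norm_num) (by norm_num) h hlt
    exact hcheck sieveCheck_nine (by decide +kernel) hlt
  · rcases le_or_gt 200 q with h | hlt
    · exact hmid 41 200 (2 ^ 21) 35 12 (by norm_num) (by norm_num) (by decide +kernel)
        (by norm_num) (by norm_num) (by norm_num) h hlt
    rcases le_or_gt 56 q with h | hlt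
    · exact hmid 29 56 200 14 9 (by norm_num) (by norm_num) (by decide +kernel)
        (by norm_num) (by norm_num) (by norm_num) h hlt
    exact hcheck sieveCheck_ten (by decide +kernel) hlt
  · rcases le_or_gt 128 q with h | hlt
    · exact hmid 53 128 (2 ^ 21) 36 15 (by norm_num) (by norm_num) (by decide +kernel)
        (by norm_num) (by norm_num) (by norm_num) h hlt
    rcases le_or_gt 45 q with h | hlt
    · exact hmid 29 45 128 14 9 (by norm_num) (by norm_num) (by decide +kernel)
        (by norm_num) (by norm_num) (by norm_num) h hlt
    exact hcheck sieveCheck_eleven (by decide +kernel) hlt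
  · rcases le_or_gt 95 q with h | hlt
    · exact hmid 59 95 (2 ^ 21) 39 16 (by norm_num) (by norm_num) (by decide +kernel)
        (by norm_num) (by norm_num) (by norm_num) h hlt
    rcases le_or_gt 40 q with h | hlt
    · exact hmid 37 40 95 14 11 (by norm_num) (by norm_num) (by decide +kernel)
        (by norm_num) (by norm_num) (by norm_num) h hlt
    exact hcheck sieveCheck_twelve (by decide +kernel) hlt
  · rcases le_or_gt 81 q with h | hlt
    · exact hmid 67 81 (2 ^ 21) 41 18 (by norm_num) (by norm_num) (by decide +kernel)
        (by norm_num) (by norm_num) (by norm_num) h hlt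
    rcases le_or_gt 38 q with h | hlt
    · exact hmid 41 38 81 14 12 (by norm_num) (by norm_num) (by decide +kernel)
        (by norm_num) (by norm_num) (by norm_num) h hlt
    exact hcheck sieveCheck_thirteen (by decide +kernel) hlt

section

variable {Fq F : Type*} [Field Fq] [Field F] [Fintype Fq] [Algebra Fq F]

/-- An element of trace zero is `1`-normal as soon as some functional `y ↦ Tr(δ y)` vanishes on its
first `n - 2` conjugates but not on the next one. -/
theorem isKNormal_one_of_dual {n : ℕ} (hn : 2 ≤ n) {α δ : F}
    (htr : ∑ i ∈ Finset.range n, α ^ Fintype.card Fq ^ i = 0)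
    (hzero : ∀ j < n - 2, ∑ k ∈ Finset.range n,
      δ ^ Fintype.card Fq ^ k * α ^ Fintype.card Fq ^ (j + k) = 0)
    (hne : ∑ k ∈ Finset.range n,
      δ ^ Fintype.card Fq ^ k * α ^ Fintype.card Fq ^ (n - 2 + k) ≠ 0) :
    IsKNormal Fq (Fintype.card Fq) n 1 α := by
  refine ⟨cofactorPoly Fq n, ⟨cofactorPoly_monic (by omega), ⟨X - 1, (cofactorPoly_mul n).symm⟩,
    ?_, ?_⟩, natDegree_cofactorPoly (by omega)⟩
  · rw [polyAct_eq_aeval, cofactorPoly, map_sum, LinearMap.sum_apply, ← htr]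
    refine Finset.sum_congr rfl fun i _ => ?_
    rw [map_pow, aeval_X, frobLin_pow_apply]
  intro h hm _ hα
  rw [polyAct_eq_aeval] at hα
  rw [natDegree_cofactorPoly (by omega)]
  by_contra! hlt
  set r := X ^ (n - 2 - h.natDegree) * h with hr
  have hdeg : r.natDegree = n - 2 := by
    rw [hr, (monic_X_pow _).natDegree_mul hm, natDegree_X_pow]
    omega
  have hlead : r.coeff (n - 2) = 1 := by
    rw [← hdeg]
    exact ((monic_X_pow _).mul hm).coeff_natDegree
  have hconj : ∀ k, ∑ j ∈ Finset.range (n - 2 + 1),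
      algebraMap Fq F (r.coeff j) * α ^ Fintype.card Fq ^ (j + k) = 0 := fun k => by
    have : aeval (frobLin Fq F) (X ^ k * r) α = 0 := by
      rw [hr, map_mul, map_mul, Module.End.mul_apply, Module.End.mul_apply, hα, map_zero, map_zero]
    rw [← this, map_mul, map_pow, aeval_X, Module.End.mul_apply, aeval_eq_sum_range, hdeg,
      LinearMap.sum_apply, map_sum]
    refine Finset.sum_congr rfl fun j _ => ?_
    rw [LinearMap.smul_apply, map_smul, ← Module.End.mul_apply, ← pow_add, frobLin_pow_apply,
      Algebra.smul_def, add_comm]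
  apply hne
  have hsum : ∑ j ∈ Finset.range (n - 2 + 1), algebraMap Fq F (r.coeff j) *
      ∑ k ∈ Finset.range n, δ ^ Fintype.card Fq ^ k * α ^ Fintype.card Fq ^ (j + k) = 0 := by
    simp_rw [Finset.mul_sum]
    rw [Finset.sum_comm]
    refine Finset.sum_eq_zero fun k _ => ?_
    rw [← mul_zero (δ ^ Fintype.card Fq ^ k), ← hconj k, Finset.mul_sum]
    exact Finset.sum_congr rfl fun j _ => mul_left_comm _ _ _
  rwa [Finset.sum_range_succ, hlead, map_one, one_mul, Finset.sum_eq_zero, zero_add] at hsum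
  intro j hj
  rw [hzero j (Finset.mem_range.mp hj), mul_zero]
end

section

/-- `withPred (a + 1) k = k a`. -/
def withPred {β : Type} : ℕ → (ℕ → β) → β
  | 0, k => k 0
  | a + 1, k => k a

/-- `withNat a k = k a`, arranged so that the kernel evaluates `a` to a literal before entering
`k`. -/
def withNat {β : Type} (a : ℕ) (k : ℕ → β) : β := withPred (a + 1) k

/-- `withNats l k = k l`, with the entries of `l` evaluated before `k` is entered. -/
def withNats {β : Type} : List ℕ → (List ℕ → β) → β
  | [], k => k []
  | a :: l, k => withNat a fun a => withNats l fun l => k (a :: l)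

@[simp]
theorem withNat_eq {β : Type} (a : ℕ) (k : ℕ → β) : withNat a k = k a := rfl

@[simp]
theorem withNats_eq {β : Type} (l : List ℕ) (k : List ℕ → β) : withNats l k = k l := by
  induction l generalizing k with
  | nil => rfl
  | cons a l ih => rw [withNats, withNat_eq, ih]

/-- `IsPacked x K m c y`: the natural number `c` has `m` digits in base `2 ^ 32 - 1`, all at most `K`,
and replacing the base by `x` turns it into `y`. The base is odd because the kernel hashes large
literals by their lowest bits. -/
inductive IsPacked {A : Type*} [CommRing A] (x : A) (K : ℕ) : ℕ → ℕ → A → Prop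
  | nil : IsPacked x K 0 0 0
  | cons {m c : ℕ} {y : A} {d : ℕ} (hd : d ≤ K) (h : IsPacked x K m c y) :
      IsPacked x K (m + 1) (d + 4294967295 * c) (d + x * y)

namespace IsPacked

variable {A : Type*} [CommRing A] {x : A} {K K' m c c' : ℕ} {y y' : A}

theorem cast (h : IsPacked x K m c y) (hc : c = c') (hy : y = y') : IsPacked x K m c' y' :=
  hc ▸ hy ▸ h

theorem mono (h : IsPacked x K m c y) (hK : K ≤ K') : IsPacked x K' m c y := by
  induction h with
  | nil => exact nil
  | cons hd _ ih => exact cons (hd.trans hK) ih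

theorem map {R : Type*} [CommRing R] (φ : A →+* R) (h : IsPacked x K m c y) :
    IsPacked (φ x) K m c (φ y) := by
  induction h with
  | nil => rw [map_zero]; exact nil
  | cons hd _ ih => simpa using cons hd ih

theorem zero : IsPacked x K m 0 0 := by
  induction m with
  | zero => exact nil
  | succ m ih => simpa using cons (Nat.zero_le K) ih

theorem const {d : ℕ} (hm : 1 ≤ m) (hd : d ≤ K) : IsPacked x K m d (d : A) := by
  obtain ⟨m, rfl⟩ := Nat.exists_eq_add_of_le' hm
  simpa using cons hd (zero (x := x))

theorem base (hm : 2 ≤ m) (hK : 1 ≤ K) : IsPacked x K m 4294967295 x := by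
  obtain ⟨m, rfl⟩ := Nat.exists_eq_add_of_le' hm
  simpa using cons (Nat.zero_le K) (const (x := x) (m := m + 1) (by lia) hK)

theorem add (h : IsPacked x K m c y) (h' : IsPacked x K' m c' y') :
    IsPacked x (K + K') m (c + c') (y + y') := by
  induction h generalizing c' y' with
  | nil => cases h' with | nil => simpa using nil
  | cons hd _ ih =>
    cases h' with
    | cons hd' h' => exact (cons (add_le_add hd hd') (ih h')).cast (by ring) (by push_cast; ring)

theorem smul (u : ℕ) (h : IsPacked x K m c y) : IsPacked x (u * K) m (u * c) (u * y) := by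
  induction h with
  | nil => simpa using nil
  | cons hd _ ih =>
    exact (cons (Nat.mul_le_mul_left u hd) ih).cast (by ring) (by push_cast; ring)

theorem shift (h : IsPacked x K m c y) : IsPacked x K (m + 1) (4294967295 * c) (x * y) := by
  simpa using cons (Nat.zero_le K) h

theorem extend (h : IsPacked x K m c y) : IsPacked x K (m + 1) c y := by
  induction h with
  | nil => exact zero
  | cons hd _ ih => exact cons hd ih

theorem lt_pow (h : IsPacked x K m c y) (hK : K < 4294967295) : c < 4294967295 ^ m := by
  induction h with
  | nil => simp
  | cons hd _ ih => rw [pow_succ]; lia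

theorem eq_of_lt (h : IsPacked x K m c y) (h' : IsPacked x K' m c y') (hK : K < 4294967295)
    (hK' : K' < 4294967295) : y = y' := by
  obtain ⟨c', hc⟩ : ∃ c', c' = c := ⟨c, rfl⟩
  rw [← hc] at h'
  induction h generalizing c' y' with
  | nil => cases h' with | nil => rfl
  | cons hd _ ih =>
    cases h' with
    | cons hd' h' =>
      rw [ih _ h' (by lia)]
      congr 2
      lia

/-- Splitting off the leading digit. -/
theorem exists_split (h : IsPacked x K (m + 1) c y) (hK : K < 4294967295) :
    ∃ y', IsPacked x K m (c % 4294967295 ^ m) y' ∧ c / 4294967295 ^ m ≤ K ∧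
      y = y' + (c / 4294967295 ^ m : ℕ) * x ^ m := by
  induction m generalizing c y with
  | zero =>
    cases h with
    | cons hd h =>
      cases h
      exact ⟨0, (zero (x := x)).cast (by simp [Nat.mod_one]) rfl, by simpa using hd, by simp⟩
  | succ m ih =>
    cases h with
    | @cons _ c' z d hd h =>
      obtain ⟨y', h₁, h₂, h₃⟩ := ih h
      have hdiv : (d + 4294967295 * c') / 4294967295 ^ (m + 1) = c' / 4294967295 ^ m := by
        rw [pow_succ', ← Nat.div_div_eq_div_mul]
        congr 1
        lia
      have hmod : (d + 4294967295 * c') % 4294967295 ^ (m + 1) =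
          d + 4294967295 * (c' % 4294967295 ^ m) := by
        rw [pow_succ', Nat.mod_mul]
        congr 1
        · lia
        · congr 2; lia
      refine ⟨_, (cons hd h₁).cast hmod.symm rfl, hdiv ▸ h₂, ?_⟩
      rw [hdiv, h₃]
      ring

theorem degree_lt {R : Type*} [CommRing R] {f : R[X]} (h : IsPacked X K m c f) :
    f.degree < m := by
  induction h with
  | nil => simp
  | @cons m c f d hd h ih =>
    refine degree_lt_iff_coeff_zero _ _ |>.mpr fun k hk => ?_
    obtain ⟨k, rfl⟩ := Nat.exists_eq_add_of_le' (show 1 ≤ k by lia)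
    rw [coeff_add, coeff_X_mul, coeff_natCast_ite, if_neg (by lia), Nat.cast_zero, zero_add]
    exact (degree_lt_iff_coeff_zero _ _).mp ih k (by lia)

end IsPacked

/-- Reduces the lowest digits modulo `p`. -/
def packReduce (p : ℕ) : ℕ → ℕ → ℕ
  | 0, _ => 0
  | k + 1, c => withNat (Nat.div c 4294967295) fun d =>
    Nat.add (Nat.mod (Nat.mod c 4294967295) p) (Nat.mul 4294967295 (packReduce p k d))

theorem packReduce_succ (p k c : ℕ) : packReduce p (k + 1) c =
    c % 4294967295 % p + 4294967295 * packReduce p k (c / 4294967295) := rfl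

theorem exists_isPacked_packReduce {A : Type*} [CommRing A] (x : A) {p : ℕ} (hp : 0 < p)
    (m c : ℕ) : ∃ y, IsPacked x p m (packReduce p m c) y := by
  induction m generalizing c with
  | zero => exact ⟨0, .nil⟩
  | succ m ih =>
    obtain ⟨y, hy⟩ := ih (c / 4294967295)
    exact ⟨_, .cons (Nat.mod_lt _ hp).le hy⟩

theorem IsPacked.packReduce {A : Type*} [CommRing A] {x y : A} {K p m c : ℕ}
    (h : IsPacked x K m c y) (hp : 0 < p) (hpA : (p : A) = 0) (hK : K < 4294967295) :
    IsPacked x p m (packReduce p m c) y := by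
  induction h with
  | nil => exact .nil
  | @cons m c y d hd _ ih =>
    rw [packReduce_succ]
    have h₁ : (d + 4294967295 * c) % 4294967295 = d := by lia
    have h₂ : (d + 4294967295 * c) / 4294967295 = c := by lia
    rw [h₁, h₂]
    refine (IsPacked.cons (Nat.mod_lt d hp).le ih).cast rfl ?_
    conv_rhs => rw [← Nat.mod_add_div d p]
    simp [hpA]

/-- Multiplies `acc` by the base, adds `u * b`, and replaces the digit of weight `M` by its residue
modulo `p` times `P`. -/
def packStep (p P M u b acc : ℕ) : ℕ :=
  withNat (Nat.add (Nat.mul 4294967295 acc) (Nat.mul u b)) fun t =>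
    Nat.add (Nat.mod t M) (Nat.mul (Nat.mod (Nat.div t M) p) P)

/-- Horner multiplication by the lowest digits of `a`. -/
def packMul (p P M a b : ℕ) : ℕ → ℕ → ℕ
  | 0, acc => acc
  | k + 1, acc => withNat (packStep p P M
      (Nat.mod (Nat.div a (Nat.pow 4294967295 k)) 4294967295) b acc) (packMul p P M a b k)

/-- Product of two reduced packed elements, reduced. -/
def packMulMod (p m P M a b : ℕ) : ℕ := withNat (packMul p P M a b m 0) (packReduce p m)

/-- Product of a reduced packed element by the generator, reduced. -/
def packMulX (p m P M a : ℕ) : ℕ := withNat (packStep p P M 0 0 a) (packReduce p m)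

/-- Binary powering, where `g` is multiplication by the element to be raised to a power. -/
def packPow (p m P M : ℕ) (g : ℕ → ℕ) : ℕ → ℕ → ℕ
  | 0, _ => 1
  | f + 1, e => if e = 0 then 1 else
      withNat (packPow p m P M g f (e / 2)) fun r => withNat (packMulMod p m P M r r) fun s =>
        if e % 2 = 1 then g s else s

/-- The product of `acc` by all `x ^ (e / l) - 1` for `l` in a list, where `x` is the generator. -/
def packPrimProd (p m P M : ℕ) (e : ℕ) : List ℕ → ℕ → ℕ
  | [], acc => acc
  | l :: ls, acc => withNat (packPow p m P M (packMulX p m P M) 64 (e / l)) fun y =>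
      withNat (packReduce p m (y + (p - 1))) fun y =>
        withNat (packMulMod p m P M y acc) (packPrimProd p m P M e ls)

/-- The list of the first iterates of `a` under raising to the power `q`. -/
def packOrbit (p m P M : ℕ) (q : ℕ) : ℕ → ℕ → List ℕ
  | 0, _ => []
  | k + 1, a => a :: withNat (packPow p m P M (packMulMod p m P M a) 8 q) (packOrbit p m P M q k)

/-- Scalar product of lists of packed elements, not reduced. -/
def packDot (p m P M : ℕ) : List ℕ → List ℕ → ℕ → ℕ
  | a :: l, b :: l', acc => withNat (acc + packMul p P M a b m 0) (packDot p m P M l l')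
  | _, _, acc => acc

/-- The data needed for computing with packed elements: `x` satisfies the monic equation of degree
`m` encoded by `P` in characteristic `p`, and `N` products can be added without overflow. -/
structure PackedModulus {A : Type*} [CommRing A] (x : A) (p m P M N : ℕ) : Prop where
  pos : 0 < p
  cast_eq_zero : (p : A) = 0
  two_le : 2 ≤ m
  isPacked : IsPacked x p m P (x ^ m)
  eq_pow : M = 4294967295 ^ m
  lt : (N + 1) * (m * (2 * (p * p))) < 4294967295

namespace PackedModulus

variable {A : Type*} [CommRing A] {x y z : A} {p m P M N a b c : ℕ}

theorem packStep (hM : PackedModulus x p m P M N) {K u : ℕ} (hy : IsPacked x K m c y)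
    (hz : IsPacked x p m b z) (hu : u ≤ p) (hK : K + 2 * (p * p) < 4294967295) :
    IsPacked x (K + 2 * (p * p)) m (packStep p P M u b c) (x * y + u * z) := by
  have hup : u * p ≤ p * p := Nat.mul_le_mul_right p hu
  have h := hy.shift.add (hz.extend.smul u)
  obtain ⟨w, h₁, -, h₃⟩ := h.exists_split (by lia)
  rw [← hM.eq_pow] at h₁ h₃
  set t := 4294967295 * c + u * b with ht
  have hr : t / M % p ≤ p := (Nat.mod_lt _ hM.pos).le
  have hrp : t / M % p * p ≤ p * p := Nat.mul_le_mul_right p hr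
  refine ((h₁.add (hM.isPacked.smul (t / M % p))).mono (by lia)).cast rfl ?_
  rw [h₃]
  conv_rhs => rw [← Nat.mod_add_div (t / M) p]
  simp [hM.cast_eq_zero]

theorem packMul_aux (hM : PackedModulus x p m P M N) {K k : ℕ} {w : A} (hc : IsPacked x K m c w)
    (hy : IsPacked x p k (a % 4294967295 ^ k) y) (hz : IsPacked x p m b z)
    (hK : K + k * (2 * (p * p)) < 4294967295) (hp : p < 4294967295) :
    IsPacked x (K + k * (2 * (p * p))) m (packMul p P M a b k c) (x ^ k * w + y * z) := by
  induction k generalizing K c w y with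
  | zero =>
    rw [pow_zero, Nat.mod_one] at hy
    cases hy
    exact (hc.mono (by lia)).cast rfl (by simp)
  | succ k ih =>
    obtain ⟨y', h₁, h₂, h₃⟩ := hy.exists_split hp
    have hdiv : a % 4294967295 ^ (k + 1) / 4294967295 ^ k = a / 4294967295 ^ k % 4294967295 := by
      rw [pow_succ, Nat.mod_mul_right_div_self]
    rw [hdiv] at h₂ h₃
    rw [pow_succ, Nat.mod_mul_right_mod] at h₁
    have hs := hM.packStep hc hz h₂ (by lia)
    refine ((ih hs h₁ (by lia)).mono (by lia)).cast rfl ?_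
    rw [h₃]
    ring

theorem mul_bound (hM : PackedModulus x p m P M N) : m * (2 * (p * p)) < 4294967295 :=
  (Nat.le_mul_of_pos_left _ N.succ_pos).trans_lt hM.lt

theorem four_mul_le (hM : PackedModulus x p m P M N) : 2 * (2 * (p * p)) ≤ m * (2 * (p * p)) :=
  Nat.mul_le_mul_right _ hM.two_le

theorem le_sq (hM : PackedModulus x p m P M N) : p ≤ p * p := Nat.le_mul_of_pos_left p hM.pos

theorem p_lt (hM : PackedModulus x p m P M N) : p < 4294967295 := by
  have := hM.mul_bound
  have := hM.four_mul_le
  have := hM.le_sq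
  lia

theorem packMul (hM : PackedModulus x p m P M N) (hy : IsPacked x p m a y)
    (hz : IsPacked x p m b z) :
    IsPacked x (m * (2 * (p * p))) m (packMul p P M a b m 0) (y * z) := by
  have hb := hM.mul_bound
  have ha := Nat.mod_eq_of_lt (hy.lt_pow hM.p_lt)
  exact ((hM.packMul_aux (.zero (K := 0)) (hy.cast ha.symm rfl) hz (by lia) hM.p_lt).mono
    (by lia)).cast rfl (by simp)

theorem packMulMod (hM : PackedModulus x p m P M N) (hy : IsPacked x p m a y)
    (hz : IsPacked x p m b z) : IsPacked x p m (packMulMod p m P M a b) (y * z) :=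
  (hM.packMul hy hz).packReduce hM.pos hM.cast_eq_zero hM.mul_bound

theorem packMulX (hM : PackedModulus x p m P M N) (hy : IsPacked x p m a y) :
    IsPacked x p m (packMulX p m P M a) (x * y) := by
  have := hM.mul_bound
  have := hM.four_mul_le
  have := hM.le_sq
  refine ((hM.packStep hy .zero (Nat.zero_le p) (by lia)).packReduce hM.pos hM.cast_eq_zero
    (by lia)).cast rfl (by simp)

theorem one (hM : PackedModulus x p m P M N) : IsPacked x p m 1 (1 : A) := by
  have := hM.two_le
  simpa using IsPacked.const (x := x) (m := m) (by lia) (Nat.one_le_iff_ne_zero.mpr hM.pos.ne')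

theorem packPow (hM : PackedModulus x p m P M N) {g : ℕ → ℕ}
    (hg : ∀ c z, IsPacked x p m c z → IsPacked x p m (g c) (y * z)) {f e : ℕ} (he : e < 2 ^ f) :
    IsPacked x p m (packPow p m P M g f e) (y ^ e) := by
  induction f generalizing e with
  | zero =>
    obtain rfl : e = 0 := by lia
    exact hM.one.cast rfl (pow_zero y).symm
  | succ f ih =>
    have hr := ih (e := e / 2) (by rw [pow_succ] at he; lia)
    have hs := hM.packMulMod hr hr
    simp only [_root_.packPow, withNat_eq]
    split_ifs with h₀ h₁
    · exact hM.one.cast rfl (by rw [h₀, pow_zero])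
    · refine (hg _ _ hs).cast rfl ?_
      rw [← pow_add, ← pow_succ']
      congr 1
      lia
    · refine hs.cast rfl ?_
      rw [← pow_add]
      congr 1
      lia

theorem packPow_base (hM : PackedModulus x p m P M N) {e : ℕ} (he : e < 2 ^ 64) :
    IsPacked x p m (_root_.packPow p m P M (_root_.packMulX p m P M) 64 e) (x ^ e) :=
  hM.packPow (fun _ _ h => hM.packMulX h) he

theorem packPrimProd (hM : PackedModulus x p m P M N) {e : ℕ} (he : e < 2 ^ 64) (ls : List ℕ)
    (hy : IsPacked x p m a y) : IsPacked x p m (packPrimProd p m P M e ls a)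
      ((ls.map fun l => x ^ (e / l) - 1).prod * y) := by
  induction ls generalizing a y with
  | nil => exact hy.cast rfl (by simp)
  | cons l ls ih =>
    have := hM.mul_bound
    have := hM.four_mul_le
    have := hM.le_sq
    have h₁ := hM.packPow_base ((Nat.div_le_self e l).trans_lt he)
    have h₂ : IsPacked x p m (p - 1) ((p - 1 : ℕ) : A) :=
      .const (by have := hM.two_le; lia) (by lia)
    have h₃ := (h₁.add h₂).packReduce hM.pos hM.cast_eq_zero (by lia)
    refine (ih (hM.packMulMod h₃ hy)).cast rfl ?_
    rw [Nat.cast_pred hM.pos, hM.cast_eq_zero, List.map_cons, List.prod_cons]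
    ring

theorem packOrbit (hM : PackedModulus x p m P M N) {q : ℕ} (hq : q < 2 ^ 8) (k : ℕ)
    (hy : IsPacked x p m a y) :
    List.Forall₂ (IsPacked x p m) (packOrbit p m P M q k a) (List.iterate (· ^ q) y k) := by
  induction k generalizing a y with
  | zero => exact .nil
  | succ k ih => exact .cons hy (ih (hM.packPow (fun _ _ h => hM.packMulMod hy h) hq))

theorem packDot (hM : PackedModulus x p m P M N) {K : ℕ} {l l' : List ℕ} {ys zs : List A}
    (hl : List.Forall₂ (IsPacked x p m) l ys) (hl' : List.Forall₂ (IsPacked x p m) l' zs)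
    (hc : IsPacked x K m c z) :
    IsPacked x (K + l.length * (m * (2 * (p * p)))) m (packDot p m P M l l' c)
      (z + (List.zipWith (· * ·) ys zs).sum) := by
  induction hl generalizing l' zs c z K with
  | nil => exact (hc.mono (by simp)).cast rfl (by simp)
  | cons h hl ih =>
    cases hl' with
    | nil => exact (hc.mono (by simp)).cast rfl (by simp)
    | cons h' hl' =>
      refine ((ih hl' (hc.add (hM.packMul h h'))).mono ?_).cast rfl ?_
      · rw [List.length_cons]; lia
      · simp [add_assoc]

end PackedModulus

theorem isPacked_list_sum {A : Type*} [CommRing A] {x : A} {K m : ℕ} {l : List ℕ} {ys : List A}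
    (hl : List.Forall₂ (IsPacked x K m) l ys) : IsPacked x (l.length * K) m l.sum ys.sum := by
  induction hl with
  | nil => exact .zero
  | cons h _ ih =>
    rw [List.length_cons, List.sum_cons, List.sum_cons]
    exact (h.add ih).mono (by lia)

theorem List.drop_iterate {α : Type*} (f : α → α) (a : α) (n j : ℕ) :
    (List.iterate f a n).drop j = List.iterate f (f^[j] a) (n - j) := by
  refine List.ext_getElem (by simp) fun i h₁ h₂ => ?_
  simp [← Function.iterate_add_apply, add_comm]

theorem List.take_iterate_of_le {α : Type*} (f : α → α) (a : α) {n j : ℕ} (h : j ≤ n) :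
    (List.iterate f a n).take j = List.iterate f a j := by
  refine List.ext_getElem (by simpa using h) fun i h₁ h₂ => ?_
  simp

theorem iterate_pow_apply {A : Type*} [Monoid A] (q j : ℕ) (y : A) :
    (· ^ q)^[j] y = y ^ q ^ j := by
  induction j with
  | zero => simp
  | succ j ih => rw [Function.iterate_succ_apply', ih, ← pow_mul, pow_succ]

theorem sum_iterate_pow {A : Type*} [CommRing A] (q n : ℕ) (y : A) :
    (List.iterate (· ^ q) y n).sum = ∑ i ∈ Finset.range n, y ^ q ^ i := by
  induction n generalizing y with
  | zero => simp
  | succ n ih =>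
    rw [List.iterate, List.sum_cons, ih, Finset.sum_range_succ', add_comm]
    simp [← pow_mul, ← pow_succ']

theorem sum_zipWith_iterate_pow {A : Type*} [CommRing A] (q : ℕ) {n k : ℕ} (h : n ≤ k) (y z : A) :
    (List.zipWith (· * ·) (List.iterate (· ^ q) y n) (List.iterate (· ^ q) z k)).sum =
      ∑ i ∈ Finset.range n, y ^ q ^ i * z ^ q ^ i := by
  induction n generalizing y z k with
  | zero => simp
  | succ n ih =>
    obtain ⟨k, rfl⟩ := Nat.exists_eq_add_of_le' (show 1 ≤ k by lia)
    rw [List.iterate, List.iterate, List.zipWith_cons_cons, List.sum_cons, ih (by lia),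
      Finset.sum_range_succ', add_comm]
    simp [← pow_mul, ← pow_succ']
end

section

/-- Evaluates a list of digits, lowest first, in base `2 ^ 32 - 1`. -/
def packList : List ℕ → ℕ
  | [] => 0
  | a :: l => a + 4294967295 * packList l

/-- Checks that the `q`-power orbit of `a` has sum zero and that `d` is dual to the conjugate of
index `n - 2` of `a` among the first `n - 1` ones. -/
def dualCheck (p m P M q n a d : ℕ) : Bool :=
  withNats (packOrbit p m P M q (2 * n - 2) a) fun A =>
    withNats (packOrbit p m P M q n d) fun D =>
      packReduce p m (A.take n).sum == 0 &&
        (List.range (n - 1)).all fun j =>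
          packReduce p m (packDot p m P M D (A.drop j) 0) == if j = n - 2 then 1 else 0

/-- Checks that the generator has multiplicative order `e`, the list `ls` holding the primes
dividing `e` and `w` being the inverse of the product of all `x ^ (e / l) - 1`. -/
def primitiveCheck (p m P M e : ℕ) (ls : List ℕ) (w : ℕ) : Bool :=
  packPow p m P M (packMulX p m P M) 64 e == 1 &&
    packMulMod p m P M w (packPrimProd p m P M e ls 1) == 1

/-- A description of a primitive element `x` of the field with `p ^ (e * n)` elements. Elements are
given by their coordinates in the basis of powers of `x`, lowest first: `modulus` is `x ^ (e * n)`,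
`witness` proves primitivity (see `primitiveCheck`), `inverse` is `x⁻¹`, and `dual` and
`inverseDual` prove that `x` and `x⁻¹` are `1`-normal (see `dualCheck`). -/
structure PairCertificate where
  /-- the characteristic -/
  p : ℕ
  /-- the degree of the small field -/
  e : ℕ
  /-- the degree of the extension -/
  n : ℕ
  /-- the primes dividing the order of the multiplicative group -/
  primes : List ℕ
  /-- the power of the generator that defines the field -/
  modulus : List ℕ
  /-- the witness of primitivity -/
  witness : List ℕ
  /-- the inverse of the generator -/
  inverse : List ℕ
  /-- the element dual to the conjugates of the generator -/
  dual : List ℕ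
  /-- the element dual to the conjugates of the inverse of the generator -/
  inverseDual : List ℕ

/-- The computations behind `PairCertificate`, on packed elements. -/
def packCheck (p n m q Q P M w v d d' : ℕ) (ls : List ℕ) : Bool :=
  (n + 1) * (m * (2 * (p * p))) < 4294967295 && Q < 2 ^ 64 && q < 2 ^ 8 && 0 < p && 2 ≤ m &&
    2 ≤ n && ls.prod ^ 16 % (Q - 1) == 0 && packMulX p m P M v == 1 &&
    primitiveCheck p m P M (Q - 1) ls w && dualCheck p m P M q n 4294967295 d &&
    dualCheck p m P M q n v d'

/-- The validity check of a certificate. -/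
def PairCertificate.check (c : PairCertificate) : Bool :=
  withNat c.p fun p => withNat c.n fun n => withNat (c.e * n) fun m =>
    withNat (p ^ c.e) fun q => withNat (q ^ n) fun Q => withNat (4294967295 ^ m) fun M =>
      withNat (packReduce p m (packList c.modulus)) fun P =>
        withNat (packReduce p m (packList c.witness)) fun w =>
          withNat (packReduce p m (packList c.inverse)) fun v =>
            withNat (packReduce p m (packList c.dual)) fun d =>
              withNat (packReduce p m (packList c.inverseDual)) fun d' =>
                packCheck p n m q Q P M w v d d' c.primes

section
variable {A : Type*} [CommRing A] {x y z : A} {p m P M N a b c : ℕ}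

theorem PackedModulus.eq_one (hM : PackedModulus x p m P M N) (hy : IsPacked x p m c y)
    (hc : c = 1) : y = 1 :=
  hy.eq_of_lt (hc ▸ hM.one) hM.p_lt hM.p_lt

theorem PackedModulus.eq_zero (hM : PackedModulus x p m P M N) (hy : IsPacked x p m c y)
    (hc : c = 0) : y = 0 :=
  hy.eq_of_lt (hc ▸ IsPacked.zero (K := p)) hM.p_lt hM.p_lt

theorem PackedModulus.sums_of_dualCheck {q n d : ℕ} (hM : PackedModulus x p m P M n)
    (hq : q < 2 ^ 8) (hn : 2 ≤ n) (hy : IsPacked x p m a y) (hz : IsPacked x p m d z)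
    (h : dualCheck p m P M q n a d = true) :
    ∑ i ∈ Finset.range n, y ^ q ^ i = 0 ∧ ∀ j < n - 1,
      ∑ k ∈ Finset.range n, z ^ q ^ k * y ^ q ^ (j + k) = if j = n - 2 then 1 else 0 := by
  simp only [dualCheck, withNats_eq, Bool.and_eq_true, beq_iff_eq, List.all_eq_true,
    List.mem_range] at h
  have hA := hM.packOrbit hq (2 * n - 2) hy
  have hD := hM.packOrbit hq n hz
  have hlen : (_root_.packOrbit p m P M q n d).length = n := by
    rw [hD.length_eq, List.length_iterate]
  have hlt := hM.lt
  have := hM.le_sq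
  have := hM.four_mul_le
  refine ⟨?_, fun j hj => ?_⟩
  · have hs := isPacked_list_sum (List.forall₂_take n hA)
    rw [List.take_iterate_of_le _ _ (by lia), sum_iterate_pow] at hs
    refine hM.eq_zero (hs.packReduce hM.pos hM.cast_eq_zero ?_) h.1
    refine lt_of_le_of_lt ?_ hlt
    exact Nat.mul_le_mul ((List.length_take_le _ _).trans n.le_succ) (by lia)
  · have hs := hM.packDot hD (List.forall₂_drop j hA) (.zero (K := 0))
    rw [List.drop_iterate, sum_zipWith_iterate_pow q (by lia), iterate_pow_apply, hlen, zero_add,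
      zero_add] at hs
    simp only [← pow_mul, ← pow_add] at hs
    have hr := hs.packReduce hM.pos hM.cast_eq_zero (by lia)
    have hj' := h.2 j hj
    split_ifs at hj' ⊢ with hjn
    · exact hM.eq_one hr hj'
    · exact hM.eq_zero hr hj'

theorem PackedModulus.pow_eq_one_of_primitiveCheck {e w : ℕ} {ls : List ℕ}
    (hM : PackedModulus x p m P M N) (he : e < 2 ^ 64)
    (h : primitiveCheck p m P M e ls w = true) : x ^ e = 1 := by
  simp only [primitiveCheck, Bool.and_eq_true, beq_iff_eq] at h
  exact hM.eq_one (hM.packPow_base he) h.1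

theorem PackedModulus.pow_ne_one_of_primitiveCheck [Nontrivial A] {e w : ℕ} {ls : List ℕ}
    (hM : PackedModulus x p m P M N) (he : e < 2 ^ 64) (hz : IsPacked x p m w z)
    (h : primitiveCheck p m P M e ls w = true) {l : ℕ} (hl : l ∈ ls) : x ^ (e / l) ≠ 1 := by
  simp only [primitiveCheck, Bool.and_eq_true, beq_iff_eq] at h
  have hprod := hM.eq_one (hM.packMulMod hz (hM.packPrimProd he ls hM.one)) h.2
  intro hx
  rw [List.prod_eq_zero (List.mem_map.mpr ⟨l, hl, sub_eq_zero.mpr hx⟩), zero_mul,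
    mul_zero] at hprod
  exact zero_ne_one hprod
end

/-- A polynomial equation whose formal root has order dividing `card F - 1` has a root in `F`. -/
theorem exists_root_of_primitiveCheck {F : Type*} [Field F] [Fintype F] {p m P M N w : ℕ}
    {ls : List ℕ} {f : F[X]} (hf : IsPacked X p m P f) (hp : 0 < p) (hpF : (p : F) = 0)
    (hm : 2 ≤ m) (hM : M = 4294967295 ^ m) (hlt : (N + 1) * (m * (2 * (p * p))) < 4294967295)
    (hF : Fintype.card F < 2 ^ 64)
    (h : primitiveCheck p m P M (Fintype.card F - 1) ls w = true) :
    ∃ x : F, PackedModulus x p m P M N := by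
  have hdeg : (X ^ m - f).degree = (m : WithBot ℕ) := by
    rw [degree_sub_eq_left_of_degree_lt] <;> rw [degree_X_pow]
    exact hf.degree_lt
  have hroot : PackedModulus (AdjoinRoot.root (X ^ m - f)) p m P M N := by
    refine ⟨hp, ?_, hm, ?_, hM, hlt⟩
    · rw [← map_natCast (AdjoinRoot.of (X ^ m - f)), hpF, map_zero]
    · refine (hf.map (AdjoinRoot.mk (X ^ m - f))).cast rfl ?_
      rw [eq_comm, ← sub_eq_zero, ← AdjoinRoot.mk_X, ← map_pow, ← map_sub]
      exact AdjoinRoot.mk_self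
  have hpow := hroot.pow_eq_one_of_primitiveCheck (by lia) h
  have hcard : 1 < Fintype.card F := Fintype.one_lt_card
  have hdvd : X ^ m - f ∣ X ^ Fintype.card F - X := by
    rw [← AdjoinRoot.mk_eq_zero, map_sub, map_pow, AdjoinRoot.mk_X, ← Nat.sub_add_cancel hcard.le,
      pow_succ, hpow, one_mul, sub_self]
  have hall : (X ^ Fintype.card F - X : F[X]).Splits := by
    simpa using IsSplittingField.splits (L := F) (X ^ Fintype.card F - X : F[X])
  have hsplit : (X ^ m - f).Splits :=
    hall.of_dvd (FiniteField.X_pow_card_sub_X_ne_zero F hcard) hdvd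
  obtain ⟨x, hx⟩ := hsplit.exists_eval_eq_zero (by rw [hdeg]; exact_mod_cast (by lia : m ≠ 0))
  refine ⟨x, hp, hpF, hm, ?_, hM, hlt⟩
  rw [eval_sub, eval_pow, eval_X, sub_eq_zero] at hx
  rw [hx]
  simpa using hf.map (evalRingHom x)

theorem exists_primitive_one_normal_pair_of_check (c : PairCertificate)
    (hprimes : ∀ l ∈ c.primes, l.Prime) (hc : c.check = true)
    (Fq F : Type*) [Field Fq] [Field F] [Fintype Fq] [Fintype F] [Algebra Fq F]
    (hcard : Fintype.card Fq = c.p ^ c.e) (hdim : Module.finrank Fq F = c.n) :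
    ∃ α : F, α ≠ 0 ∧ orderOf α = (c.p ^ c.e) ^ c.n - 1 ∧
      orderOf α⁻¹ = (c.p ^ c.e) ^ c.n - 1 ∧
      IsKNormal Fq (c.p ^ c.e) c.n 1 α ∧ IsKNormal Fq (c.p ^ c.e) c.n 1 α⁻¹ := by
  simp only [PairCertificate.check, withNat_eq, packCheck, Bool.and_eq_true, beq_iff_eq,
    decide_eq_true_eq] at hc
  obtain ⟨⟨⟨⟨⟨⟨⟨⟨⟨⟨hlt, hQ⟩, hq⟩, hp⟩, hm⟩, hn⟩, hls⟩, hv⟩, hprim⟩, hd⟩, hd'⟩ := hc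
  have hcardF : Fintype.card F = (c.p ^ c.e) ^ c.n := by
    rw [Module.card_eq_pow_finrank (K := Fq), hcard, hdim]
  have hpF : (c.p : F) = 0 := by
    have h : ((c.p ^ c.e : ℕ) : F) = 0 := by
      rw [← hcard, ← map_natCast (algebraMap Fq F), Nat.cast_card_eq_zero, map_zero]
    rw [Nat.cast_pow] at h
    exact eq_zero_of_pow_eq_zero h
  obtain ⟨f, hf⟩ := exists_isPacked_packReduce (X : F[X]) hp (c.e * c.n) (packList c.modulus)
  rw [← hcardF] at hQ hls hprim ⊢
  obtain ⟨x, hM⟩ := exists_root_of_primitiveCheck hf hp hpF hm rfl hlt hQ hprim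
  obtain ⟨w, hw⟩ := exists_isPacked_packReduce x hp (c.e * c.n) (packList c.witness)
  obtain ⟨y, hy⟩ := exists_isPacked_packReduce x hp (c.e * c.n) (packList c.inverse)
  obtain ⟨z, hz⟩ := exists_isPacked_packReduce x hp (c.e * c.n) (packList c.dual)
  obtain ⟨z', hz'⟩ := exists_isPacked_packReduce x hp (c.e * c.n) (packList c.inverseDual)
  have hxy : x * y = 1 := hM.eq_one (hM.packMulX hy) hv
  obtain rfl : y = x⁻¹ := eq_inv_of_mul_eq_one_right hxy
  have hcard' : 1 < Fintype.card F := Fintype.one_lt_card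
  have horder : orderOf x = Fintype.card F - 1 := by
    refine orderOf_eq_of_pow_and_pow_div_prime (by lia)
      (hM.pow_eq_one_of_primitiveCheck (by lia) hprim) fun r hr hrQ => ?_
    have hr' : r ∣ c.primes.prod :=
      hr.dvd_of_dvd_pow (hrQ.trans (Nat.dvd_of_mod_eq_zero hls))
    obtain ⟨l, hl, hrl⟩ := (Prime.dvd_prod_iff hr.prime).mp hr'
    obtain rfl := (Nat.prime_dvd_prime_iff_eq hr (hprimes l hl)).mp hrl
    exact hM.pow_ne_one_of_primitiveCheck (by lia) hw hprim hl
  have hnormal : ∀ {a b : ℕ} {α δ : F}, IsPacked x c.p (c.e * c.n) a α →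
      IsPacked x c.p (c.e * c.n) b δ → dualCheck c.p (c.e * c.n)
        (packReduce c.p (c.e * c.n) (packList c.modulus)) (4294967295 ^ (c.e * c.n)) (c.p ^ c.e)
        c.n a b = true → IsKNormal Fq (c.p ^ c.e) c.n 1 α := by
    intro a b α δ hα hδ h
    obtain ⟨h₁, h₂⟩ := hM.sums_of_dualCheck hq hn hα hδ h
    rw [← hcard] at h₁ h₂ ⊢
    refine isKNormal_one_of_dual (δ := δ) hn h₁ (fun j hj => ?_) ?_
    · rw [h₂ j (by lia), if_neg (by lia)]
    · rw [h₂ _ (by lia), if_pos rfl]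
      exact one_ne_zero
  refine ⟨x, left_ne_zero_of_mul_eq_one hxy, horder, ?_, hnormal (.base hm hp) hz hd,
    hnormal hy hz' hd'⟩
  rw [← horder]
  exact orderOf_eq_orderOf_iff.mpr fun k => by rw [inv_pow, inv_eq_one]

/-- Primitive elements for the exceptional pairs with `n = 7`. -/
def pairCertificatesSeven : List PairCertificate := [
    { p := 2, e := 1, n := 7, primes := [127], modulus := [1, 0, 0, 1, 1, 1, 0],
      witness := [0, 0, 0, 1, 0, 1, 1], inverse := [0, 0, 1, 1, 1, 0, 1],
      dual := [0, 0, 1, 1, 1, 0, 0], inverseDual := [0, 1, 0, 0, 1, 0, 0] },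
    { p := 3, e := 1, n := 7, primes := [2, 1093], modulus := [2, 0, 1, 2, 1, 2, 0],
      witness := [1, 0, 2, 2, 0, 1, 0], inverse := [0, 1, 2, 1, 2, 0, 2],
      dual := [0, 2, 1, 0, 0, 1, 0], inverseDual := [0, 0, 0, 2, 1, 1, 2] },
    { p := 2, e := 2, n := 7, primes := [3, 43, 127],
      modulus := [1, 0, 0, 0, 0, 1, 1, 0, 1, 1, 1, 1, 1, 0],
      witness := [1, 0, 0, 0, 0, 1, 0, 1, 1, 0, 1, 0, 1, 1],
      inverse := [0, 0, 0, 0, 1, 1, 0, 1, 1, 1, 1, 1, 0, 1],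
      dual := [0, 0, 1, 1, 1, 0, 1, 0, 1, 1, 1, 1, 1, 0],
      inverseDual := [0, 0, 1, 0, 0, 1, 1, 0, 0, 0, 1, 1, 0, 0] },
    { p := 5, e := 1, n := 7, primes := [2, 19531], modulus := [2, 0, 3, 1, 2, 4, 0],
      witness := [2, 0, 3, 0, 4, 1, 4], inverse := [0, 1, 2, 4, 3, 0, 3],
      dual := [0, 2, 0, 0, 3, 4, 3], inverseDual := [0, 3, 0, 1, 4, 2, 3] },
    { p := 2, e := 3, n := 7, primes := [7, 127, 337],
      modulus := [1, 0, 0, 0, 1, 1, 0, 0, 1, 1, 0, 1, 0, 0, 1, 0, 0, 0, 1, 0, 0],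
      witness := [1, 0, 0, 0, 0, 0, 0, 1, 0, 1, 1, 1, 0, 1, 0, 1, 0, 0, 1, 1, 0],
      inverse := [0, 0, 0, 1, 1, 0, 0, 1, 1, 0, 1, 0, 0, 1, 0, 0, 0, 1, 0, 0, 1],
      dual := [0, 1, 0, 0, 0, 0, 1, 0, 1, 0, 1, 0, 0, 0, 0, 0, 1, 1, 0, 0, 0],
      inverseDual := [0, 0, 1, 1, 0, 1, 0, 0, 1, 1, 0, 0, 0, 0, 0, 1, 1, 1, 0, 0, 0] }]

/-- Primitive elements for the exceptional pairs with `n = 8`. -/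
def pairCertificatesEight : List PairCertificate := [
    { p := 3, e := 1, n := 8, primes := [2, 5, 41], modulus := [1, 0, 1, 1, 1, 1, 1, 0],
      witness := [2, 2, 0, 2, 1, 2, 1, 2], inverse := [0, 2, 2, 2, 2, 2, 0, 1],
      dual := [0, 2, 1, 0, 2, 2, 0, 2], inverseDual := [0, 2, 0, 2, 2, 0, 1, 0] },
    { p := 5, e := 1, n := 8, primes := [2, 3, 13, 313], modulus := [2, 0, 2, 0, 2, 3, 4, 0],
      witness := [1, 4, 1, 4, 3, 0, 4, 2], inverse := [0, 4, 0, 4, 1, 3, 0, 3],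
      dual := [0, 2, 4, 1, 0, 1, 4, 3], inverseDual := [0, 2, 0, 1, 4, 4, 2, 3] },
    { p := 7, e := 1, n := 8, primes := [2, 3, 5, 1201], modulus := [2, 0, 5, 5, 0, 2, 3, 0],
      witness := [1, 1, 4, 3, 6, 3, 3, 2], inverse := [0, 1, 1, 0, 6, 2, 0, 4],
      dual := [0, 6, 3, 4, 5, 4, 6, 4], inverseDual := [0, 5, 3, 5, 3, 6, 1, 3] },
    { p := 3, e := 2, n := 8, primes := [2, 5, 17, 41, 193],
      modulus := [1, 0, 0, 2, 2, 2, 1, 0, 0, 1, 0, 1, 0, 2, 0, 0],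
      witness := [0, 0, 1, 2, 1, 0, 1, 1, 0, 1, 1, 2, 2, 1, 2, 0],
      inverse := [0, 0, 1, 1, 1, 2, 0, 0, 2, 0, 2, 0, 1, 0, 0, 1],
      dual := [0, 2, 1, 0, 1, 0, 0, 0, 1, 2, 1, 1, 0, 1, 1, 0],
      inverseDual := [0, 0, 0, 0, 0, 2, 2, 1, 0, 0, 1, 0, 2, 2, 2, 0] },
    { p := 13, e := 1, n := 8, primes := [2, 3, 5, 7, 17, 14281],
      modulus := [11, 0, 11, 7, 2, 7, 10, 0], witness := [9, 4, 10, 2, 9, 5, 5, 7],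
      inverse := [0, 12, 10, 1, 10, 5, 0, 6], dual := [0, 0, 5, 5, 10, 1, 4, 4],
      inverseDual := [0, 1, 11, 10, 0, 8, 1, 3] },
    { p := 17, e := 1, n := 8, primes := [2, 3, 5, 29, 41761],
      modulus := [5, 0, 14, 3, 3, 11, 5, 0], witness := [4, 14, 8, 13, 3, 1, 2, 6],
      inverse := [0, 4, 13, 13, 8, 16, 0, 7], dual := [0, 10, 11, 1, 2, 12, 15, 1],
      inverseDual := [0, 8, 12, 14, 4, 12, 10, 3] }]

/-- Primitive elements for the exceptional pairs with `n = 9`. -/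
def pairCertificatesNine : List PairCertificate := [
    { p := 2, e := 1, n := 9, primes := [7, 73], modulus := [1, 0, 1, 1, 0, 1, 0, 0, 0],
      witness := [0, 0, 1, 1, 1, 0, 1, 1, 0], inverse := [0, 1, 1, 0, 1, 0, 0, 0, 1],
      dual := [0, 1, 0, 0, 1, 1, 1, 1, 1], inverseDual := [0, 1, 0, 1, 1, 1, 1, 1, 1] },
    { p := 2, e := 2, n := 9, primes := [3, 7, 19, 73],
      modulus := [1, 0, 1, 1, 1, 1, 1, 0, 0, 0, 0, 1, 1, 1, 1, 0, 0, 0],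
      witness := [0, 1, 0, 1, 0, 0, 1, 1, 0, 0, 0, 1, 1, 0, 1, 1, 0, 1],
      inverse := [0, 1, 1, 1, 1, 1, 0, 0, 0, 0, 1, 1, 1, 1, 0, 0, 0, 1],
      dual := [0, 1, 0, 0, 0, 0, 1, 1, 1, 0, 1, 0, 1, 0, 0, 1, 0, 1],
      inverseDual := [0, 1, 1, 0, 1, 0, 1, 0, 0, 0, 0, 1, 0, 0, 1, 1, 0, 1] },
    { p := 7, e := 1, n := 9, primes := [2, 3, 19, 37, 1063],
      modulus := [5, 0, 0, 6, 5, 5, 5, 4, 0], witness := [6, 4, 3, 5, 3, 2, 6, 2, 2],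
      inverse := [0, 0, 3, 6, 6, 6, 2, 0, 3], dual := [0, 5, 0, 6, 4, 0, 3, 5, 4],
      inverseDual := [0, 4, 0, 4, 0, 2, 6, 1, 2] }]

/-- Primitive elements for the exceptional pairs with `n = 10`. -/
def pairCertificatesTen : List PairCertificate := [
    { p := 3, e := 1, n := 10, primes := [2, 11, 61], modulus := [1, 0, 1, 2, 0, 0, 1, 2, 1, 0],
      witness := [1, 2, 0, 2, 2, 1, 2, 2, 0, 1], inverse := [0, 2, 1, 0, 0, 2, 1, 2, 0, 1],
      dual := [0, 0, 0, 2, 0, 1, 0, 1, 1, 2], inverseDual := [0, 2, 0, 2, 1, 2, 2, 2, 1, 0] },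
    { p := 11, e := 1, n := 10, primes := [2, 3, 5, 3221, 13421],
      modulus := [3, 0, 8, 4, 9, 9, 0, 9, 9, 0], witness := [8, 1, 4, 7, 9, 0, 8, 1, 3, 8],
      inverse := [0, 1, 6, 8, 8, 0, 8, 8, 0, 4], dual := [0, 1, 7, 0, 10, 5, 8, 3, 9, 7],
      inverseDual := [0, 0, 2, 7, 9, 3, 1, 8, 0, 0] }]

/-- Primitive elements for the exceptional pairs with `n = 11`. -/
def pairCertificatesEleven : List PairCertificate := [
    { p := 2, e := 1, n := 11, primes := [23, 89], modulus := [1, 0, 0, 0, 1, 0, 0, 1, 0, 1, 0],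
      witness := [1, 0, 1, 0, 0, 1, 0, 0, 1, 1, 1], inverse := [0, 0, 0, 1, 0, 0, 1, 0, 1, 0, 1],
      dual := [0, 1, 0, 1, 0, 1, 1, 0, 1, 1, 0], inverseDual := [0, 0, 0, 1, 0, 0, 1, 1, 0, 0, 0] },
    { p := 3, e := 1, n := 11, primes := [2, 23, 3851],
      modulus := [2, 0, 0, 2, 0, 1, 0, 0, 1, 2, 0], witness := [2, 0, 0, 1, 0, 2, 2, 1, 0, 1, 2],
      inverse := [0, 0, 2, 0, 1, 0, 0, 1, 2, 0, 2], dual := [0, 1, 2, 2, 0, 0, 1, 1, 0, 1, 1],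
      inverseDual := [0, 2, 0, 2, 0, 1, 2, 1, 1, 0, 1] }]

/-- Primitive elements for the exceptional pairs with `n = 12`. -/
def pairCertificatesTwelve : List PairCertificate := [
    { p := 5, e := 1, n := 12, primes := [2, 3, 7, 13, 31, 601],
      modulus := [2, 0, 3, 4, 3, 1, 2, 3, 1, 2, 4, 0],
      witness := [2, 0, 4, 3, 3, 1, 2, 2, 0, 0, 2, 4],
      inverse := [0, 1, 3, 1, 2, 4, 1, 2, 4, 3, 0, 3],
      dual := [0, 2, 0, 0, 1, 3, 0, 4, 1, 3, 2, 3],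
      inverseDual := [0, 2, 0, 2, 1, 4, 2, 3, 4, 1, 1, 2] },
    { p := 7, e := 1, n := 12, primes := [2, 3, 5, 13, 19, 43, 181],
      modulus := [4, 0, 2, 2, 0, 3, 6, 3, 6, 2, 3, 0],
      witness := [6, 4, 2, 0, 0, 6, 6, 4, 3, 2, 4, 6],
      inverse := [0, 3, 3, 0, 1, 2, 1, 2, 3, 1, 0, 2],
      dual := [0, 4, 5, 0, 5, 2, 5, 4, 3, 3, 1, 1],
      inverseDual := [0, 2, 0, 5, 0, 6, 0, 3, 1, 5, 0, 1] },
    { p := 13, e := 1, n := 12, primes := [2, 3, 5, 7, 17, 61, 157, 28393],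
      modulus := [7, 0, 0, 10, 0, 7, 7, 2, 4, 5, 1, 0],
      witness := [6, 11, 11, 10, 6, 2, 4, 2, 0, 11, 4, 0],
      inverse := [0, 0, 6, 0, 12, 12, 9, 5, 3, 11, 0, 2],
      dual := [0, 9, 8, 6, 5, 12, 5, 2, 11, 4, 5, 3],
      inverseDual := [0, 6, 5, 0, 9, 2, 5, 7, 12, 12, 3, 10] }]

/-- Primitive elements for the exceptional pairs with `n = 13`. -/
def pairCertificatesThirteen : List PairCertificate := [
    { p := 2, e := 1, n := 13, primes := [8191],
      modulus := [1, 0, 1, 0, 1, 1, 1, 1, 0, 1, 1, 0, 0],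
      witness := [0, 0, 1, 1, 0, 1, 0, 1, 1, 0, 1, 1, 1],
      inverse := [0, 1, 0, 1, 1, 1, 1, 0, 1, 1, 0, 0, 1],
      dual := [0, 1, 0, 1, 1, 1, 1, 1, 0, 1, 1, 0, 1],
      inverseDual := [0, 0, 1, 0, 0, 1, 1, 1, 0, 0, 1, 0, 0] },
    { p := 3, e := 1, n := 13, primes := [2, 797161],
      modulus := [2, 0, 1, 2, 2, 1, 1, 2, 0, 1, 2, 1, 0],
      witness := [0, 0, 2, 1, 0, 0, 2, 1, 2, 0, 0, 2, 0],
      inverse := [0, 1, 2, 2, 1, 1, 2, 0, 1, 2, 1, 0, 2],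
      dual := [0, 2, 2, 0, 1, 0, 2, 0, 1, 0, 2, 1, 1],
      inverseDual := [0, 0, 1, 0, 1, 1, 1, 0, 0, 0, 0, 1, 2] }]

/-- Primitive elements for the exceptional pairs. -/
def pairCertificates : List PairCertificate :=
  pairCertificatesSeven ++ pairCertificatesEight ++ pairCertificatesNine ++ pairCertificatesTen ++
    pairCertificatesEleven ++ pairCertificatesTwelve ++ pairCertificatesThirteen

theorem prime_of_mem_primes {c : PairCertificate} (hc : c ∈ pairCertificates) :
    ∀ l ∈ c.primes, l.Prime := by
  revert c
  simp only [pairCertificates, pairCertificatesSeven, pairCertificatesEight, pairCertificatesNine,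
    pairCertificatesTen, pairCertificatesEleven, pairCertificatesTwelve, pairCertificatesThirteen,
    List.cons_append, List.nil_append, List.forall_mem_cons, List.not_mem_nil, false_imp_iff,
    implies_true, and_true]
  norm_num

set_option maxRecDepth 100000 in
theorem pairCertificatesSeven_all_check :
    pairCertificatesSeven.all PairCertificate.check = true := by
  decide +kernel

set_option maxRecDepth 100000 in
theorem pairCertificatesEight_all_check :
    pairCertificatesEight.all PairCertificate.check = true := by
  decide +kernel

set_option maxRecDepth 100000 in
theorem pairCertificatesNine_all_check :
    pairCertificatesNine.all PairCertificate.check = true := by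
  decide +kernel

set_option maxRecDepth 100000 in
theorem pairCertificatesTen_all_check :
    pairCertificatesTen.all PairCertificate.check = true := by
  decide +kernel

set_option maxRecDepth 100000 in
theorem pairCertificatesEleven_all_check :
    pairCertificatesEleven.all PairCertificate.check = true := by
  decide +kernel

set_option maxRecDepth 100000 in
theorem pairCertificatesTwelve_all_check :
    pairCertificatesTwelve.all PairCertificate.check = true := by
  decide +kernel

set_option maxRecDepth 100000 in
theorem pairCertificatesThirteen_all_check :
    pairCertificatesThirteen.all PairCertificate.check = true := by
  decide +kernel

theorem check_eq_true_of_mem_pairCertificates {c : PairCertificate} (hc : c ∈ pairCertificates) :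
    c.check = true := by
  revert c
  rw [← List.all_eq_true]
  simp only [pairCertificates, List.all_append, pairCertificatesSeven_all_check,
    pairCertificatesEight_all_check, pairCertificatesNine_all_check,
    pairCertificatesTen_all_check, pairCertificatesEleven_all_check,
    pairCertificatesTwelve_all_check, pairCertificatesThirteen_all_check, Bool.and_self]

theorem exists_certificate_of_mem_exceptionalPairs :
    ∀ x ∈ exceptionalPairs, ∃ c ∈ pairCertificates, c.p ^ c.e = x.1 ∧ c.n = x.2 := by
  decide +kernel

end

/-- For `7 ≤ n ≤ 13` and any prime power `q` with `gcd(q, n) = 1` there is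
`α ∈ F_{q^n}^*` such that both `α` and `α⁻¹` are simultaneously primitive and
`1`-normal over `F_q`. -/
theorem exists_primitive_one_normal_pair_of_coprime_of_le_thirteen
    (q n : ℕ) (hq : IsPrimePow q) (hn7 : 7 ≤ n) (hn13 : n ≤ 13)
    (hgcd : Nat.gcd q n = 1)
    (Fq F : Type*) [Field Fq] [Field F] [Fintype Fq] [Fintype F] [Algebra Fq F]
    (hcard : Fintype.card Fq = q) (hdim : Module.finrank Fq F = n) :
    ∃ α : F, α ≠ 0 ∧ orderOf α = q ^ n - 1 ∧ orderOf α⁻¹ = q ^ n - 1 ∧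
      IsKNormal Fq q n 1 α ∧ IsKNormal Fq q n 1 α⁻¹ := by
  by_cases hexc : (q, n) ∈ exceptionalPairs
  · obtain ⟨c, hc, rfl, rfl⟩ := exists_certificate_of_mem_exceptionalPairs (q, n) hexc
    exact exists_primitive_one_normal_pair_of_check c (prime_of_mem_primes hc)
      (check_eq_true_of_mem_pairCertificates hc) Fq F hcard hdim
  · obtain ⟨C, hC, hineq⟩ := exists_sieveInequality hn7 hn13 hq hgcd hexc
    exact exists_primitive_one_normal_pair_of_sieve (by lia) hgcd Fq F hcard hdim hC hineq

end
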